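/- Compactness of the truncated solutions: Let K be a kernel satisfying the global existence assumption with parameters μ, ν, λ = max(μ,ν) > 1, α ≥ 0, φ ∈ Y⁺_{-2α,2λ}, let c₀ ∈ Y⁺_{-α,λ}, and for each integer n ≥ 2 let c^n be the unique nonnegative solution of the truncated system with initial datum c₀·1_{(1/n,n)}, extended by zero outside (1/n,n). Then for every T ∈ (0,∞) there exists a subsequence (n_k) and a map c : [0,T] → Y⁺_{-α,λ} such that: for every bounded measurable g, sup_{t∈[0,T]} |∫₀^∞ g(x)(x^{-α}+x^λ)(c^{n_k}_t(x) − c_t(x)) dx| → 0 as k → ∞ (convergence in C([0,T], weak-Y_{-α,λ})); and the limit t ↦ c_t is strongly continuous in L¹([0,∞), x̂^{-α} dx), indeed Lipschitz: there is C(T) > 0 with ∫₀^∞ |c_t(x) − c_s(x)| x̂^{-α} dx ≤ C(T)(t−s) for 0 ≤ s ≤ t ≤ T. -/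

import Mathlib

open MeasureTheory Set Filter
open scoped ENNReal Topology

noncomputable section

/-- `x̂ := min 1 x` -/
def hatm (x : ℝ) : ℝ := min 1 x

/-- `x̌ := max 1 x` -/
def checkm (x : ℝ) : ℝ := max 1 x

/-- discrete Laplacian `(Δ_z f)(x) = f(x+z) - 2 f(x) + f(x-z)` -/
def dLap (f : ℝ → ℝ) (z x : ℝ) : ℝ := f (x + z) - 2 * f x + f (x - z)

/-- bounded measurable test function -/
def BddMeas (f : ℝ → ℝ) : Prop := Measurable f ∧ ∃ M : ℝ, ∀ x, |f x| ≤ M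

/-- the weighted L¹ norm `‖c‖_{-β,r} = ∫₀^∞ (x^{-β} + x^r) |c x| dx` -/
def Ynorm (β r : ℝ) (c : ℝ → ℝ) : ℝ :=
  ∫ x in Ioi (0:ℝ), (x ^ (-β) + x ^ r) * |c x|

/-- membership in the weighted space `Y_{-β,r}` -/
def MemY (β r : ℝ) (c : ℝ → ℝ) : Prop :=
  Measurable c ∧ IntegrableOn (fun x => (x ^ (-β) + x ^ r) * |c x|) (Ioi (0:ℝ))

/-- membership in the positive cone `Y⁺_{-β,r}` -/
def MemYplus (β r : ℝ) (c : ℝ → ℝ) : Prop :=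
  MemY β r c ∧ ∀ᵐ x ∂(volume.restrict (Ioi (0:ℝ))), 0 ≤ c x

/-- the moment `M_l(c) = ∫₀^∞ x^l c x dx` -/
def Mom (l : ℝ) (c : ℝ → ℝ) : ℝ := ∫ x in Ioi (0:ℝ), x ^ l * c x

/-- finiteness of the `l`-th moment -/
def MomFin (l : ℝ) (c : ℝ → ℝ) : Prop :=
  IntegrableOn (fun x => x ^ l * c x) (Ioi (0:ℝ))

/-- the mixed moment `M_{-α,λ}(c) = ∫₀^∞ x̂^{-α} x̌^λ c x dx` -/
def MomMix (a lam : ℝ) (c : ℝ → ℝ) : ℝ :=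
  ∫ x in Ioi (0:ℝ), hatm x ^ (-a) * checkm x ^ lam * c x

/-- `‖φ‖₀ = ∫₀^∞ φ` -/
def phiNorm0 (φ : ℝ → ℝ) : ℝ := ∫ z in Ioi (0:ℝ), φ z

/-- `‖φ‖_{0,r} = ∫₀^∞ (1 + z^r) φ(z) dz` -/
def phiNorm (r : ℝ) (φ : ℝ → ℝ) : ℝ := ∫ z in Ioi (0:ℝ), (1 + z ^ r) * φ z

/-- a kernel: measurable, nonnegative, symmetric in the first two arguments,
vanishing for `z > x` -/
structure IsKernel (K : ℝ → ℝ → ℝ → ℝ) : Prop where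
  meas : Measurable (fun p : ℝ × ℝ × ℝ => K p.1 p.2.1 p.2.2)
  nonneg : ∀ x y z, 0 ≤ K x y z
  symm : ∀ x y z, K x y z = K y x z
  vanish : ∀ x y z, x < z → K x y z = 0

/-- the domain `D = {(x,y,z) ∈ [0,∞)³ : x ≥ z, y ≥ z}` -/
def Dcgedg : Set (ℝ × ℝ × ℝ) :=
  {p | 0 ≤ p.1 ∧ 0 ≤ p.2.1 ∧ 0 ≤ p.2.2 ∧ p.2.2 ≤ p.1 ∧ p.2.2 ≤ p.2.1}

/-- weak solution of CGEDG with kernel `K`, initial datum `c₀` on `[0,T)`,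
taking values in `Y⁺_{-β,r}`.  Coordinates: `p = (s, x, y, z)`. -/
structure IsWeakSolution (K : ℝ → ℝ → ℝ → ℝ) (β r : ℝ) (T : ℝ≥0∞)
    (c₀ : ℝ → ℝ) (c : ℝ → ℝ → ℝ) : Prop where
  mem : ∀ t : ℝ, 0 ≤ t → ENNReal.ofReal t < T → MemYplus β r (c t)
  cont : ∀ f : ℝ → ℝ, BddMeas f →
    ContinuousOn (fun t => ∫ x in Ioi (0:ℝ), f x * c t x)
      {t : ℝ | 0 ≤ t ∧ ENNReal.ofReal t < T}
  bdd : ∃ C : ℝ, ∀ t : ℝ, 0 ≤ t → ENNReal.ofReal t < T → Ynorm β r (c t) ≤ C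
  integ : ∀ t : ℝ, 0 ≤ t → ENNReal.ofReal t < T →
    IntegrableOn (fun p : ℝ × ℝ × ℝ × ℝ =>
        K p.2.1 p.2.2.1 p.2.2.2 * c p.1 p.2.1 * c p.1 p.2.2.1)
      ((Ioc (0:ℝ) t) ×ˢ Dcgedg)
  weak : ∀ t : ℝ, 0 ≤ t → ENNReal.ofReal t < T → ∀ f : ℝ → ℝ, BddMeas f →
    (∫ x in Ioi (0:ℝ), f x * (c t x - c₀ x)) =
      ∫ p in (Ioc (0:ℝ) t) ×ˢ Dcgedg,
        dLap f p.2.2.2 p.2.1 *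
          (K p.2.1 p.2.2.1 p.2.2.2 * c p.1 p.2.1 * c p.1 p.2.2.1)

/-- the bound on the second derivative of the kernel in its first argument:
`∂₁² K(x,y,z) ≤ ŷ^{-α} y̌^λ φ(z)` for `x ≥ 0` (together with twice
differentiability in the first argument). -/
def SecondDerivBound (K : ℝ → ℝ → ℝ → ℝ) (a lam : ℝ) (φ : ℝ → ℝ) : Prop :=
  ∀ y z, 0 ≤ y → 0 ≤ z → ∀ x, 0 ≤ x →
    DifferentiableWithinAt ℝ (fun w => K w y z) (Ici 0) x ∧
    DifferentiableWithinAt ℝ (derivWithin (fun w => K w y z) (Ici 0)) (Ici 0) x ∧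
    derivWithin (derivWithin (fun w => K w y z) (Ici 0)) (Ici 0) x ≤
      hatm y ^ (-a) * checkm y ^ lam * φ z

/-- the singular bound `(min(1,x-z))^{-α} K(x,y,z) ≤ Cα x̂^{-2α} ŷ^{-α} x̌^λ y̌^λ φ(z)`
for `x ≥ z ≥ 0`. -/
def SingularBound (K : ℝ → ℝ → ℝ → ℝ) (a lam Ca : ℝ) (φ : ℝ → ℝ) : Prop :=
  ∀ x y z, 0 ≤ y → 0 ≤ z → z ≤ x →
    (min 1 (x - z)) ^ (-a) * K x y z ≤
      Ca * hatm x ^ (-(2*a)) * hatm y ^ (-a) * checkm x ^ lam * checkm y ^ lam * φ z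

/-- the global existence assumption (Assumption 1.3) with parameters `μ, ν, α` and
weight `φ`; here `λ = max μ ν`. -/
structure GlobalExistenceAssumption (K : ℝ → ℝ → ℝ → ℝ) (μ ν a : ℝ) (φ : ℝ → ℝ) :
    Prop where
  hμ : μ ∈ Icc (0:ℝ) 2
  hν : ν ∈ Icc (0:ℝ) 2
  hμν : μ + ν ≤ 3
  hlam : 1 < max μ ν
  ha : 0 ≤ a
  hφ : MemYplus (2*a) (2 * max μ ν) φ
  growth : ∀ x y z, 0 ≤ x → 0 ≤ y → 0 ≤ z →
    K x y z ≤ hatm x ^ (-a) * hatm y ^ (-a) *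
      ((checkm x ^ μ * checkm y ^ ν + checkm x ^ ν * checkm y ^ μ) / 2) * φ z
  deriv2 : SecondDerivBound K a (max μ ν) φ
  sing : 0 < a → ∃ Ca > 0, SingularBound K a (max μ ν) Ca φ

/-- the gelation time of a solution on `[0,T)`:
`T_gel = sup { t ∈ [0,T) : M₂(c_t) < ∞ }` (as an extended real). -/
def gelTime (T : ℝ≥0∞) (c : ℝ → ℝ → ℝ) : ℝ≥0∞ :=
  sSup {s : ℝ≥0∞ | ∃ t : ℝ, s = ENNReal.ofReal t ∧ 0 ≤ t ∧
    ENNReal.ofReal t < T ∧ MomFin 2 (c t)}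

/-- the truncated kernel `K_n` -/
def Ktrunc (K : ℝ → ℝ → ℝ → ℝ) (n : ℕ) (x y z : ℝ) : ℝ :=
  if (1/(n:ℝ) < x ∧ x < n) ∧ (1/(n:ℝ) < y ∧ y < n) ∧ (1/(n:ℝ) < z ∧ z < n) ∧
     (0 < x + z ∧ x + z < n) ∧ (0 < y + z ∧ y + z < n) ∧
     1/(n:ℝ) < x - z ∧ 1/(n:ℝ) < y - z
  then K x y z else 0

/-- the right-hand side of the truncated system; coordinates `p = (z, y)`. -/
def truncRHS (K : ℝ → ℝ → ℝ → ℝ) (n : ℕ) (c : ℝ → ℝ) (x : ℝ) : ℝ :=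
  (∫ p in (Ioi (0:ℝ)) ×ˢ (Ioi (0:ℝ)),
      Ktrunc K n p.2 (x - p.1) p.1 * c p.2 * c (x - p.1))
  - (∫ p in (Ioi (0:ℝ)) ×ˢ (Ioi (0:ℝ)),
      Ktrunc K n x p.2 p.1 * c x * c p.2)
  - (∫ p in (Ioi (0:ℝ)) ×ˢ (Ioi (0:ℝ)),
      Ktrunc K n p.2 x p.1 * c p.2 * c x)
  + (∫ p in (Ioi (0:ℝ)) ×ˢ (Ioi (0:ℝ)),
      Ktrunc K n (x + p.1) p.2 p.1 * c (x + p.1) * c p.2)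

/-- classical solution of the truncated system on `L¹((1/n,n))`, extended by zero
outside `(1/n, n)`. -/
structure IsTruncatedSolution (K : ℝ → ℝ → ℝ → ℝ) (n : ℕ) (c : ℝ → ℝ → ℝ) :
    Prop where
  meas : ∀ t : ℝ, Measurable (c t)
  zero_outside : ∀ t : ℝ, ∀ x, x ∉ Ioo (1/(n:ℝ)) (n:ℝ) → c t x = 0
  integrable : ∀ t : ℝ, 0 ≤ t → IntegrableOn (c t) (Ioo (1/(n:ℝ)) (n:ℝ))
  ode : ∀ x ∈ Ioo (1/(n:ℝ)) (n:ℝ), ∀ t : ℝ, 0 ≤ t →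
    HasDerivWithinAt (fun s => c s x) (truncRHS K n (c t) x) (Ici 0) t

/-- de la Vallée-Poussin class `C_VP` -/
structure IsCVP (σ : ℝ → ℝ) : Prop where
  contDiff : ContDiffOn ℝ 2 σ (Ici 0)
  nonneg : ∀ x, 0 ≤ x → 0 ≤ σ x
  convex : ConvexOn ℝ (Ici 0) σ
  zero : σ 0 = 0
  deriv_zero : derivWithin σ (Ici 0) 0 = 0
  deriv_concave : ConcaveOn ℝ (Ici 0) (derivWithin σ (Ici 0))
  deriv_pos : ∀ x, 0 < x → 0 < derivWithin σ (Ici 0) x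
  deriv_top : Tendsto (derivWithin σ (Ici 0)) atTop atTop
  slope_top : Tendsto (fun x => σ x / x) atTop atTop



lemma dens_exists (l : Set ℝ → ℝ) (h0 : ∀ A, MeasurableSet A → 0 ≤ l A)
    (hadd : ∀ A B, MeasurableSet A → MeasurableSet B → Disjoint A B → l (A ∪ B) = l A + l B)
    (hUI : ∀ ε > 0, ∃ δ > 0, ∃ R : ℝ, ∀ A, MeasurableSet A →
      volume (A ∩ Icc (-R) R) ≤ ENNReal.ofReal δ → l A ≤ ε) :
    ∃ f : ℝ → ℝ, Measurable f ∧ (∀ x, 0 ≤ f x) ∧ Integrable f ∧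
      ∀ A, MeasurableSet A → ∫ x in A, f x = l A := by
  have hemp : l ∅ = 0 := by
    have := hadd ∅ ∅ .empty .empty (by simp)
    simp at this; exact this
  have hsum : ∀ (A : ℕ → Set ℝ), (∀ i, MeasurableSet (A i)) → Pairwise (Function.onFun Disjoint A) →
      ∀ n, l (⋃ i, A i) = (∑ i ∈ Finset.range n, l (A i)) + l (⋃ i, A (i + n)) := by
    intro A hA hd n
    induction n with
    | zero => simp
    | succ n ih =>
      have e : (⋃ i, A (i + n)) = A n ∪ ⋃ i, A (i + (n+1)) := by
        ext x; simp only [mem_iUnion, mem_union]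
        constructor
        · rintro ⟨i, hi⟩
          rcases i with _ | i
          · left; simpa using hi
          · right; exact ⟨i, by convert hi using 2; ring⟩
        · rintro (h | ⟨i, hi⟩)
          · exact ⟨0, by simpa using h⟩
          · exact ⟨i+1, by convert hi using 2; ring⟩
      rw [ih, Finset.sum_range_succ, e, hadd _ _ (hA n) (.iUnion fun i => hA _), add_assoc]
      rw [disjoint_iUnion_right]
      intro i
      exact hd (by omega)
  have htail : ∀ (A : ℕ → Set ℝ), (∀ i, MeasurableSet (A i)) → Pairwise (Function.onFun Disjoint A) →
      HasSum (fun i => l (A i)) (l (⋃ i, A i)) := by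
    intro A hA hd
    rw [hasSum_iff_tendsto_nat_of_nonneg (fun i => h0 _ (hA i))]
    have e : (fun n => ∑ i ∈ Finset.range n, l (A i)) =
        fun n => l (⋃ i, A i) - l (⋃ i, A (i + n)) := by
      funext n; rw [hsum A hA hd n]; ring
    rw [e]
    have : Tendsto (fun n => l (⋃ i, A (i + n))) atTop (𝓝 0) := by
      rw [Metric.tendsto_atTop]
      intro ε hε
      obtain ⟨δ, hδ, R, h⟩ := hUI (ε/2) (by positivity)
      have ht : Tendsto (fun n => volume ((⋃ i, A (i + n)) ∩ Icc (-R) R)) atTop (𝓝 0) := by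
        have := tendsto_measure_iInter_atTop (μ := (volume : Measure ℝ))
          (s := fun n => (⋃ i, A (i + n)) ∩ Icc (-R) R)
          (fun n => ((MeasurableSet.iUnion fun i => hA _).inter measurableSet_Icc).nullMeasurableSet)
          (by
            intro m n hmn
            apply inter_subset_inter_left
            apply iUnion_subset
            intro i
            obtain ⟨k, rfl⟩ := Nat.exists_eq_add_of_le hmn
            refine subset_trans ?_ (subset_iUnion _ (i + k))
            apply subset_of_eq; congr 1; ring)
          ⟨0, ((measure_mono inter_subset_right).trans_lt (by simp)).ne⟩
        have hz : (⋂ n, (⋃ i, A (i + n)) ∩ Icc (-R) R) = ∅ := ?_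
        · rw [hz, measure_empty] at this; exact this
        rw [eq_empty_iff_forall_notMem]
        intro x hx
        simp only [mem_iInter, mem_inter_iff, mem_iUnion] at hx
        obtain ⟨i, hi⟩ := (hx 0).1
        obtain ⟨j, hj⟩ := (hx (i+1)).1
        exact (Set.disjoint_left.1 (hd (show i + 0 ≠ j + (i+1) by omega))) hi hj
      obtain ⟨N, hN⟩ := (ht.eventually (Iic_mem_nhds (show (0:ℝ≥0∞) < ENNReal.ofReal δ by simpa using hδ))).exists_forall_of_atTop
      refine ⟨N, fun n hn => ?_⟩
      have h1 := h _ (MeasurableSet.iUnion fun i => hA (i + n)) (hN n hn)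
      have h2 := h0 _ (MeasurableSet.iUnion fun i => hA (i + n))
      rw [Real.dist_eq, sub_zero, abs_of_nonneg h2]; linarith
    simpa using this.const_sub (l (⋃ i, A i))
  let m : Measure ℝ := Measure.ofMeasurable (fun A _ => ENNReal.ofReal (l A)) (by simp [hemp]) (by
    intro A hA hd
    have := htail A hA hd
    rw [← this.tsum_eq, ENNReal.ofReal_tsum_of_nonneg (fun i => h0 _ (hA i)) this.summable])
  have hm : ∀ A, MeasurableSet A → m A = ENNReal.ofReal (l A) := fun A hA =>
    Measure.ofMeasurable_apply A hA
  have : IsFiniteMeasure m := ⟨by rw [hm _ .univ]; exact ENNReal.ofReal_lt_top⟩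
  have hac : m ≪ volume := by
    refine Measure.AbsolutelyContinuous.mk fun A hA h => ?_
    rw [hm A hA, ENNReal.ofReal_eq_zero]
    refine le_of_forall_pos_le_add fun ε hε => ?_
    obtain ⟨δ, hδ, R, h'⟩ := hUI ε hε
    have := h' A hA (by rw [measure_mono_null inter_subset_left h]; simp)
    linarith
  refine ⟨fun x => (m.rnDeriv volume x).toReal, (Measure.measurable_rnDeriv _ _).ennreal_toReal,
    fun x => ENNReal.toReal_nonneg, Measure.integrable_toReal_rnDeriv, fun A hA => ?_⟩
  rw [Measure.setIntegral_toReal_rnDeriv hac, Measure.real, hm A hA, ENNReal.toReal_ofReal (h0 A hA)]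

lemma abs_compact (T : ℝ) (hT : 0 < T) (F : ℕ → ℝ → ℝ → ℝ)
    (hint : ∀ n, ∀ t ∈ Icc 0 T, Integrable (F n t))
    (hnn : ∀ n, ∀ t ∈ Icc 0 T, ∀ x, 0 ≤ F n t x) (M : ℝ)
    (hM : ∀ n, ∀ t ∈ Icc 0 T, ∫ x, F n t x ≤ M)
    (hUI : ∀ ε > 0, ∃ δ > 0, ∃ R : ℝ, ∃ N : ℕ, ∀ n ≥ N, ∀ t ∈ Icc 0 T, ∀ A, MeasurableSet A →
      volume (A ∩ Icc (-R) R) ≤ ENNReal.ofReal δ → ∫ x in A, F n t x ≤ ε)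
    (hEC : ∀ ε > 0, ∃ η > 0, ∃ N : ℕ, ∀ n ≥ N, ∀ s ∈ Icc 0 T, ∀ t ∈ Icc 0 T, |t - s| ≤ η →
      ∀ A, MeasurableSet A → |(∫ x in A, F n t x) - ∫ x in A, F n s x| ≤ ε) :
    ∃ ns : ℕ → ℕ, StrictMono ns ∧ ∃ f : ℝ → ℝ → ℝ,
      (∀ t ∈ Icc 0 T, Measurable (f t) ∧ (∀ x, 0 ≤ f t x) ∧ Integrable (f t)) ∧
      ∀ A, MeasurableSet A → ∀ ε > 0, ∃ k0, ∀ k ≥ k0, ∀ t ∈ Icc 0 T,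
        |(∫ x in A, F (ns k) t x) - ∫ x in A, f t x| ≤ ε := by
  obtain ⟨𝒜, hc, hd⟩ := exists_countable_measureDense (μ := (volume : Measure ℝ))
  let cl : ℚ → ℝ := fun q => max 0 (min (q:ℝ) T)
  have hcl : ∀ q, cl q ∈ Icc 0 T := fun q =>
    ⟨le_max_left _ _, max_le hT.le (min_le_right _ _)⟩
  have : Countable 𝒜 := hc.to_subtype
  have hle : ∀ n, ∀ t ∈ Icc 0 T, ∀ A, MeasurableSet A → (∫ x in A, F n t x) ∈ Icc 0 M := by
    intro n t ht A hA
    exact ⟨setIntegral_nonneg hA fun x _ => hnn n t ht x,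
      (setIntegral_le_integral (hint n t ht) (ae_of_all _ (hnn n t ht))).trans (hM n t ht)⟩
  let U : ℕ → (𝒜 × ℚ → Icc (0:ℝ) M) := fun n p =>
    ⟨∫ x in (p.1 : Set ℝ), F n (cl p.2) x, hle n _ (hcl p.2) _ (hd.measurable _ p.1.2)⟩
  obtain ⟨a, ns, hns, hlim⟩ := CompactSpace.tendsto_subseq U
  have hlim' : ∀ A ∈ 𝒜, ∀ q : ℚ, CauchySeq (fun k => ∫ x in A, F (ns k) (cl q) x) := by
    intro A hA q
    have h1 := (tendsto_pi_nhds.1 hlim) (⟨A, hA⟩, q)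
    have h2 := (continuous_subtype_val.tendsto _).comp h1
    exact h2.cauchySeq
  have hsd : ∀ n, ∀ t ∈ Icc 0 T, ∀ A B, MeasurableSet A → MeasurableSet B → ∀ ε,
      ∫ x in (symmDiff A B), F n t x ≤ ε → |(∫ x in A, F n t x) - ∫ x in B, F n t x| ≤ ε := by
    intro n t ht A B hA hB ε h
    have hI := fun S : Set ℝ => (hint n t ht).integrableOn (s := S)
    have e1 : ∀ A B : Set ℝ, MeasurableSet A → MeasurableSet B →
        (∫ x in A, F n t x) - ∫ x in B, F n t x ≤ ∫ x in (symmDiff A B), F n t x := by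
      intro A B hA hB
      have h1 : (∫ x in A, F n t x) ≤ ∫ x in (symmDiff A B) ∪ B, F n t x := by
        refine setIntegral_mono_set (hI _) (ae_of_all _ fun x => hnn n t ht x) ?_
        refine LE.le.eventuallyLE fun x hx => ?_
        by_cases hxB : x ∈ B
        · right; exact hxB
        · left; left; exact ⟨hx, hxB⟩
      have h2 : (∫ x in (symmDiff A B) ∪ B, F n t x) ≤
          (∫ x in (symmDiff A B), F n t x) + ∫ x in B, F n t x := by
        have e : (symmDiff A B) ∪ B = (symmDiff A B \ B) ∪ B := by rw [Set.sdiff_union_self]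
        rw [e, setIntegral_union disjoint_sdiff_left hB (hI _) (hI _)]
        gcongr
        · exact ae_of_all _ fun x => hnn n t ht x
        · exact hI _
        · exact Set.sdiff_subset
      linarith
    rw [abs_le]
    have := e1 A B hA hB
    have h3 := e1 B A hB hA
    rw [symmDiff_comm] at h3
    constructor <;> linarith
  have hcau : ∀ A, MeasurableSet A → ∀ ε > 0, ∃ k0, ∀ k ≥ k0, ∀ l ≥ k0, ∀ t ∈ Icc 0 T,
      |(∫ x in A, F (ns k) t x) - ∫ x in A, F (ns l) t x| ≤ ε := by
    intro A hA ε hε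
    obtain ⟨δ, hδ, R, N1, hU⟩ := hUI (ε/5) (by positivity)
    obtain ⟨B, hB, hAB⟩ := hd.approx (A ∩ Icc (-R) R) (hA.inter measurableSet_Icc)
      ((measure_mono inter_subset_right).trans_lt (by simp)).ne δ hδ
    have hBm := hd.measurable _ hB
    have hclose : ∀ n ≥ N1, ∀ t ∈ Icc 0 T, |(∫ x in A, F n t x) - ∫ x in B, F n t x| ≤ ε/5 := by
      intro n hn t ht
      refine hsd n t ht A B hA hBm _ (hU n hn t ht _ (hA.symmDiff hBm) (le_trans ?_ hAB.le))
      refine measure_mono ?_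
      rintro x ⟨hx | hx, hR⟩
      · left; exact ⟨⟨hx.1, hR⟩, hx.2⟩
      · right; exact ⟨hx.1, fun h => hx.2 h.1⟩
    obtain ⟨η, hη, N2, hE⟩ := hEC (ε/5) (by positivity)
    obtain ⟨m, hm⟩ := exists_nat_one_div_lt hη
    have hm0 : (0:ℝ) < (m:ℝ) + 1 := by positivity
    have hgrid : ∀ᶠ k in atTop, ∀ j ∈ Finset.range (⌊T * (m+1)⌋₊ + 1), ∀ l ≥ k, 
        |(∫ x in B, F (ns k) (cl ((j:ℚ)/((m:ℚ)+1))) x) - ∫ x in B, F (ns l) (cl ((j:ℚ)/((m:ℚ)+1))) x| ≤ ε/10 := by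
      rw [Filter.eventually_all_finset]
      intro j _
      obtain ⟨k0, hk0⟩ := Metric.cauchySeq_iff.1 (hlim' B hB ((j:ℚ)/((m:ℚ)+1))) (ε/10) (by positivity)
      filter_upwards [eventually_ge_atTop k0] with k hk l hl
      exact (hk0 k hk l (hk.trans hl)).le
    obtain ⟨k1, hk1⟩ := hgrid.exists_forall_of_atTop
    refine ⟨max k1 (max N1 N2), fun k hk l hl t ht => ?_⟩
    have hk' : k1 ≤ k := (le_max_left _ _).trans hk
    have hl' : k1 ≤ l := (le_max_left _ _).trans hl
    have hkN1 : N1 ≤ ns k := ((le_max_left _ _).trans ((le_max_right _ _).trans hk)).trans (hns.id_le k)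
    have hlN1 : N1 ≤ ns l := ((le_max_left _ _).trans ((le_max_right _ _).trans hl)).trans (hns.id_le l)
    have hkN2 : N2 ≤ ns k := ((le_max_right _ _).trans ((le_max_right _ _).trans hk)).trans (hns.id_le k)
    have hlN2 : N2 ≤ ns l := ((le_max_right _ _).trans ((le_max_right _ _).trans hl)).trans (hns.id_le l)
    set j := ⌊t * (m+1)⌋₊ with hj
    have hjr : j ∈ Finset.range (⌊T * (m+1)⌋₊ + 1) := by
      rw [Finset.mem_range, Nat.lt_succ_iff]
      exact Nat.floor_le_floor (by gcongr; exact ht.2)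
    have hj1 : (j:ℝ) ≤ t * (m+1) := Nat.floor_le (by have := ht.1; positivity)
    have hj2 : t * (m+1) < j + 1 := Nat.lt_floor_add_one _
    have hjd : (j:ℝ)/(m+1) ≤ t := by rw [div_le_iff₀ hm0]; exact hj1
    have hclj : cl ((j:ℚ)/((m:ℚ)+1)) = (j:ℝ)/(m+1) := by
      simp only [cl]; push_cast
      rw [min_eq_left (hjd.trans ht.2), max_eq_right (by positivity)]
    have hts : |t - cl ((j:ℚ)/((m:ℚ)+1))| ≤ η := by
      rw [hclj, abs_of_nonneg (by linarith)]
      have : t - (j:ℝ)/(m+1) ≤ 1/(m+1) := by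
        rw [sub_le_iff_le_add, ← add_div, le_div_iff₀ hm0]; linarith
      linarith
    have g1 := hclose _ hkN1 t ht
    have g2 := hclose _ hlN1 t ht
    have g3 := hE _ hkN2 _ (hcl _) t ht hts B hBm
    have g4 := hE _ hlN2 _ (hcl _) t ht hts B hBm
    have g5 := hk1 k1 le_rfl j hjr k hk'
    have g6 := hk1 k1 le_rfl j hjr l hl'
    rw [abs_le] at *
    constructor <;> linarith [g1.1, g1.2, g2.1, g2.2, g3.1, g3.2, g4.1, g4.2, g5.1, g5.2, g6.1, g6.2]
  have hl : ∀ t ∈ Icc 0 T, ∀ A, MeasurableSet A → ∃ l, Tendsto (fun k => ∫ x in A, F (ns k) t x) atTop (𝓝 l) := by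
    intro t ht A hA
    refine cauchySeq_tendsto_of_complete (Metric.cauchySeq_iff.2 fun ε hε => ?_)
    obtain ⟨k0, h⟩ := hcau A hA (ε/2) (by positivity)
    exact ⟨k0, fun k hk l hl => (h k hk l hl t ht).trans_lt (by linarith)⟩
  have hf : ∀ t ∈ Icc 0 T, ∃ f : ℝ → ℝ, Measurable f ∧ (∀ x, 0 ≤ f x) ∧ Integrable f ∧
      ∀ A, MeasurableSet A → Tendsto (fun k => ∫ x in A, F (ns k) t x) atTop (𝓝 (∫ x in A, f x)) := by
    intro t ht
    choose! l hl using hl t ht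
    obtain ⟨f, h1, h2, h3, h4⟩ := dens_exists l
      (fun A hA => ge_of_tendsto' (hl A hA) fun k => (hle _ t ht A hA).1)
      (by
        intro A B hA hB hAB
        refine tendsto_nhds_unique (hl _ (hA.union hB)) ?_
        have := (hl A hA).add (hl B hB)
        refine this.congr fun k => ?_
        rw [setIntegral_union hAB hB (hint _ t ht).integrableOn (hint _ t ht).integrableOn])
      (by
        intro ε hε
        obtain ⟨δ, hδ, R, N, h⟩ := hUI ε hε
        refine ⟨δ, hδ, R, fun A hA hv => le_of_tendsto (hl A hA) ?_⟩
        filter_upwards [eventually_ge_atTop N] with k hk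
        exact h _ (hk.trans (hns.id_le k)) t ht A hA hv)
    exact ⟨f, h1, h2, h3, fun A hA => by rw [h4 A hA]; exact hl A hA⟩
  choose! f hf1 hf2 hf3 hf4 using hf
  refine ⟨ns, hns, f, fun t ht => ⟨hf1 t ht, hf2 t ht, hf3 t ht⟩, fun A hA ε hε => ?_⟩
  obtain ⟨k0, h⟩ := hcau A hA ε hε
  refine ⟨k0, fun k hk t ht => ?_⟩
  refine le_of_tendsto ((hf4 t ht A hA).const_sub _).abs ?_
  filter_upwards [eventually_ge_atTop k0] with l hl
  exact h k hk l hl t ht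

/-- uniform approximation extension to bounded measurable functions -/
lemma conv_bdd (T : ℝ) (F : ℕ → ℝ → ℝ → ℝ) (f : ℝ → ℝ → ℝ)
    (hint : ∀ n, ∀ t ∈ Icc 0 T, Integrable (F n t))
    (hnn : ∀ n, ∀ t ∈ Icc 0 T, ∀ x, 0 ≤ F n t x)
    (hf : ∀ t ∈ Icc 0 T, Measurable (f t) ∧ (∀ x, 0 ≤ f t x) ∧ Integrable (f t))
    (M : ℝ) (hM0 : 0 ≤ M) (hM : ∀ n, ∀ t ∈ Icc 0 T, ∫ x, F n t x ≤ M)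
    (hc : ∀ A, MeasurableSet A → ∀ ε > 0, ∃ k0, ∀ k ≥ k0, ∀ t ∈ Icc 0 T,
        |(∫ x in A, F k t x) - ∫ x in A, f t x| ≤ ε)
    (g : ℝ → ℝ) (hg : Measurable g) (L : ℝ) (hL : ∀ x, |g x| ≤ L) :
    ∀ ε > 0, ∃ k0, ∀ k ≥ k0, ∀ t ∈ Icc 0 T, |∫ x, g x * (F k t x - f t x)| ≤ ε := by
  intro ε hε
  have hLnn : 0 ≤ L := (abs_nonneg _).trans (hL 0)
  -- mesh
  obtain ⟨m, hm⟩ := exists_nat_one_div_lt (show 0 < ε / (2 * (2 * M + 1)) by positivity)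
  set h : ℝ := 1/((m:ℝ)+1) with hh
  have hpos : 0 < h := by positivity
  let J : Finset ℤ := Finset.Icc ⌊-L/h⌋ ⌊L/h⌋
  let S : ℤ → Set ℝ := fun j => {x | ⌊g x / h⌋ = j}
  have hS : ∀ j, MeasurableSet (S j) := fun j =>
    (Int.measurable_floor.comp (hg.div_const h)) (measurableSet_singleton j)
  let gs : ℝ → ℝ := fun x => h * ⌊g x / h⌋
  have hgs : ∀ x, gs x = ∑ j ∈ J, (h * j) * (S j).indicator 1 x := by
    intro x
    have hxJ : ⌊g x / h⌋ ∈ J := by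
      rw [Finset.mem_Icc]
      have := abs_le.1 (hL x)
      constructor <;> apply Int.floor_le_floor <;> gcongr
      · exact this.1
      · exact this.2
    rw [Finset.sum_eq_single_of_mem _ hxJ]
    · simp [gs, S]
    · intro j _ hj
      have : x ∉ S j := fun h' => hj h'.symm
      simp [this]
  have hgd : ∀ x, |g x - gs x| ≤ h := by
    intro x
    have h1 := Int.floor_le (g x / h)
    have h2 := Int.lt_floor_add_one (g x / h)
    rw [le_div_iff₀ hpos] at h1
    rw [div_lt_iff₀ hpos] at h2
    simp only [gs]
    rw [abs_le]; constructor <;> nlinarith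
  have hgsm : Measurable gs := by
    have : Measurable (fun x => ((⌊g x / h⌋ : ℤ) : ℝ)) :=
      (measurable_of_countable (fun j : ℤ => (j:ℝ))).comp
        (Int.measurable_floor.comp (hg.div_const h))
    exact this.const_mul h
  -- convergence for simple part
  have hsimp : ∀ᶠ k in atTop, ∀ j ∈ J, ∀ t ∈ Icc 0 T,
      |(∫ x in S j, F k t x) - ∫ x in S j, f t x| ≤ ε / (2 * (1 + ∑ j ∈ J, |h * j|)) := by
    rw [Filter.eventually_all_finset]
    intro j _
    obtain ⟨k0, hk⟩ := hc (S j) (hS j) (ε / (2 * (1 + ∑ j ∈ J, |h * j|)))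
      (by have : 0 ≤ ∑ j ∈ J, |h * (j:ℝ)| := Finset.sum_nonneg fun _ _ => abs_nonneg _
          positivity)
    filter_upwards [eventually_ge_atTop k0] with k hk'
    exact hk k hk'
  obtain ⟨k1, hk1⟩ := hsimp.exists_forall_of_atTop
  have hfM : ∀ t ∈ Icc 0 T, ∫ x, f t x ≤ M := by
    intro t ht
    refine le_of_forall_pos_le_add fun e he => ?_
    obtain ⟨k0, h0⟩ := hc univ .univ e he
    have := (abs_le.1 (h0 k0 le_rfl t ht)).1
    simp only [Measure.restrict_univ] at this
    linarith [hM k0 t ht]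
  refine ⟨k1, fun k hk t ht => ?_⟩
  have hFi := hint k t ht
  obtain ⟨hfm, hf0, hfi⟩ := hf t ht
  have hdi := hFi.sub hfi
  have hdi' : Integrable (fun x => F k t x - f t x) := hdi
  have i1 : Integrable (fun x => (g x - gs x) * (F k t x - f t x)) :=
    hdi'.bdd_mul (hg.sub hgsm).aestronglyMeasurable (ae_of_all _ fun x => by
      rw [Real.norm_eq_abs]; exact hgd x)
  have i2 : ∀ j ∈ J, Integrable (fun x => (h * j) * (S j).indicator 1 x * (F k t x - f t x)) := by
    intro j _
    have : (fun x => (h * j) * (S j).indicator (1 : ℝ → ℝ) x * (F k t x - f t x)) =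
        fun x => (h * j) * (S j).indicator (fun x => F k t x - f t x) x := by
      funext x; by_cases hx : x ∈ S j <;> simp [hx]
    rw [this]
    exact (hdi'.indicator (hS j)).const_mul _
  have e : ∫ x, g x * (F k t x - f t x) = (∫ x, (g x - gs x) * (F k t x - f t x)) +
      ∑ j ∈ J, (h * j) * ((∫ x in S j, F k t x) - ∫ x in S j, f t x) := by
    have e2 : ∀ j ∈ J, (h * j) * ((∫ x in S j, F k t x) - ∫ x in S j, f t x) =
        ∫ x, (h * j) * (S j).indicator 1 x * (F k t x - f t x) := by
      intro j _
      rw [← integral_sub hFi.integrableOn hfi.integrableOn, ← integral_indicator (hS j),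
        ← integral_const_mul]
      congr 1; funext x; by_cases hx : x ∈ S j <;> simp [hx]
    rw [Finset.sum_congr rfl e2, ← integral_finsetSum _ i2, ← integral_add i1 (integrable_finsetSum _ i2)]
    congr 1; funext x
    rw [← Finset.sum_mul, ← hgs]; ring
  rw [e]
  have b1 : |∫ x, (g x - gs x) * (F k t x - f t x)| ≤ ε / 2 := by
    calc |∫ x, (g x - gs x) * (F k t x - f t x)| ≤ ∫ x, |(g x - gs x) * (F k t x - f t x)| :=
          abs_integral_le_integral_abs
      _ ≤ ∫ x, h * (F k t x + f t x) := by
          refine integral_mono i1.abs ((hFi.add hfi).const_mul h) fun x => ?_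
          simp only [abs_mul]
          have := hnn k t ht x
          have := hf0 x
          gcongr
          · exact hgd x
          · rw [abs_le]; constructor <;> linarith
      _ = h * ((∫ x, F k t x) + ∫ x, f t x) := by
          rw [integral_const_mul, integral_add hFi hfi]
      _ ≤ h * (2 * M + 1) := by
          refine mul_le_mul_of_nonneg_left ?_ hpos.le
          linarith [hM k t ht, hfM t ht]
      _ ≤ ε / (2 * (2 * M + 1)) * (2 * M + 1) := by gcongr
      _ = ε / 2 := by field_simp
  have hs0 : 0 ≤ ∑ j ∈ J, |h * (j:ℝ)| := Finset.sum_nonneg fun _ _ => abs_nonneg _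
  have b2 : |∑ j ∈ J, (h * j) * ((∫ x in S j, F k t x) - ∫ x in S j, f t x)| ≤ ε / 2 := by
    calc _ ≤ ∑ j ∈ J, |(h * j) * ((∫ x in S j, F k t x) - ∫ x in S j, f t x)| :=
          Finset.abs_sum_le_sum_abs _ _
      _ ≤ ∑ j ∈ J, |h * (j:ℝ)| * (ε / (2 * (1 + ∑ j ∈ J, |h * j|))) := by
          refine Finset.sum_le_sum fun j hj => ?_
          rw [abs_mul]; gcongr; exact hk1 k hk j hj t ht
      _ = (∑ j ∈ J, |h * (j:ℝ)|) * (ε / (2 * (1 + ∑ j ∈ J, |h * j|))) := by rw [Finset.sum_mul]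
      _ ≤ (1 + ∑ j ∈ J, |h * (j:ℝ)|) * (ε / (2 * (1 + ∑ j ∈ J, |h * j|))) := by gcongr; linarith
      _ = ε / 2 := by field_simp
  calc _ ≤ _ := abs_add_le _ _
    _ ≤ ε := by linarith


lemma gron (T B E : ℝ) (hT : 0 < T) (hB : 0 < B) (hE : 0 ≤ E) (m D : ℝ → ℝ)
    (hm0 : ∀ t ∈ Icc 0 T, 0 ≤ m t) (hb : ∃ M, ∀ t ∈ Icc 0 T, m t ≤ M)
    (hD : ∀ t ∈ Icc 0 T, IntervalIntegrable D volume 0 t ∧ m t - m 0 = ∫ s in (0:ℝ)..t, D s)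
    (hle : ∀ t ∈ Icc 0 T, D t ≤ B * m t + E) :
    ∀ t ∈ Icc 0 T, m t ≤ 2 * (m 0 + E * T) * Real.exp (2 * B * T) := by
  obtain ⟨M, hM⟩ := hb
  let f : ℝ → ℝ := fun t => Real.exp (-(2*B*t)) * m t
  have h0T : (0:ℝ) ∈ Icc 0 T := ⟨le_rfl, hT.le⟩
  have hbdd : BddAbove (f '' Icc 0 T) := by
    refine ⟨M, ?_⟩
    rintro _ ⟨t, ht, rfl⟩
    have h1 : Real.exp (-(2*B*t)) ≤ 1 := by
      rw [Real.exp_le_one_iff]; have := ht.1; have : 0 ≤ 2 * B * t := by positivity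
      linarith
    have := hm0 t ht
    exact (mul_le_of_le_one_left this h1).trans (hM t ht)
  set S := sSup (f '' Icc 0 T) with hS
  have hfS : ∀ t ∈ Icc 0 T, f t ≤ S := fun t ht => le_csSup hbdd ⟨t, ht, rfl⟩
  have hmS : ∀ t ∈ Icc 0 T, m t ≤ S * Real.exp (2*B*t) := by
    intro t ht
    have := hfS t ht
    simp only [f] at this
    rw [Real.exp_neg, inv_mul_le_iff₀ (Real.exp_pos _)] at this
    linarith
  have hm00 := hm0 0 h0T
  have hS0 : 0 ≤ S := by
    have := hfS 0 h0T; simp only [f] at this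
    have h2 : 0 ≤ Real.exp (-(2*B*0)) * m 0 := by positivity
    linarith
  have key : ∀ t ∈ Icc 0 T, m t ≤ m 0 + E * T + S / 2 * Real.exp (2*B*t) := by
    intro t ht
    obtain ⟨hi, he⟩ := hD t ht
    have hle2 : ∫ s in (0:ℝ)..t, D s ≤ ∫ s in (0:ℝ)..t, (B * S * Real.exp (2*B*s) + E) := by
      refine intervalIntegral.integral_mono_on ht.1 hi (by
        apply Continuous.intervalIntegrable; fun_prop) fun s hs => ?_
      have hs' : s ∈ Icc 0 T := ⟨hs.1, hs.2.trans ht.2⟩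
      have := hle s hs'
      have h2 := hmS s hs'
      nlinarith
    have hF : ∫ s in (0:ℝ)..t, (B * S * Real.exp (2*B*s) + E) =
        (S / 2 * Real.exp (2*B*t) + E * t) - (S / 2 * Real.exp (2*B*0) + E * 0) := by
      refine intervalIntegral.integral_eq_sub_of_hasDerivAt
        (f := fun s => S / 2 * Real.exp (2*B*s) + E * s) (fun s _ => ?_) (by
        apply Continuous.intervalIntegrable; fun_prop)
      have h1 : HasDerivAt (fun s : ℝ => 2*B*s) (2*B) s := by
        simpa using (hasDerivAt_id s).const_mul (2*B)
      have h2 := (h1.exp.const_mul (S/2)).add ((hasDerivAt_id s).const_mul E)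
      exact h2.congr_deriv (by ring)
    simp at hF
    have := ht.2
    nlinarith
  have hS2 : S ≤ m 0 + E * T + S / 2 := by
    refine csSup_le ⟨_, 0, h0T, rfl⟩ ?_
    rintro _ ⟨t, ht, rfl⟩
    have := key t ht
    simp only [f]
    rw [Real.exp_neg, inv_mul_le_iff₀ (Real.exp_pos _)]
    have h1 : 1 ≤ Real.exp (2*B*t) := by
      rw [Real.one_le_exp_iff]; have := ht.1; positivity
    have h3 : 0 ≤ m 0 + E * T := by positivity
    nlinarith
  intro t ht
  have h4 : Real.exp (2*B*t) ≤ Real.exp (2*B*T) := by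
    apply Real.exp_le_exp.2; have := ht.2; gcongr
  calc m t ≤ S * Real.exp (2*B*t) := hmS t ht
    _ ≤ (2 * (m 0 + E * T)) * Real.exp (2*B*T) := by
      gcongr; linarith

lemma deriv_le_lip (f f' : ℝ → ℝ) (p q B : ℝ) (hd : ∀ u ∈ Icc p q, HasDerivAt f (f' u) u)
    (hB : ∀ u ∈ Icc p q, f' u ≤ B) : ∀ u ∈ Icc p q, ∀ v ∈ Icc p q, u ≤ v → f v - f u ≤ B * (v - u) := by
  intro u hu v hv huv
  have : AntitoneOn (fun w => f w - B * w) (Icc p q) := by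
    have hd' : ∀ w ∈ Icc p q, HasDerivAt (fun w => f w - B * w) (f' w - B) w := by
      intro w hw
      exact ((hd w hw).sub ((hasDerivAt_id w).const_mul B)).congr_deriv (by simp)
    refine antitoneOn_of_deriv_nonpos (convex_Icc _ _)
      (fun w hw => (hd' w hw).continuousAt.continuousWithinAt)
      (fun w hw => (hd' w (interior_subset hw)).differentiableAt.differentiableWithinAt)
      fun w hw => ?_
    rw [(hd' w (interior_subset hw)).deriv]
    linarith [hB w (interior_subset hw)]
  have := this hu hv huv
  simp only at this
  linarith

lemma second_diff (f f' f'' : ℝ → ℝ) (x z B : ℝ) (hz : 0 ≤ z)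
    (h1 : ∀ u ∈ Icc (x-z) (x+z), HasDerivAt f (f' u) u)
    (h2 : ∀ u ∈ Icc (x-z) (x+z), HasDerivAt f' (f'' u) u)
    (hB : ∀ u ∈ Icc (x-z) (x+z), f'' u ≤ B) :
    f (x+z) + f (x-z) - 2 * f x ≤ B * z^2 := by
  have hl := deriv_le_lip f' f'' (x-z) (x+z) B h2 hB
  have hG : ∀ s ∈ Icc 0 z, HasDerivAt (fun s => f (x+s) + f (x-s) - B * s^2)
      (f' (x+s) - f' (x-s) - B * (2 * s)) s := by
    intro s hs
    have e1 : HasDerivAt (fun s => f (x+s)) (f' (x+s)) s := by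
      have := (h1 (x+s) ⟨by linarith [hs.1], by linarith [hs.2]⟩).comp s ((hasDerivAt_id s).const_add x)
      simpa [Function.comp_def] using this
    have e2 : HasDerivAt (fun s => f (x-s)) (-f' (x-s)) s := by
      have := (h1 (x-s) ⟨by linarith [hs.2], by linarith [hs.1]⟩).comp s ((hasDerivAt_id s).const_sub x)
      simpa [Function.comp_def] using this
    have e3 : HasDerivAt (fun s : ℝ => B * s^2) (B * (2*s)) s := by
      simpa using (hasDerivAt_pow 2 s).const_mul B
    exact ((e1.add e2).sub e3).congr_deriv (by ring)
  have := deriv_le_lip _ _ 0 z 0 hG (fun s hs => by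
    have := hl (x-s) ⟨by linarith [hs.2], by linarith [hs.1, hs.2]⟩ (x+s)
      ⟨by linarith [hs.2, hs.1], by linarith [hs.2]⟩ (by linarith [hs.1])
    linarith) 0 ⟨le_rfl, hz⟩ z ⟨hz, le_rfl⟩ hz
  simp at this
  linarith

/-- the tail test function -/
def fR (lam R x : ℝ) : ℝ := x ^ lam * (x / (x + R))

lemma fR_nonneg (lam R x : ℝ) (hR : 0 ≤ R) (hx : 0 ≤ x) : 0 ≤ fR lam R x := by
  unfold fR; positivity

lemma fR_scale (lam R x k u : ℝ) (h2 : lam ≤ 2) (h1 : 1 < lam) (hR : 0 ≤ R) (hx : 0 < x) (hk : 1 ≤ k)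
    (hu : 0 < u) (huk : u ≤ k * x) : fR lam R u ≤ k^3 * fR lam R x := by
  unfold fR
  have e1 : u ^ lam ≤ k^2 * x ^ lam := by
    calc u ^ lam ≤ (k*x) ^ lam := by gcongr
      _ = k^lam * x^lam := by rw [Real.mul_rpow (by positivity) hx.le]
      _ ≤ k^2 * x^lam := by
        gcongr
        calc k ^ lam ≤ k ^ (2:ℝ) := Real.rpow_le_rpow_of_exponent_le hk h2
          _ = k^2 := by norm_cast
  have e2 : u / (u + R) ≤ k * (x / (x+R)) := by
    rw [← mul_div_assoc, div_le_div_iff₀ (by positivity) (by positivity)]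
    have : u * R ≤ k * x * R := by gcongr
    nlinarith [mul_pos hu hx, mul_nonneg (mul_nonneg (sub_nonneg.2 hk) hu.le) hx.le]
  calc u ^ lam * (u/(u+R)) ≤ (k^2 * x ^ lam) * (k * (x / (x+R))) := by gcongr
    _ = _ := by ring

lemma fR_lap (lam R x z : ℝ) (h2 : lam ≤ 2) (h1 : 1 < lam) (hR : 0 ≤ R) (hz : 0 < z) (hzx : z < x) :
    fR lam R (x+z) + fR lam R (x-z) - 2 * fR lam R x ≤ 100 * (fR lam R x * (z^2/x^2)) := by
  have hx : 0 < x := hz.trans hzx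
  have hfx := fR_nonneg lam R x hR hx.le
  by_cases hc : x < 2 * z
  · have e1 := fR_scale lam R x 2 (x+z) h2 h1 hR hx (by norm_num) (by linarith) (by linarith)
    have e2 := fR_scale lam R x 1 (x-z) h2 h1 hR hx (by norm_num) (by linarith) (by linarith)
    have e3 : 1/4 ≤ z^2/x^2 := by rw [div_le_div_iff₀ (by positivity) (by positivity)]; nlinarith
    have : fR lam R x * (1/4) ≤ fR lam R x * (z^2/x^2) := by gcongr
    linarith
  · push Not at hc
    let f' : ℝ → ℝ := fun u => lam * u^(lam-1) * (u/(u+R)) + u^lam * (R/(u+R)^2)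
    let f'' : ℝ → ℝ := fun u => (lam * ((lam-1) * u^(lam-1-1)) * (u/(u+R)) + lam * u^(lam-1) * (R/(u+R)^2))
       + (lam * u^(lam-1) * (R/(u+R)^2) + u^lam * (-(2*R/(u+R)^3)))
    have hpos : ∀ u ∈ Icc (x-z) (x+z), 0 < u := fun u hu => by linarith [hu.1]
    have hm : ∀ u, 0 < u → HasDerivAt (fun u => u/(u+R)) (R/(u+R)^2) u := by
      intro u hu
      have hne : u + R ≠ 0 := by positivity
      have := (hasDerivAt_id u).div ((hasDerivAt_id u).add_const R) hne
      exact this.congr_deriv (by simp)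
    have hm2 : ∀ u, 0 < u → HasDerivAt (fun u => R/(u+R)^2) (-(2*R/(u+R)^3)) u := by
      intro u hu
      have hne : u + R ≠ 0 := by positivity
      have := (hasDerivAt_const u R).div (((hasDerivAt_id u).add_const R).pow 2) (pow_ne_zero 2 hne)
      exact this.congr_deriv (by simp; field_simp)
    have := second_diff (fR lam R) f' f'' x z (81 * (fR lam R x / x^2)) hz.le
      (fun u hu => by
        have hu0 := hpos u hu
        exact (Real.hasDerivAt_rpow_const (Or.inl hu0.ne')).mul (hm u hu0))
      (fun u hu => by
        have hu0 := hpos u hu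
        have a1 := ((Real.hasDerivAt_rpow_const (p := lam - 1) (Or.inl hu0.ne')).const_mul lam).mul (hm u hu0)
        have a2 := (Real.hasDerivAt_rpow_const (p := lam) (Or.inl hu0.ne')).mul (hm2 u hu0)
        exact a1.add a2)
      (fun u hu => by
        have hu0 := hpos u hu
        have hs := fR_scale lam R x (3/2) u h2 h1 hR hx (by norm_num) hu0 (by linarith [hu.2])
        have q1 : u^(lam-1) = u^lam / u := by rw [Real.rpow_sub hu0, Real.rpow_one]
        have q2 : u^(lam-1-1) = u^lam / u^2 := by
          rw [Real.rpow_sub hu0, Real.rpow_sub hu0, Real.rpow_one]; field_simp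
        have hul : 0 < u^lam := by positivity
        have c1 : f'' u ≤ 6 * (fR lam R u / u^2) := by
          simp only [f'', fR, q1, q2]
          have d1 : lam * (lam-1) ≤ 2 := by nlinarith
          have d2 : R/(u+R)^2 ≤ (u/(u+R)) / u := by
            rw [div_div, div_le_div_iff₀ (by positivity) (by positivity)]
            nlinarith [mul_nonneg hR hu0.le, mul_pos hu0 hu0, mul_nonneg (mul_pos hu0 hu0).le hR, mul_pos (mul_pos hu0 hu0) hu0]
          have d3 : 0 ≤ 2*R/(u+R)^3 := by positivity
          set mm := u/(u+R) with hmm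
          have hmm0 : 0 ≤ mm := by positivity
          set ul := u^lam
          have k1 : lam * ((lam-1) * (ul/u^2)) * mm ≤ 2 * (ul/u^2 * mm) := by
            have : 0 ≤ ul/u^2 * mm := by positivity
            nlinarith
          have k2 : lam * (ul/u) * (R/(u+R)^2) ≤ 2 * (ul/u^2*mm) := by
            calc lam * (ul/u) * (R/(u+R)^2) ≤ 2 * (ul/u) * (mm/u) := by gcongr
              _ = _ := by field_simp
          have k3 : ul * (-(2*R/(u+R)^3)) ≤ 0 := by nlinarith
          have k4 : 6 * (ul * mm / u^2) = 6 * (ul/u^2*mm) := by ring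
          linarith
        have c2 : fR lam R u / u^2 ≤ ((3/2)^3 * fR lam R x) / (x/2)^2 := by
          have : x/2 ≤ u := by linarith [hu.1]
          gcongr
        have c3 : 6 * (((3/2)^3 * fR lam R x) / (x/2)^2) = 81 * (fR lam R x / x^2) := by
          field_simp; ring
        linarith)
    have e4 : 81 * (fR lam R x / x^2) * z^2 = 81 * (fR lam R x * (z^2/x^2)) := by ring
    have : 0 ≤ fR lam R x * (z^2/x^2) := by positivity
    linarith


/-- the weight -/
def Wt (a lam x : ℝ) : ℝ := hatm x ^ (-a) * checkm x ^ lam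

/-- the integrable majorant in the jump size -/
def Psi (a lam : ℝ) (φ : ℝ → ℝ) (z : ℝ) : ℝ :=
  (Ioi (0:ℝ)).indicator (fun z => Wt (2*a) (2*lam) z * φ z) z

lemma hatm_pos {x : ℝ} (hx : 0 < x) : 0 < hatm x := lt_min one_pos hx
lemma hatm_le_one (x : ℝ) : hatm x ≤ 1 := min_le_left _ _
lemma one_le_checkm (x : ℝ) : 1 ≤ checkm x := le_max_left _ _
lemma checkm_pos (x : ℝ) : 0 < checkm x := one_pos.trans_le (one_le_checkm x)
lemma le_checkm (x : ℝ) : x ≤ checkm x := le_max_right _ _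

lemma hatm_meas : Measurable hatm := measurable_const.min measurable_id
lemma checkm_meas : Measurable checkm := measurable_const.max measurable_id
lemma Wt_meas (a lam : ℝ) : Measurable (Wt a lam) :=
  (hatm_meas.pow_const _).mul (checkm_meas.pow_const _)

lemma hatm_rpow_ge_one {a x : ℝ} (ha : 0 ≤ a) (hx : 0 < x) : 1 ≤ hatm x ^ (-a) :=
  Real.one_le_rpow_of_pos_of_le_one_of_nonpos (hatm_pos hx) (hatm_le_one x) (by linarith)

lemma hatm_rpow_anti {a x z : ℝ} (ha : 0 ≤ a) (hz : 0 < z) (hzx : z ≤ x) :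
    hatm x ^ (-a) ≤ hatm z ^ (-a) :=
  Real.rpow_le_rpow_of_nonpos (hatm_pos hz) (min_le_min le_rfl hzx) (by linarith)

lemma checkm_rpow_ge_one {r : ℝ} (hr : 0 ≤ r) (x : ℝ) : 1 ≤ checkm x ^ r :=
  Real.one_le_rpow (one_le_checkm x) hr

lemma Wt_pos (a lam : ℝ) {x : ℝ} (hx : 0 < x) : 0 < Wt a lam x :=
  mul_pos (Real.rpow_pos_of_pos (hatm_pos hx) _) (Real.rpow_pos_of_pos (checkm_pos x) _)

lemma Wt_ge_one {a lam x : ℝ} (ha : 0 ≤ a) (hl : 0 ≤ lam) (hx : 0 < x) : 1 ≤ Wt a lam x :=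
  one_le_mul_of_one_le_of_one_le (hatm_rpow_ge_one ha hx) (checkm_rpow_ge_one hl x)

lemma Wt_ge_check {a lam x : ℝ} (ha : 0 ≤ a) (hx : 0 < x) : checkm x ^ lam ≤ Wt a lam x :=
  le_mul_of_one_le_left (Real.rpow_pos_of_pos (checkm_pos x) _).le (hatm_rpow_ge_one ha hx)

lemma Wt_ge_hat {a lam x : ℝ} (hl : 0 ≤ lam) (hx : 0 < x) : hatm x ^ (-a) ≤ Wt a lam x :=
  le_mul_of_one_le_right (Real.rpow_pos_of_pos (hatm_pos hx) _).le (checkm_rpow_ge_one hl x)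

lemma Wt_le {a lam x : ℝ} (hx : 0 < x) : Wt a lam x ≤ x ^ (-a) + x ^ lam := by
  unfold Wt hatm checkm
  rcases le_total x 1 with h | h
  · rw [min_eq_right h, max_eq_left h, Real.one_rpow, mul_one]
    have : 0 < x ^ lam := Real.rpow_pos_of_pos hx _
    linarith
  · rw [min_eq_left h, max_eq_right h, Real.one_rpow, one_mul]
    have : 0 < x ^ (-a) := Real.rpow_pos_of_pos hx _
    linarith

lemma le_Wt {a lam x : ℝ} (ha : 0 ≤ a) (hl : 0 ≤ lam) (hx : 0 < x) :
    x ^ (-a) + x ^ lam ≤ 2 * Wt a lam x := by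
  unfold Wt hatm checkm
  rcases le_total x 1 with h | h
  · rw [min_eq_right h, max_eq_left h, Real.one_rpow, mul_one]
    have h1 : x ^ lam ≤ 1 := Real.rpow_le_one hx.le h hl
    have h2 : 1 ≤ x ^ (-a) := Real.one_le_rpow_of_pos_of_le_one_of_nonpos hx h (by linarith)
    linarith
  · rw [min_eq_left h, max_eq_right h, Real.one_rpow, one_mul]
    have h1 : 1 ≤ x ^ lam := Real.one_le_rpow h hl
    have h2 : x ^ (-a) ≤ 1 := Real.rpow_le_one_of_one_le_of_nonpos h (by linarith)
    linarith

/-- all the facts about the kernel that are used -/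
structure KF (K : ℝ → ℝ → ℝ → ℝ) (a lam C : ℝ) (Ψ : ℝ → ℝ) : Prop where
  ha : 0 ≤ a
  h1 : 1 < lam
  h2 : lam ≤ 2
  hC : 1 ≤ C
  ker : IsKernel K
  Pm : Measurable Ψ
  Pnn : ∀ z, 0 ≤ Ψ z
  Pint : Integrable Ψ
  b0 : ∀ x y z, 0 < z → z < x → z < y → K x y z ≤ checkm x ^ lam * checkm y ^ lam * Ψ z
  b1 : ∀ x y z, 0 < z → z < x → z < y →
    K x y z * ((x+z)^lam + (x-z)^lam - 2 * x^lam) ≤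
      C * Ψ z * (checkm x ^ lam * checkm y + checkm x * checkm y ^ lam)
  b3 : ∀ R x y z, 0 ≤ R → 0 < z → z < x → z < y →
    K x y z * (fR lam R (x+z) + fR lam R (x-z) - 2 * fR lam R x) ≤
      C * Ψ z * checkm y ^ lam * fR lam R x
  bs : ∀ x y z, 0 < z → z < x → z < y →
    (hatm (x - z)) ^ (-a) * K x y z ≤ C * checkm x ^ lam * Wt a lam y * Ψ z
  bd : ∀ x y z, 0 < z → z < x → 0 < y →
    K (x+z) y z + K (x-z) y z - 2 * K x y z ≤ Ψ z * Wt a lam y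
  bq : ∀ x y z, 0 < z → z ≤ x → 0 < y → z^2 * K x y z ≤ Ψ z * Wt a lam y * (x-z)^2
  bl : ∀ x y z, 0 < x → x ≤ 2*z → 0 < y → K (x+z) y z ≤ 2 * (Ψ z * Wt a lam y)

lemma rpow_pair {X Y p q r s : ℝ} (hY : 1 ≤ Y) (hX : Y ≤ X) (h1 : p + q ≤ r + s) (h2 : p ≤ r) :
    X^p * Y^q ≤ X^r * Y^s := by
  have hY0 : 0 < Y := by linarith
  have hX0 : 0 < X := by linarith
  rw [Real.rpow_def_of_pos hX0, Real.rpow_def_of_pos hX0, Real.rpow_def_of_pos hY0,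
    Real.rpow_def_of_pos hY0, ← Real.exp_add, ← Real.exp_add]
  apply Real.exp_le_exp.2
  have l1 : 0 ≤ Real.log Y := Real.log_nonneg hY
  have l2 : Real.log Y ≤ Real.log X := Real.log_le_log hY0 hX
  nlinarith [mul_le_mul_of_nonneg_left l2 (sub_nonneg.2 h2), mul_nonneg l1 (sub_nonneg.2 h1)]

lemma KF_of (K : ℝ → ℝ → ℝ → ℝ) (μ ν a : ℝ) (φ : ℝ → ℝ)
    (hK : IsKernel K) (hA : GlobalExistenceAssumption K μ ν a φ) :
    Measurable (Psi a (max μ ν) φ) ∧ ∃ C, KF K a (max μ ν) C (Psi a (max μ ν) φ) := by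
  set lam := max μ ν with hlam
  set m := min μ ν with hm
  have ha := hA.ha
  have h1 : 1 < lam := hA.hlam
  have h2 : lam ≤ 2 := max_le hA.hμ.2 hA.hν.2
  have hm0 : 0 ≤ m := le_min hA.hμ.1 hA.hν.1
  have hml : m ≤ lam := min_le_max
  have hmsum : lam + m ≤ 3 := by
    have : max μ ν + min μ ν = μ + ν := max_add_min μ ν
    linarith [hA.hμν]
  have hφ : ∀ z, 0 ≤ z → 0 ≤ φ z := by
    intro z hz
    have := hA.growth 1 1 z zero_le_one zero_le_one hz
    simp [hatm, checkm] at this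
    linarith [hK.nonneg 1 1 z]
  have hPz : ∀ z, 0 < z → Psi a lam φ z = hatm z ^ (-(2*a)) * checkm z ^ (2*lam) * φ z := by
    intro z hz; simp [Psi, Wt, hz]
  have hPnn : ∀ z, 0 ≤ Psi a lam φ z := by
    intro z
    by_cases hz : 0 < z
    · rw [hPz z hz]
      have := hφ z hz.le
      have := hatm_pos hz
      have := checkm_pos z
      positivity
    · simp [Psi, hz]
  have hPm : Measurable (Psi a lam φ) :=
    ((Wt_meas _ _).mul hA.hφ.1.1).indicator measurableSet_Ioi
  have hPint : Integrable (Psi a lam φ) := by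
    have : IntegrableOn (fun z => Wt (2*a) (2*lam) z * φ z) (Ioi 0) := by
      refine Integrable.mono' hA.hφ.1.2 ((Wt_meas _ _).mul hA.hφ.1.1).aestronglyMeasurable ?_
      filter_upwards [ae_restrict_mem measurableSet_Ioi] with z hz
      rw [Real.norm_eq_abs, abs_mul, abs_of_pos (Wt_pos _ _ hz)]
      gcongr
      exact Wt_le hz
    exact (integrable_indicator_iff measurableSet_Ioi).2 this
  have hhat2 : ∀ z, 0 < z → hatm z ^ (-a) * hatm z ^ (-a) = hatm z ^ (-(2*a)) := by
    intro z hz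
    rw [← Real.rpow_add (hatm_pos hz)]; ring_nf
  -- basic bound
  have hbase : ∀ x y z, 0 < z → z < x → z < y → K x y z ≤ hatm z ^ (-(2*a)) *
      ((checkm x ^ lam * checkm y ^ m + checkm x ^ m * checkm y ^ lam)/2) * φ z := by
    intro x y z hz hx hy
    have hg := hA.growth x y z (hz.trans hx).le (hz.trans hy).le hz.le
    have hsym : checkm x ^ μ * checkm y ^ ν + checkm x ^ ν * checkm y ^ μ =
        checkm x ^ lam * checkm y ^ m + checkm x ^ m * checkm y ^ lam := by
      rcases le_total μ ν with h | h
      · rw [hlam, hm, max_eq_right h, min_eq_left h]; ring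
      · rw [hlam, hm, max_eq_left h, min_eq_right h]
    rw [hsym] at hg
    refine hg.trans ?_
    have h3 := hφ z hz.le
    have h4 := hatm_rpow_anti ha hz hx.le
    have h5 := hatm_rpow_anti ha hz hy.le
    rw [← hhat2 z hz]
    have := hatm_pos hz; have := hatm_pos (hz.trans hy); have := hatm_pos (hz.trans hx)
    have := checkm_pos x; have := checkm_pos y
    gcongr
  have hGle : ∀ x y, (checkm x ^ lam * checkm y ^ m + checkm x ^ m * checkm y ^ lam)/2 ≤
      checkm x ^ lam * checkm y ^ lam := by
    intro x y
    have e1 : checkm y ^ m ≤ checkm y ^ lam := Real.rpow_le_rpow_of_exponent_le (one_le_checkm y) hml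
    have e2 : checkm x ^ m ≤ checkm x ^ lam := Real.rpow_le_rpow_of_exponent_le (one_le_checkm x) hml
    have := checkm_pos x; have := checkm_pos y
    have e3 : checkm x ^ lam * checkm y ^ m ≤ checkm x ^ lam * checkm y ^ lam := by gcongr
    have e4 : checkm x ^ m * checkm y ^ lam ≤ checkm x ^ lam * checkm y ^ lam := by gcongr
    linarith
  have hq1 : ∀ z, 0 < z → φ z ≤ Psi a lam φ z := by
    intro z hz
    rw [hPz z hz]
    exact le_mul_of_one_le_left (hφ z hz.le) (Wt_ge_one (by linarith) (by linarith) hz)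
  have hch2 : ∀ z, checkm z ^ 2 ≤ checkm z ^ (2*lam) := by
    intro z
    rw [← Real.rpow_natCast]
    exact Real.rpow_le_rpow_of_exponent_le (one_le_checkm z) (by push_cast; linarith)
  have hhz : ∀ z, 0 < z → hatm z ^ (-(2*a)) * checkm z ^ 2 * φ z ≤ Psi a lam φ z := by
    intro z hz
    rw [hPz z hz]
    have := hφ z hz.le
    have := hatm_pos hz
    gcongr
    exact hch2 z
  have hzq : ∀ z, 0 < z → z^2 * φ z ≤ Psi a lam φ z := by
    intro z hz
    refine le_trans ?_ (hhz z hz)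
    have := hφ z hz.le
    have h5 : z^2 ≤ checkm z^2 := by have := le_checkm z; gcongr
    have h6 := hatm_rpow_ge_one (a := 2*a) (by linarith) hz
    gcongr
    nlinarith [sq_nonneg (checkm z)]
  -- x^lam z^2/x^2
  have hxz : ∀ x z, 0 < z → z < x → checkm x ^ lam * (z^2/x^2) ≤ checkm z ^ 2 := by
    intro x z hz hzx
    have hx := hz.trans hzx
    rcases le_total x 1 with h | h
    · rw [show checkm x = 1 from max_eq_left h, Real.one_rpow, one_mul]
      have : z^2/x^2 ≤ 1 := by rw [div_le_one (by positivity)]; gcongr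
      nlinarith [one_le_checkm z]
    · rw [show checkm x = x from max_eq_right h]
      have e1 : x ^ lam ≤ x^2 := by
        rw [← Real.rpow_natCast]; exact Real.rpow_le_rpow_of_exponent_le h (by push_cast; linarith)
      calc x^lam * (z^2/x^2) ≤ x^2 * (z^2/x^2) := by gcongr
        _ = z^2 := by field_simp
        _ ≤ _ := by have := le_checkm z; gcongr
  have hb0 : ∀ x y z, 0 < z → z < x → z < y →
      K x y z ≤ checkm x ^ lam * checkm y ^ lam * Psi a lam φ z := by
    intro x y z hz hx hy
    refine (hbase x y z hz hx hy).trans ?_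
    have h3 := hφ z hz.le
    have := hatm_pos hz; have := checkm_pos x; have := checkm_pos y
    calc _ ≤ hatm z ^ (-(2*a)) * (checkm x ^ lam * checkm y ^ lam) * φ z := by
            gcongr; exact hGle x y
      _ = checkm x ^ lam * checkm y ^ lam * (hatm z ^ (-(2*a)) * 1 ^ 2 * φ z) := by ring
      _ ≤ checkm x ^ lam * checkm y ^ lam * (hatm z ^ (-(2*a)) * checkm z ^ 2 * φ z) := by
            gcongr; exact one_le_checkm z
      _ ≤ _ := by gcongr; exact hhz z hz
  -- derivatives
  have hder1 : ∀ y z w, 0 < y → 0 < z → 0 < w →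
      HasDerivAt (fun w => K w y z) (derivWithin (fun w => K w y z) (Ici 0) w) w := by
    intro y z w hy hz hw
    exact ((hA.deriv2 y z hy.le hz.le w hw.le).1.hasDerivWithinAt).hasDerivAt (Ici_mem_nhds hw)
  have hder2 : ∀ y z w, 0 < y → 0 < z → 0 < w →
      HasDerivAt (derivWithin (fun w => K w y z) (Ici 0))
        (derivWithin (derivWithin (fun w => K w y z) (Ici 0)) (Ici 0) w) w := by
    intro y z w hy hz hw
    exact ((hA.deriv2 y z hy.le hz.le w hw.le).2.1.hasDerivWithinAt).hasDerivAt (Ici_mem_nhds hw)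
  have hder3 : ∀ y z w, 0 < y → 0 < z → 0 < w →
      derivWithin (derivWithin (fun w => K w y z) (Ici 0)) (Ici 0) w ≤ Wt a lam y * φ z :=
    fun y z w hy hz hw => (hA.deriv2 y z hy.le hz.le w hw.le).2.2
  have hquad : ∀ x y z, 0 < z → z ≤ x → 0 < y → K x y z ≤ Wt a lam y * φ z * (x-z)^2 / 2 := by
    intro x y z hz hzx hy
    have hcz := (hder1 y z z hy hz hz).continuousAt
    have hKz : K z y z = 0 := by
      have h1 : Tendsto (fun w => K w y z) (𝓝[<] z) (𝓝 (K z y z)) :=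
        hcz.tendsto.mono_left nhdsWithin_le_nhds
      have h2 : Tendsto (fun w => K w y z) (𝓝[<] z) (𝓝 0) := by
        refine tendsto_const_nhds.congr' ?_
        filter_upwards [self_mem_nhdsWithin] with w hw
        exact (hK.vanish w y z hw).symm
      exact tendsto_nhds_unique h1 h2
    have hd0 : derivWithin (fun w => K w y z) (Ici 0) z = 0 := by
      have hmin : IsLocalMin (fun w => K w y z) z :=
        Filter.Eventually.of_forall fun w => by simp only [hKz]; exact hK.nonneg w y z
      exact hmin.hasDerivAt_eq_zero (hder1 y z z hy hz hz)
    set B := Wt a lam y * φ z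
    have hl := deriv_le_lip _ _ z x B (fun u hu => hder2 y z u hy hz (hz.trans_le hu.1))
      (fun u hu => hder3 y z u hy hz (hz.trans_le hu.1))
    have := deriv_le_lip (fun w => K w y z - B * (w-z)^2/2)
      (fun w => derivWithin (fun w => K w y z) (Ici 0) w - B * (w - z)) z x 0
      (fun u hu => by
        have e1 := hder1 y z u hy hz (hz.trans_le hu.1)
        have e2 : HasDerivAt (fun w : ℝ => B * (w-z)^2/2) (B*(u-z)) u := by
          have := ((((hasDerivAt_id u).sub_const z).pow 2).const_mul B).div_const 2
          exact this.congr_deriv (by simp; ring)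
        exact e1.sub e2)
      (fun u hu => by
        have := hl z ⟨le_rfl, hzx⟩ u hu hu.1
        rw [hd0] at this
        linarith) z ⟨le_rfl, hzx⟩ x ⟨hzx, le_rfl⟩ hzx
    simp only [hKz, sub_self] at this
    simp at this
    linarith
  -- singular
  have hs : ∃ C, 100 ≤ C ∧ ∀ x y z, 0 < z → z < x → z < y →
    (hatm (x - z)) ^ (-a) * K x y z ≤ C * checkm x ^ lam * Wt a lam y * Psi a lam φ z := by
    rcases ha.eq_or_lt with h0 | h0
    · refine ⟨100, le_rfl, fun x y z hz hx hy => ?_⟩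
      have := hb0 x y z hz hx hy
      have e : Wt a lam y = checkm y ^ lam := by simp [Wt, ← h0]
      rw [e, ← h0, neg_zero, Real.rpow_zero, one_mul]
      rw [← h0] at this
      have : 0 ≤ checkm x ^ lam * checkm y ^ lam * Psi 0 lam φ z := by
        have := hPnn z; rw [← h0] at this
        have := checkm_pos x; have := checkm_pos y
        positivity
      linarith
    · obtain ⟨Ca, hCa, hS⟩ := hA.sing h0
      refine ⟨max 100 Ca, le_max_left _ _, fun x y z hz hx hy => ?_⟩
      have hS' := hS x y z (hz.trans hy).le hz.le hx.le
      refine hS'.trans ?_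
      have h3 := hφ z hz.le
      have h4 := hatm_rpow_anti (a := 2*a) (by linarith) hz hx.le
      have := hatm_pos hz; have := hatm_pos (hz.trans hy); have := hatm_pos (hz.trans hx)
      have := checkm_pos x; have := checkm_pos y
      have hP := hPnn z
      have hWy := (Wt_pos a lam (hz.trans hy)).le
      have e5 : hatm z ^ (-(2*a)) * φ z ≤ Psi a lam φ z := by
        refine le_trans ?_ (hhz z hz)
        have := one_le_checkm z
        calc _ = hatm z ^ (-(2*a)) * 1^2 * φ z := by ring
          _ ≤ _ := by gcongr
      calc _ ≤ Ca * hatm z ^ (-(2*a)) * hatm y ^ (-a) * checkm x ^ lam * checkm y ^ lam * φ z := by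
              gcongr
        _ = Ca * checkm x ^ lam * Wt a lam y * (hatm z ^ (-(2*a)) * φ z) := by
              unfold Wt; ring
        _ ≤ max 100 Ca * checkm x ^ lam * Wt a lam y * Psi a lam φ z := by
              gcongr
              exact le_max_right _ _
  obtain ⟨C, hC, hs⟩ := hs
  refine ⟨hPm, C, ⟨ha, h1, h2, by linarith, hK, hPm, hPnn, hPint, hb0, ?_, ?_, hs, ?_, ?_, ?_⟩⟩
  · intro x y z hz hx hy
    have hx0 := hz.trans hx
    have hlap := fR_lap lam 0 x z h2 h1 le_rfl hz hx
    have hf0 : ∀ u, 0 < u → fR lam 0 u = u^lam := by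
      intro u hu; unfold fR; rw [add_zero, div_self hu.ne', mul_one]
    rw [hf0 _ hx0, hf0 _ (by linarith), hf0 _ (by linarith)] at hlap
    have h3 := hφ z hz.le
    have := hatm_pos hz
    have hX := checkm_pos x; have hY := checkm_pos y
    have hX1 := one_le_checkm x; have hY1 := one_le_checkm y
    have hxl : x^lam * (z^2/x^2) ≤ checkm z ^ 2 * checkm x ^ (lam-2) := by
      rcases le_total x 1 with h | h
      · rw [show checkm x = 1 from max_eq_left h, Real.one_rpow, mul_one]
        have e1 : z^2/x^2 ≤ 1 := by rw [div_le_one (by positivity)]; gcongr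
        have e2 : x^lam ≤ 1 := Real.rpow_le_one hx0.le h (by linarith)
        have e3 : 0 ≤ z^2/x^2 := by positivity
        have e4 : 0 ≤ x^lam := by positivity
        nlinarith [one_le_checkm z]
      · rw [show checkm x = x from max_eq_right h]
        rw [Real.rpow_sub hx0, Real.rpow_two]
        have e5 : z^2 ≤ checkm z^2 := by have := le_checkm z; gcongr
        calc _ = z^2 * (x^lam/x^2) := by ring
          _ ≤ _ := by gcongr
    set X := checkm x
    set Y := checkm y
    have p1 : X ^ (2*lam-2) * Y^m ≤ X^lam * Y + X * Y^lam := by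
      have q1 : 0 ≤ X^lam*Y := by positivity
      have q2 : 0 ≤ X * Y^lam := by positivity
      rcases le_total Y X with h | h
      · have := rpow_pair (p := 2*lam-2) (q := m) (r := lam) (s := 1) hY1 h (by linarith) (by linarith)
        rw [Real.rpow_one] at this; linarith
      · have := rpow_pair (p := m) (q := 2*lam-2) (r := lam) (s := 1) hX1 h (by linarith) (by linarith)
        rw [Real.rpow_one] at this; linarith
    have p2 : X ^ (lam-2+m) ≤ X := by
      calc X ^ (lam-2+m) ≤ X^(1:ℝ) := Real.rpow_le_rpow_of_exponent_le hX1 (by linarith)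
        _ = X := Real.rpow_one X
    have p3 : (X ^ lam * Y ^ m + X ^ m * Y ^ lam)/2 * X ^ (lam-2) ≤ X^lam * Y + X * Y^lam := by
      have e1 : X ^ lam * X ^ (lam-2) = X ^ (2*lam-2) := by
        rw [← Real.rpow_add hX]; ring_nf
      have e2 : X ^ m * X ^ (lam-2) = X ^ (lam-2+m) := by
        rw [← Real.rpow_add hX]; ring_nf
      have e3 : X ^ (lam-2+m) * Y^lam ≤ X * Y^lam := by gcongr
      calc _ = (X ^ lam * X ^ (lam-2) * Y^m + X ^ m * X ^ (lam-2) * Y^lam)/2 := by ring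
        _ = (X ^ (2*lam-2) * Y^m + X ^ (lam-2+m) * Y^lam)/2 := by rw [e1, e2]
        _ ≤ _ := by
          have q1 : 0 ≤ X^lam*Y := by positivity
          linarith
    have hPz0 := hPnn z
    calc K x y z * ((x+z)^lam + (x-z)^lam - 2 * x^lam)
        ≤ K x y z * (100 * (checkm z ^ 2 * X ^ (lam-2))) := by
          have := hK.nonneg x y z
          gcongr
          linarith
      _ ≤ (hatm z ^ (-(2*a)) * ((X ^ lam * Y ^ m + X ^ m * Y ^ lam)/2) * φ z) * (100 * (checkm z ^ 2 * X ^ (lam-2))) := by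
          have := hbase x y z hz hx hy
          gcongr
      _ = 100 * (hatm z ^ (-(2*a)) * checkm z ^ 2 * φ z) * ((X ^ lam * Y ^ m + X ^ m * Y ^ lam)/2 * X ^ (lam-2)) := by ring
      _ ≤ C * Psi a lam φ z * (X^lam * Y + X * Y^lam) := by
          have := hhz z hz
          gcongr
  · intro R x y z hR hz hx hy
    have hx0 := hz.trans hx
    have hlap := fR_lap lam R x z h2 h1 hR hz hx
    have hf := fR_nonneg lam R x hR hx0.le
    have h3 := hφ z hz.le
    have := hatm_pos hz
    have hX := checkm_pos x; have hY := checkm_pos y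
    have hPz0 := hPnn z
    calc K x y z * (fR lam R (x+z) + fR lam R (x-z) - 2 * fR lam R x)
        ≤ K x y z * (100 * (fR lam R x * (z^2/x^2))) := by
          have := hK.nonneg x y z
          gcongr
      _ ≤ (hatm z ^ (-(2*a)) * (checkm x ^ lam * checkm y ^ lam) * φ z) * (100 * (fR lam R x * (z^2/x^2))) := by
          have h5 := hbase x y z hz hx hy
          have h6 := hGle x y
          gcongr
          refine h5.trans ?_
          gcongr
      _ = 100 * (hatm z ^ (-(2*a)) * (checkm x ^ lam * (z^2/x^2)) * φ z) * (checkm y ^ lam * fR lam R x) := by ring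
      _ ≤ 100 * (hatm z ^ (-(2*a)) * checkm z ^ 2 * φ z) * (checkm y ^ lam * fR lam R x) := by
          have := hxz x z hz hx
          gcongr
      _ ≤ C * Psi a lam φ z * (checkm y ^ lam * fR lam R x) := by
          have := hhz z hz
          gcongr
      _ = _ := by ring
  · intro x y z hz hx hy
    have := second_diff (fun w => K w y z) _ _ x z (Wt a lam y * φ z) hz.le
      (fun u hu => hder1 y z u hy hz (by linarith [hu.1]))
      (fun u hu => hder2 y z u hy hz (by linarith [hu.1]))
      (fun u hu => hder3 y z u hy hz (by linarith [hu.1]))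
    refine this.trans ?_
    have hW := Wt_pos a lam hy
    calc _ = z^2 * φ z * Wt a lam y := by ring
      _ ≤ _ := by gcongr; exact hzq z hz
  · intro x y z hz hx hy
    have h3 := hquad x y z hz hx hy
    have hW := Wt_pos a lam hy
    have h4 := hzq z hz
    have h5 := hφ z hz.le
    calc z^2 * K x y z ≤ z^2 * (Wt a lam y * φ z * (x-z)^2 / 2) := by gcongr
      _ = (z^2 * φ z) * Wt a lam y * (x-z)^2 * (1/2) := by ring
      _ ≤ (Psi a lam φ z) * Wt a lam y * (x-z)^2 * 1 := by
        have := hPnn z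
        gcongr; norm_num
      _ = _ := by ring
  · intro x y z hx hxz hy
    have hz : 0 < z := by linarith
    have h3 := hquad (x+z) y z hz (by linarith) hy
    have hW := Wt_pos a lam hy
    have h4 := hzq z hz
    have h5 := hφ z hz.le
    refine h3.trans ?_
    rw [add_sub_cancel_right]
    calc Wt a lam y * φ z * x^2/2 ≤ Wt a lam y * φ z * (2*z)^2/2 := by gcongr
      _ = 2 * ((z^2 * φ z) * Wt a lam y) := by ring
      _ ≤ _ := by gcongr


/-- the flux density; coordinates `p = (x,(z,y))` -/
def Jd (K : ℝ → ℝ → ℝ → ℝ) (n : ℕ) (c : ℝ → ℝ) (p : ℝ × ℝ × ℝ) : ℝ :=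
  Ktrunc K n p.1 p.2.2 p.2.1 * (c p.1 * c p.2.2)

/-- the weak form functional -/
def Qf (K : ℝ → ℝ → ℝ → ℝ) (n : ℕ) (c q : ℝ → ℝ) : ℝ :=
  ∫ p : ℝ × ℝ × ℝ, Jd K n c p * (q (p.1 + p.2.1) + q (p.1 - p.2.1) - 2 * q p.1)

lemma Ktrunc_supp {K : ℝ → ℝ → ℝ → ℝ} {n : ℕ} {x y z : ℝ} (h : Ktrunc K n x y z ≠ 0) :
    (1/(n:ℝ) < x ∧ x < n) ∧ (1/(n:ℝ) < y ∧ y < n) ∧ (1/(n:ℝ) < z ∧ z < n) ∧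
     (0 < x + z ∧ x + z < n) ∧ (0 < y + z ∧ y + z < n) ∧
     1/(n:ℝ) < x - z ∧ 1/(n:ℝ) < y - z := by
  unfold Ktrunc at h
  by_contra hh
  rw [if_neg hh] at h
  exact h rfl

lemma Ktrunc_eq {K : ℝ → ℝ → ℝ → ℝ} {n : ℕ} {x y z : ℝ} (h : Ktrunc K n x y z ≠ 0) :
    Ktrunc K n x y z = K x y z := by
  have := Ktrunc_supp h
  unfold Ktrunc
  rw [if_pos this]

lemma Ktrunc_nonneg {K : ℝ → ℝ → ℝ → ℝ} (hK : IsKernel K) (n : ℕ) (x y z : ℝ) :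
    0 ≤ Ktrunc K n x y z := by
  unfold Ktrunc; split_ifs
  · exact hK.nonneg x y z
  · exact le_rfl

lemma Ktrunc_symm {K : ℝ → ℝ → ℝ → ℝ} (hK : IsKernel K) (n : ℕ) (x y z : ℝ) :
    Ktrunc K n x y z = Ktrunc K n y x z := by
  unfold Ktrunc
  rw [hK.symm x y z]
  congr 1
  simp only [eq_iff_iff]
  tauto

lemma Ktrunc_meas {K : ℝ → ℝ → ℝ → ℝ} (hK : IsKernel K) (n : ℕ) :
    Measurable (fun p : ℝ × ℝ × ℝ => Ktrunc K n p.1 p.2.1 p.2.2) := by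
  unfold Ktrunc
  refine Measurable.ite ?_ hK.meas measurable_const
  have m1 : Measurable (fun p : ℝ × ℝ × ℝ => p.1) := by fun_prop
  have m2 : Measurable (fun p : ℝ × ℝ × ℝ => p.2.1) := by fun_prop
  have m3 : Measurable (fun p : ℝ × ℝ × ℝ => p.2.2) := by fun_prop
  have cc : ∀ r : ℝ, Measurable (fun _ : ℝ × ℝ × ℝ => r) := fun r => measurable_const
  refine MeasurableSet.inter (MeasurableSet.inter (measurableSet_lt (cc _) m1) (measurableSet_lt m1 (cc _))) ?_
  refine MeasurableSet.inter (MeasurableSet.inter (measurableSet_lt (cc _) m2) (measurableSet_lt m2 (cc _))) ?_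
  refine MeasurableSet.inter (MeasurableSet.inter (measurableSet_lt (cc _) m3) (measurableSet_lt m3 (cc _))) ?_
  refine MeasurableSet.inter (MeasurableSet.inter (measurableSet_lt (cc _) (m1.add m3)) (measurableSet_lt (m1.add m3) (cc _))) ?_
  refine MeasurableSet.inter (MeasurableSet.inter (measurableSet_lt (cc _) (m2.add m3)) (measurableSet_lt (m2.add m3) (cc _))) ?_
  exact MeasurableSet.inter (measurableSet_lt (cc _) (m1.sub m3)) (measurableSet_lt (cc _) (m2.sub m3))

lemma inv_pos_n (n : ℕ) : (0:ℝ) ≤ 1/(n:ℝ) := by positivity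

/-- crude kernel bound -/
lemma Ktrunc_le {K : ℝ → ℝ → ℝ → ℝ} {a lam C : ℝ} {Ψ : ℝ → ℝ} (hF : KF K a lam C Ψ) (n : ℕ) (x y z : ℝ) :
    Ktrunc K n x y z ≤ checkm n ^ lam * checkm n ^ lam * Ψ z := by
  have hn := checkm_pos n
  have hP := hF.Pnn z
  by_cases h : Ktrunc K n x y z = 0
  · rw [h]; positivity
  · rw [Ktrunc_eq h]
    obtain ⟨h1, h2, h3, h4, h5, h6, h7⟩ := Ktrunc_supp h
    have h0 := inv_pos_n n
    refine (hF.b0 x y z (by linarith) (by linarith) (by linarith)).trans ?_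
    have := checkm_pos x; have := checkm_pos y
    have hl := hF.h1
    have e1 : checkm x ≤ checkm n := max_le_max le_rfl h1.2.le
    have e2 : checkm y ≤ checkm n := max_le_max le_rfl h2.2.le
    gcongr

lemma int_comb {α : Type*} [MeasurableSpace α] {μ : Measure α} {f g h : α → ℝ} (hf : Integrable f μ)
    (hg : Integrable g μ) (hh : Integrable h μ) :
    ∫ x, (f x - 2 * g x + h x) ∂μ = (∫ x, f x ∂μ) - 2 * (∫ x, g x ∂μ) + ∫ x, h x ∂μ := by
  have h1 := integral_add (hf.sub (hg.const_mul 2)) hh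
  have h2 := integral_sub hf (hg.const_mul 2)
  rw [integral_const_mul] at h2
  rw [← h2]; exact h1

/-- shear -/
def shr (s : ℝ) (p : ℝ × ℝ × ℝ) : ℝ × ℝ × ℝ := (p.1 + s * p.2.1, p.2)

lemma shr_mp (s : ℝ) : MeasurePreserving (shr s) (volume : Measure (ℝ × ℝ × ℝ)) volume := by
  have h1 : MeasurePreserving (fun p : (ℝ × ℝ) × ℝ => (p.1, p.2 + s * p.1.1))
      ((volume : Measure (ℝ×ℝ)).prod (volume : Measure ℝ)) (volume.prod volume) := by
    refine MeasurePreserving.skew_product (f := id) (g := fun (w : ℝ × ℝ) (x : ℝ) => x + s * w.1)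
      (MeasurePreserving.id _) (by fun_prop) (Filter.Eventually.of_forall fun w => ?_)
    exact (measurePreserving_add_right volume (s * w.1)).map_eq
  have h2 : MeasurePreserving (Prod.swap : ℝ × (ℝ × ℝ) → (ℝ × ℝ) × ℝ) volume
    ((volume : Measure (ℝ×ℝ)).prod (volume : Measure ℝ)) := Measure.measurePreserving_swap
  have h3 : MeasurePreserving (Prod.swap : (ℝ × ℝ) × ℝ → ℝ × (ℝ × ℝ))
    ((volume : Measure (ℝ×ℝ)).prod (volume : Measure ℝ)) volume := Measure.measurePreserving_swap
  exact (h3.comp (h1.comp h2))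

lemma shr_int (s : ℝ) {H : ℝ × ℝ × ℝ → ℝ} (hH : Integrable H) :
    Integrable (fun p => H (shr s p)) ∧ ∫ p, H (shr s p) = ∫ p, H p := by
  have hS := shr_mp s
  constructor
  · exact hS.integrable_comp_of_integrable hH
  · have := integral_map (f := H) hS.measurable.aemeasurable (by rw [hS.map_eq]; exact hH.1)
    rw [hS.map_eq] at this
    exact this.symm

lemma shr_inv (s : ℝ) (p : ℝ × ℝ × ℝ) : shr (-s) (shr s p) = p := by
  unfold shr; ext <;> simp

lemma shr_q (s : ℝ) {H : ℝ × ℝ × ℝ → ℝ} (hH : Integrable H) {q : ℝ → ℝ} (hq : Measurable q) {M : ℝ}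
    (hM : ∀ x, |q x| ≤ M) :
    Integrable (fun p => q p.1 * H (shr (-s) p)) ∧ Integrable (fun p : ℝ×ℝ×ℝ => q (p.1 + s * p.2.1) * H p) ∧
     ∫ p, q p.1 * H (shr (-s) p) = ∫ p : ℝ×ℝ×ℝ, q (p.1 + s * p.2.1) * H p := by
  have i1 : Integrable (fun p : ℝ×ℝ×ℝ => q p.1 * H (shr (-s) p)) :=
    (shr_int (-s) hH).1.bdd_mul (c := M) (hq.comp measurable_fst).aestronglyMeasurable
      (Filter.Eventually.of_forall fun p => hM p.1)
  have := shr_int s i1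
  simp only [shr_inv] at this
  exact ⟨i1, this.1, this.2.symm⟩

/-- standing assumptions on a concentration profile -/
structure Nice (n : ℕ) (c : ℝ → ℝ) : Prop where
  m : Measurable c
  nn : ∀ x, 0 ≤ c x
  i : Integrable c
  z : ∀ x, x ∉ Ioo (1/(n:ℝ)) (n:ℝ) → c x = 0

lemma Jd_nonneg {K : ℝ → ℝ → ℝ → ℝ} (hK : IsKernel K) {n : ℕ} {c : ℝ → ℝ} (hc : Nice n c) (p) :
    0 ≤ Jd K n c p := mul_nonneg (Ktrunc_nonneg hK _ _ _ _) (mul_nonneg (hc.nn _) (hc.nn _))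

lemma Jd_meas {K : ℝ → ℝ → ℝ → ℝ} (hK : IsKernel K) (n : ℕ) {c : ℝ → ℝ} (hc : Measurable c) :
    Measurable (Jd K n c) := by
  have := (Ktrunc_meas hK n).comp (g := fun p : ℝ × ℝ × ℝ => Ktrunc K n p.1 p.2.1 p.2.2)
    (f := fun p : ℝ × ℝ × ℝ => (p.1, p.2.2, p.2.1)) (by fun_prop)
  exact this.mul ((hc.comp measurable_fst).mul (hc.comp (measurable_snd.comp measurable_snd)))

lemma prod3_int {f g h : ℝ → ℝ} (hf : Integrable f) (hg : Integrable g) (hh : Integrable h) :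
    Integrable (fun p : ℝ × ℝ × ℝ => f p.1 * (g p.2.1 * h p.2.2)) ∧
    ∫ p : ℝ × ℝ × ℝ, f p.1 * (g p.2.1 * h p.2.2) = (∫ x, f x) * ((∫ x, g x) * ∫ x, h x) := by
  constructor
  · exact hf.mul_prod (hg.mul_prod hh)
  · have e1 := integral_prod_mul (μ := (volume : Measure ℝ)) (ν := (volume : Measure (ℝ×ℝ))) f
      (fun w : ℝ × ℝ => g w.1 * h w.2)
    have e2 := integral_prod_mul (μ := (volume : Measure ℝ)) (ν := (volume : Measure ℝ)) g h
    rw [← e2]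
    exact e1

section
variable {K : ℝ → ℝ → ℝ → ℝ} {a lam C : ℝ} {Ψ : ℝ → ℝ} (hF : KF K a lam C Ψ) {n : ℕ}
  {c : ℝ → ℝ} (hc : Nice n c)

lemma Jd_int (hF : KF K a lam C Ψ) (hc : Nice n c) :
    Integrable (Jd K n c) ∧
    ∫ p, Jd K n c p ≤ checkm n ^ lam * checkm n ^ lam * (∫ z, Ψ z) * (∫ x, c x)^2 := by
  have h3 := prod3_int hc.i hF.Pint hc.i
  set B := checkm n ^ lam * checkm n ^ lam with hB
  have hle : ∀ p : ℝ × ℝ × ℝ, Jd K n c p ≤ B * (c p.1 * (Ψ p.2.1 * c p.2.2)) := by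
    intro p
    have := mul_le_mul_of_nonneg_right (Ktrunc_le hF n p.1 p.2.2 p.2.1)
      (mul_nonneg (hc.nn p.1) (hc.nn p.2.2))
    unfold Jd
    refine this.trans (le_of_eq ?_)
    rw [hB]; ring
  have hi : Integrable (Jd K n c) := by
    refine Integrable.mono' (h3.1.const_mul B) (Jd_meas hF.ker n hc.m).aestronglyMeasurable
      (Filter.Eventually.of_forall fun p => ?_)
    rw [Real.norm_eq_abs, abs_of_nonneg (Jd_nonneg hF.ker hc p)]
    exact hle p
  refine ⟨hi, ?_⟩
  refine (integral_mono hi (h3.1.const_mul B) hle).trans (le_of_eq ?_)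
  rw [integral_const_mul, h3.2]; ring

lemma truncRHS_eq (hK : IsKernel K) (n : ℕ) (c : ℝ → ℝ) (x : ℝ) :
    truncRHS K n c x = (∫ w : ℝ × ℝ, Jd K n c (shr (-1) (x, w))) - 2 * (∫ w, Jd K n c (x, w))
      + ∫ w, Jd K n c (shr 1 (x, w)) := by
  have hset : ∀ g : ℝ × ℝ → ℝ, (∀ w, w ∉ Ioi (0:ℝ) ×ˢ Ioi (0:ℝ) → g w = 0) →
      ∫ w in Ioi (0:ℝ) ×ˢ Ioi (0:ℝ), g w = ∫ w, g w :=
    fun g hg => setIntegral_eq_integral_of_forall_compl_eq_zero hg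
  have hv : ∀ x y z : ℝ, (z, y) ∉ Ioi (0:ℝ) ×ˢ Ioi (0:ℝ) → Ktrunc K n x y z = 0 := by
    intro x y z h
    by_contra hne
    obtain ⟨h1, h2, h3, h4, h5, h6, h7⟩ := Ktrunc_supp hne
    have h0 := inv_pos_n n
    exact h ⟨by simp; linarith, by simp; linarith⟩
  unfold truncRHS
  rw [hset _ (fun w hw => by rw [Ktrunc_symm hK, hv _ _ _ hw]; ring),
    hset _ (fun w hw => by rw [hv _ _ _ hw]; ring),
    hset _ (fun w hw => by rw [Ktrunc_symm hK, hv _ _ _ hw]; ring),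
    hset _ (fun w hw => by rw [hv _ _ _ hw]; ring)]
  have e1 : (fun p : ℝ × ℝ => Ktrunc K n p.2 (x - p.1) p.1 * c p.2 * c (x - p.1)) =
      fun w => Jd K n c (shr (-1) (x, w)) := by
    ext w; simp only [Jd, shr]; rw [Ktrunc_symm hK]; ring_nf
  have e2 : (fun p : ℝ × ℝ => Ktrunc K n x p.2 p.1 * c x * c p.2) = fun w => Jd K n c (x, w) := by
    ext w; simp only [Jd]; ring
  have e3 : (fun p : ℝ × ℝ => Ktrunc K n p.2 x p.1 * c p.2 * c x) = fun w => Jd K n c (x, w) := by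
    ext w; simp only [Jd]; rw [Ktrunc_symm hK]; ring
  have e4 : (fun p : ℝ × ℝ => Ktrunc K n (x + p.1) p.2 p.1 * c (x + p.1) * c p.2) =
      fun w => Jd K n c (shr 1 (x, w)) := by
    ext w; simp only [Jd, shr]; ring_nf
  rw [e1, e2, e3, e4]; ring

lemma truncRHS_zero (hK : IsKernel K) (n : ℕ) (c : ℝ → ℝ) {x : ℝ} (hx : x ∉ Ioo (1/(n:ℝ)) (n:ℝ)) :
    truncRHS K n c x = 0 := by
  rw [truncRHS_eq hK]
  have key : ∀ s : ℝ, (s = -1 ∨ s = 0 ∨ s = 1) → ∀ w : ℝ × ℝ, Jd K n c (shr s (x, w)) = 0 := by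
    intro s hs w
    by_contra hne
    unfold Jd at hne
    have := Ktrunc_supp (left_ne_zero_of_mul hne)
    simp only [shr] at this
    have h0 := inv_pos_n n
    apply hx
    rcases hs with rfl | rfl | rfl <;> constructor <;> linarith
  have k0 := key 0 (by simp)
  simp only [shr, zero_mul, add_zero] at k0
  simp [key (-1) (by simp), key 1 (by simp), k0]

/-- main fixed time facts -/
lemma RHS_facts (hF : KF K a lam C Ψ) (hc : Nice n c) :
    Integrable (truncRHS K n c) ∧
    (∫ x, |truncRHS K n c x| ≤ 4 * (checkm n ^ lam * checkm n ^ lam * (∫ z, Ψ z) * (∫ x, c x)^2)) ∧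
    ∀ q : ℝ → ℝ, Measurable q → ∀ M, (∀ x, |q x| ≤ M) → ∫ x, q x * truncRHS K n c x = Qf K n c q := by
  obtain ⟨hJ, hJle⟩ := Jd_int hF hc
  have hi : ∀ s, Integrable (fun x => ∫ w : ℝ × ℝ, Jd K n c (shr s (x, w))) := fun s =>
    (shr_int s hJ).1.integral_prod_left
  have hi0 : Integrable (fun x => ∫ w : ℝ × ℝ, Jd K n c (x, w)) := hJ.integral_prod_left
  have hI : ∀ s, ∫ x, ∫ w : ℝ × ℝ, Jd K n c (shr s (x, w)) = ∫ p, Jd K n c p := fun s => by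
    rw [← (shr_int s hJ).2]
    exact (integral_prod _ (shr_int s hJ).1).symm
  have hI0 : ∫ x, ∫ w : ℝ × ℝ, Jd K n c (x, w) = ∫ p, Jd K n c p := (integral_prod _ hJ).symm
  have heq : truncRHS K n c = fun x => (∫ w : ℝ × ℝ, Jd K n c (shr (-1) (x, w))) - 2 * (∫ w, Jd K n c (x, w))
      + ∫ w, Jd K n c (shr 1 (x, w)) := funext (truncRHS_eq hF.ker n c)
  have hint : Integrable (truncRHS K n c) := by
    rw [heq]
    exact ((hi (-1)).sub (hi0.const_mul 2)).add (hi 1)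
  refine ⟨hint, ?_, ?_⟩
  · have hle : ∀ x, |truncRHS K n c x| ≤ (∫ w : ℝ × ℝ, Jd K n c (shr (-1) (x, w))) + 2 * (∫ w, Jd K n c (x, w))
      + ∫ w, Jd K n c (shr 1 (x, w)) := by
      intro x
      have p1 : 0 ≤ ∫ w : ℝ × ℝ, Jd K n c (shr (-1) (x, w)) := integral_nonneg fun w => Jd_nonneg hF.ker hc _
      have p2 : 0 ≤ ∫ w : ℝ × ℝ, Jd K n c (shr 1 (x, w)) := integral_nonneg fun w => Jd_nonneg hF.ker hc _
      have p3 : 0 ≤ ∫ w : ℝ × ℝ, Jd K n c (x, w) := integral_nonneg fun w => Jd_nonneg hF.ker hc _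
      rw [truncRHS_eq hF.ker, abs_le]
      constructor <;> linarith
    have hs : Integrable (fun x => (∫ w : ℝ × ℝ, Jd K n c (shr (-1) (x, w))) + 2 * (∫ w, Jd K n c (x, w))
      + ∫ w, Jd K n c (shr 1 (x, w))) := ((hi (-1)).add (hi0.const_mul 2)).add (hi 1)
    refine (integral_mono hint.abs hs hle).trans ?_
    have h4 := integral_add ((hi (-1)).add (hi0.const_mul 2)) (hi 1)
    have h5 := integral_add (hi (-1)) (hi0.const_mul 2)
    simp only [Pi.add_apply] at h4
    rw [h4, h5, integral_const_mul, hI, hI, hI0]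
    linarith
  · intro q hq M hM
    have q0 := shr_q 0 hJ hq hM
    have q1 := shr_q 1 hJ hq hM
    have q2 := shr_q (-1) hJ hq hM
    have z0 : ∀ p : ℝ × ℝ × ℝ, shr (-0) p = p := by intro p; simp [shr]
    simp only [z0, zero_mul, add_zero] at q0
    rw [neg_neg] at q2
    have j1 : Integrable (fun x => q x * ∫ w : ℝ × ℝ, Jd K n c (shr (-1) (x, w))) :=
      (hi (-1)).bdd_mul (c := M) hq.aestronglyMeasurable (Filter.Eventually.of_forall fun p => hM p)
    have j2 : Integrable (fun x => q x * ∫ w : ℝ × ℝ, Jd K n c (shr 1 (x, w))) :=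
      (hi 1).bdd_mul (c := M) hq.aestronglyMeasurable (Filter.Eventually.of_forall fun p => hM p)
    have j0 : Integrable (fun x => q x * ∫ w : ℝ × ℝ, Jd K n c (x, w)) :=
      hi0.bdd_mul (c := M) hq.aestronglyMeasurable (Filter.Eventually.of_forall fun p => hM p)
    have v1 : ∫ x, q x * ∫ w : ℝ × ℝ, Jd K n c (shr (-1) (x, w)) = ∫ p : ℝ × ℝ × ℝ, q (p.1 + 1 * p.2.1) * Jd K n c p := by
      rw [← q1.2.2]
      refine Eq.trans ?_ (integral_prod _ q1.1).symm
      simp only [integral_const_mul]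
    have v2 : ∫ x, q x * ∫ w : ℝ × ℝ, Jd K n c (shr 1 (x, w)) = ∫ p : ℝ × ℝ × ℝ, q (p.1 + (-1) * p.2.1) * Jd K n c p := by
      rw [← q2.2.2]
      refine Eq.trans ?_ (integral_prod _ q2.1).symm
      simp only [integral_const_mul]
    have v0 : ∫ x, q x * ∫ w : ℝ × ℝ, Jd K n c (x, w) = ∫ p : ℝ × ℝ × ℝ, q p.1 * Jd K n c p := by
      refine Eq.trans ?_ (integral_prod _ q0.1).symm
      simp only [integral_const_mul]
    have el : ∫ x, q x * truncRHS K n c x = (∫ x, q x * ∫ w : ℝ × ℝ, Jd K n c (shr (-1) (x, w)))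
        - 2 * (∫ x, q x * ∫ w : ℝ × ℝ, Jd K n c (x, w)) + ∫ x, q x * ∫ w : ℝ × ℝ, Jd K n c (shr 1 (x, w)) := by
      rw [← int_comb j1 j0 j2]
      congr 1; ext x
      rw [truncRHS_eq hF.ker]; ring
    have er : Qf K n c q = (∫ p : ℝ × ℝ × ℝ, q (p.1 + 1 * p.2.1) * Jd K n c p)
        - 2 * (∫ p : ℝ × ℝ × ℝ, q p.1 * Jd K n c p) + ∫ p : ℝ × ℝ × ℝ, q (p.1 + (-1) * p.2.1) * Jd K n c p := by
      rw [← int_comb q1.2.1 q0.1 q2.2.1]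
      unfold Qf
      congr 1; ext p
      rw [one_mul, neg_one_mul, ← sub_eq_add_neg]; ring
    rw [el, er, v1, v2, v0]

/-- the product bound -/
lemma Q_le (hF : KF K a lam C Ψ) (hc : Nice n c) (q U1 V1 U2 V2 : ℝ → ℝ)
    (i1 : Integrable (fun x => U1 x * c x)) (i2 : Integrable (fun x => V1 x * c x))
    (i3 : Integrable (fun x => U2 x * c x)) (i4 : Integrable (fun x => V2 x * c x))
    (hq : Measurable q) (M : ℝ) (hM : ∀ x ∈ Ioo (1/(n:ℝ)) n, |q x| ≤ M)
    (h : ∀ x y z, Ktrunc K n x y z ≠ 0 → c x ≠ 0 → c y ≠ 0 →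
      Ktrunc K n x y z * (q (x+z) + q (x-z) - 2 * q x) ≤ Ψ z * (U1 x * V1 y + U2 x * V2 y))
    (h' : ∀ x y, x ∈ Ioo (1/(n:ℝ)) n → y ∈ Ioo (1/(n:ℝ)) n → 0 ≤ U1 x * V1 y + U2 x * V2 y) :
    Qf K n c q ≤ (∫ z, Ψ z) * ((∫ x, U1 x * c x) * (∫ x, V1 x * c x) + (∫ x, U2 x * c x) * (∫ x, V2 x * c x)) := by
  have a1 := prod3_int i1 hF.Pint i2
  have a2 := prod3_int i3 hF.Pint i4
  obtain ⟨hJ, -⟩ := Jd_int hF hc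
  have hii : Integrable (fun p : ℝ × ℝ × ℝ => Jd K n c p * (q (p.1 + p.2.1) + q (p.1 - p.2.1) - 2 * q p.1)) := by
    refine Integrable.mono' (hJ.const_mul (4*M)) ?_ (Filter.Eventually.of_forall fun p => ?_)
    · refine ((Jd_meas hF.ker n hc.m).mul ?_).aestronglyMeasurable
      fun_prop
    · rw [norm_mul, Real.norm_eq_abs, Real.norm_eq_abs, abs_of_nonneg (Jd_nonneg hF.ker hc p)]
      by_cases hk : Ktrunc K n p.1 p.2.2 p.2.1 = 0
      · simp [Jd, hk]
      · obtain ⟨s1, s2, s3, s4, s5, s6, s7⟩ := Ktrunc_supp hk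
        have h0 := inv_pos_n n
        have g1 := abs_le.1 (hM (p.1 + p.2.1) ⟨by linarith, by linarith⟩)
        have g2 := abs_le.1 (hM (p.1 - p.2.1) ⟨by linarith, by linarith⟩)
        have g3 := abs_le.1 (hM p.1 ⟨by linarith, by linarith⟩)
        have : |q (p.1 + p.2.1) + q (p.1 - p.2.1) - 2 * q p.1| ≤ 4 * M := by
          rw [abs_le]; constructor <;> linarith
        rw [mul_comm]
        have := Jd_nonneg hF.ker hc p
        gcongr
  have hle := integral_mono hii (a1.1.add a2.1) (fun p => by
    simp only [Pi.add_apply, Jd]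
    have hcc := mul_nonneg (hc.nn p.1) (hc.nn p.2.2)
    have hrw : U1 p.1 * c p.1 * (Ψ p.2.1 * (V1 p.2.2 * c p.2.2)) +
        U2 p.1 * c p.1 * (Ψ p.2.1 * (V2 p.2.2 * c p.2.2)) =
        (Ψ p.2.1 * (U1 p.1 * V1 p.2.2 + U2 p.1 * V2 p.2.2)) * (c p.1 * c p.2.2) := by ring
    have hlw : Ktrunc K n p.1 p.2.2 p.2.1 * (c p.1 * c p.2.2) * (q (p.1 + p.2.1) + q (p.1 - p.2.1) - 2 * q p.1)
        = (Ktrunc K n p.1 p.2.2 p.2.1 * (q (p.1 + p.2.1) + q (p.1 - p.2.1) - 2 * q p.1)) * (c p.1 * c p.2.2) := by ring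
    rw [hrw, hlw]
    by_cases c1 : c p.1 = 0
    · simp [c1]
    by_cases c2 : c p.2.2 = 0
    · simp [c2]
    refine mul_le_mul_of_nonneg_right ?_ hcc
    by_cases hk : Ktrunc K n p.1 p.2.2 p.2.1 = 0
    · rw [hk, zero_mul]
      refine mul_nonneg (hF.Pnn _) (h' _ _ ?_ ?_)
      · by_contra hh; exact c1 (hc.z _ hh)
      · by_contra hh; exact c2 (hc.z _ hh)
    · exact h _ _ _ hk c1 c2)
  refine hle.trans (le_of_eq ?_)
  have := integral_add a1.1 a2.1
  simp only [Pi.add_apply]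
  rw [this, a1.2, a2.2]; ring

end


section
variable {K : ℝ → ℝ → ℝ → ℝ} {a lam C : ℝ} {Ψ : ℝ → ℝ} {n : ℕ} {c : ℝ → ℝ → ℝ}

/-- a nonnegative truncated solution -/
structure Sol (K : ℝ → ℝ → ℝ → ℝ) (n : ℕ) (c : ℝ → ℝ → ℝ) : Prop where
  s : IsTruncatedSolution K n c
  nn : ∀ t x : ℝ, 0 ≤ t → 0 ≤ c t x

lemma Sol.nice (hS : Sol K n c) {t : ℝ} (ht : 0 ≤ t) : Nice n (c t) where
  m := hS.s.meas t
  nn := fun x => hS.nn t x ht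
  i := (hS.s.integrable t ht).integrable_of_forall_notMem_eq_zero (hS.s.zero_outside t)
  z := hS.s.zero_outside t

lemma Sol.hd (hK : IsKernel K) (hS : Sol K n c) (x : ℝ) {t : ℝ} (ht : 0 ≤ t) :
    HasDerivWithinAt (fun s => c s x) (truncRHS K n (c t) x) (Ici 0) t := by
  by_cases hx : x ∈ Ioo (1/(n:ℝ)) (n:ℝ)
  · exact hS.s.ode x hx t ht
  · rw [truncRHS_zero hK n _ hx]
    have : (fun s => c s x) = fun _ => 0 := funext fun s => hS.s.zero_outside s x hx
    rw [this]; exact hasDerivWithinAt_const _ _ _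

lemma Sol.cont (hK : IsKernel K) (hS : Sol K n c) (x : ℝ) : Continuous (fun τ => c (max τ 0) x) := by
  have h1 : ContinuousOn (fun s => c s x) (Ici 0) := fun t ht => (hS.hd hK x ht).continuousWithinAt
  exact h1.comp_continuous (by fun_prop) (fun τ => mem_Ici.2 (le_max_right _ _))

lemma Sol.jm (hK : IsKernel K) (hS : Sol K n c) : Measurable (fun q : ℝ × ℝ => c (max q.1 0) q.2) :=
  measurable_uncurry_of_continuous_of_measurable (u := fun τ x => c (max τ 0) x)
    (fun x => hS.cont hK x) (fun τ => hS.s.meas _)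

lemma Sol.rm (hK : IsKernel K) (hS : Sol K n c) :
    Measurable (fun q : ℝ × ℝ => truncRHS K n (c (max q.1 0)) q.2) := by
  have hj := hS.jm hK
  have hk := Ktrunc_meas hK n
  have key : ∀ s : ℝ, Measurable (fun q : ℝ × ℝ => ∫ w : ℝ × ℝ, Jd K n (c (max q.1 0)) (shr s (q.2, w))) := by
    intro s
    have m1 : Measurable (fun v : (ℝ × ℝ) × (ℝ × ℝ) => Jd K n (c (max v.1.1 0)) (shr s (v.1.2, v.2))) := by
      unfold Jd shr
      have e1 := hk.comp (g := fun p : ℝ × ℝ × ℝ => Ktrunc K n p.1 p.2.1 p.2.2)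
        (f := fun v : (ℝ × ℝ) × (ℝ × ℝ) => (v.1.2 + s * v.2.1, v.2.2, v.2.1)) (by fun_prop)
      have e2 := hj.comp (g := fun q : ℝ × ℝ => c (max q.1 0) q.2)
        (f := fun v : (ℝ × ℝ) × (ℝ × ℝ) => (v.1.1, v.1.2 + s * v.2.1)) (by fun_prop)
      have e3 := hj.comp (g := fun q : ℝ × ℝ => c (max q.1 0) q.2)
        (f := fun v : (ℝ × ℝ) × (ℝ × ℝ) => (v.1.1, v.2.2)) (by fun_prop)
      exact e1.mul (e2.mul e3)
    exact (m1.stronglyMeasurable.integral_prod_right').measurable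
  have k0 := key 0
  simp only [shr, zero_mul, add_zero] at k0
  simp only [truncRHS_eq hK]
  exact ((key (-1)).sub (k0.const_mul 2)).add (key 1)

/-- the renormalised weak form -/
lemma weakform (hF : KF K a lam C Ψ) (hS : Sol K n c) {s t : ℝ} (hs : 0 ≤ s) (hst : s ≤ t)
    (hN : ∃ M, ∀ τ ∈ Icc s t, ∫ x, c τ x ≤ M) (f : ℝ → ℝ) (hf : Measurable f) (F : ℝ) (hfF : ∀ x, |f x| ≤ F)
    (σ β : ℝ → ℝ) (hσm : Measurable σ) (hβm : Measurable β) (hβ : ∀ r, 0 ≤ r → |β r| ≤ 1)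
    (hσ : ∀ r, 0 ≤ r → |σ r| ≤ r) (hd : ∀ r, 0 ≤ r → HasDerivAt σ (β r) r) :
    IntervalIntegrable (fun τ => Qf K n (c τ) (fun x => f x * β (c τ x))) volume s t ∧
    (∫ x, f x * σ (c t x)) - (∫ x, f x * σ (c s x)) =
      ∫ τ in s..t, Qf K n (c τ) (fun x => f x * β (c τ x)) := by
  obtain ⟨M, hM⟩ := hN
  have hK := hF.ker
  have hF0 : 0 ≤ F := (abs_nonneg _).trans (hfF 0)
  set ct : ℝ → ℝ → ℝ := fun τ => c (max τ 0) with hct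
  have hctτ : ∀ τ, 0 ≤ τ → ct τ = c τ := fun τ hτ => by simp only [hct, max_eq_left hτ]
  have hn : ∀ τ, Nice n (ct τ) := fun τ => hS.nice (le_max_right _ _)
  set ν : Measure ℝ := volume.restrict (Ioc s t) with hν
  set B := 4 * (checkm n ^ lam * checkm n ^ lam * (∫ z, Ψ z) * M^2) with hB
  have hP0 : 0 ≤ ∫ z, Ψ z := integral_nonneg hF.Pnn
  have hck := checkm_pos n
  -- joint integrability of the right-hand side
  have hG : Integrable (fun q : ℝ × ℝ => truncRHS K n (ct q.1) q.2) (ν.prod volume) := by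
    rw [integrable_prod_iff (hS.rm hK).aestronglyMeasurable]
    refine ⟨Filter.Eventually.of_forall fun τ => (RHS_facts hF (hn τ)).1, ?_⟩
    refine Integrable.mono' (g := fun _ => B) (integrable_const _) ?_ ?_
    · exact ((hS.rm hK).norm.stronglyMeasurable.integral_prod_right').aestronglyMeasurable
    · filter_upwards [ae_restrict_mem measurableSet_Ioc] with τ hτ
      have hτ0 : 0 ≤ τ := hs.trans hτ.1.le
      rw [Real.norm_eq_abs, abs_of_nonneg (integral_nonneg fun _ => norm_nonneg _)]
      refine (RHS_facts hF (hn τ)).2.1.trans ?_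
      have h1 : ∫ x, ct τ x ≤ M := by rw [hctτ τ hτ0]; exact hM τ ⟨hτ.1.le, hτ.2⟩
      have h2 : 0 ≤ ∫ x, ct τ x := integral_nonneg (hn τ).nn
      rw [hB]
      gcongr
  have hH : Integrable (fun q : ℝ × ℝ => (f q.2 * β (ct q.1 q.2)) * truncRHS K n (ct q.1) q.2) (ν.prod volume) := by
    refine hG.bdd_mul (c := F) ?_ (Filter.Eventually.of_forall fun q => ?_)
    · exact ((hf.comp measurable_snd).mul (hβm.comp (hS.jm hK))).aestronglyMeasurable
    · rw [Real.norm_eq_abs, abs_mul]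
      have := hβ _ ((hn q.1).nn q.2)
      have := hfF q.2
      calc _ ≤ F * 1 := by gcongr
        _ = F := mul_one F
  have hinner : ∀ τ, ∫ x, (f x * β (ct τ x)) * truncRHS K n (ct τ) x = Qf K n (ct τ) (fun x => f x * β (ct τ x)) := by
    intro τ
    refine (RHS_facts hF (hn τ)).2.2 _ (hf.mul (hβm.comp (hn τ).m)) F fun x => ?_
    rw [abs_mul]
    have := hβ _ ((hn τ).nn x)
    have := hfF x
    calc _ ≤ F * 1 := by gcongr
      _ = F := mul_one F
  have hQi : Integrable (fun τ => Qf K n (ct τ) (fun x => f x * β (ct τ x))) ν := by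
    have := hH.integral_prod_left
    simp only [hinner] at this
    exact this
  have hIoc : ∀ τ ∈ Ioc s t, Qf K n (ct τ) (fun x => f x * β (ct τ x)) = Qf K n (c τ) (fun x => f x * β (c τ x)) := by
    intro τ hτ
    rw [hctτ τ (hs.trans hτ.1.le)]
  constructor
  · rw [intervalIntegrable_iff_integrableOn_Ioc_of_le hst]
    exact IntegrableOn.congr_fun hQi hIoc measurableSet_Ioc
  · rw [intervalIntegral.integral_of_le hst, ← setIntegral_congr_fun measurableSet_Ioc hIoc]
    have hsw := integral_integral_swap (f := fun τ x => (f x * β (ct τ x)) * truncRHS K n (ct τ) x) hH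
    simp only [hinner] at hsw
    rw [hsw]
    have hσi : ∀ τ, 0 ≤ τ → Integrable (fun x => f x * σ (c τ x)) := by
      intro τ hτ
      have hnτ := hS.nice hτ
      refine Integrable.bdd_mul (c := F) ?_ hf.aestronglyMeasurable (Filter.Eventually.of_forall hfF)
      refine Integrable.mono' hnτ.i (hσm.comp hnτ.m).aestronglyMeasurable
        (Filter.Eventually.of_forall fun x => hσ _ (hnτ.nn x))
    rw [← integral_sub (hσi t (hs.trans hst)) (hσi s hs)]
    apply integral_congr_ae
    filter_upwards [hG.prod_left_ae] with x hx
    have hbx : Integrable (fun τ => β (ct τ x) * truncRHS K n (ct τ) x) ν := by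
      refine hx.bdd_mul (c := 1) ?_ (Filter.Eventually.of_forall fun τ => hβ _ ((hn τ).nn x))
      exact (hβm.comp (hS.cont hK x).measurable).aestronglyMeasurable
    have hftc : ∫ τ in s..t, β (ct τ x) * truncRHS K n (ct τ) x = σ (ct t x) - σ (ct s x) := by
      refine intervalIntegral.integral_eq_sub_of_hasDerivAt_of_le (f := fun τ => σ (ct τ x)) hst ?_ ?_ ?_
      · intro τ hτ
        have h1 : ContinuousAt σ (ct τ x) := (hd _ ((hn τ).nn x)).continuousAt
        exact (ContinuousAt.comp (f := fun τ => ct τ x) h1 (hS.cont hK x).continuousAt).continuousWithinAt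
      · intro τ hτ
        have hτ0 : 0 < τ := hs.trans_lt hτ.1
        have h1 : HasDerivAt (fun τ => c τ x) (truncRHS K n (c τ) x) τ :=
          (hS.hd hK x hτ0.le).hasDerivAt (Ici_mem_nhds hτ0)
        have h2 : HasDerivAt (fun τ => ct τ x) (truncRHS K n (ct τ) x) τ := by
          rw [hctτ τ hτ0.le]
          refine h1.congr_of_eventuallyEq ?_
          filter_upwards [Ici_mem_nhds hτ0] with r hr
          rw [hctτ r hr]
        exact (hd _ ((hn τ).nn x)).comp τ h2
      · rw [intervalIntegrable_iff_integrableOn_Ioc_of_le hst]; exact hbx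
    rw [intervalIntegral.integral_of_le hst, hctτ t (hs.trans hst), hctτ s hs] at hftc
    simp only [mul_assoc]
    rw [integral_const_mul, hftc]; ring

/-- linear special case -/
lemma weaklin (hF : KF K a lam C Ψ) (hS : Sol K n c) {s t : ℝ} (hs : 0 ≤ s) (hst : s ≤ t)
    (hN : ∃ M, ∀ τ ∈ Icc s t, ∫ x, c τ x ≤ M) (f : ℝ → ℝ) (hf : Measurable f) (F : ℝ) (hfF : ∀ x, |f x| ≤ F) :
    IntervalIntegrable (fun τ => Qf K n (c τ) f) volume s t ∧
    (∫ x, f x * c t x) - (∫ x, f x * c s x) = ∫ τ in s..t, Qf K n (c τ) f := by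
  have := weakform hF hS hs hst hN f hf F hfF (fun r => r) (fun _ => 1) measurable_id measurable_const
    (fun r _ => by simp) (fun r hr => by rw [abs_of_nonneg hr]) (fun r _ => hasDerivAt_id r)
  simpa using this

lemma mass_const (hF : KF K a lam C Ψ) (hS : Sol K n c) {s t : ℝ} (hs : 0 ≤ s) (hst : s ≤ t)
    (hN : ∃ M, ∀ τ ∈ Icc s t, ∫ x, c τ x ≤ M) : ∫ x, c t x = ∫ x, c s x := by
  have := (weaklin hF hS hs hst hN (fun _ => 1) measurable_const 1 (by simp)).2
  have e : ∀ τ, Qf K n (c τ) (fun _ => 1) = 0 := fun τ => by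
    unfold Qf; norm_num
  simp only [e, one_mul] at this
  simp at this
  linarith

lemma mass_const' (hF : KF K a lam C Ψ) (hS : Sol K n c) {s t : ℝ} (hst : s ≤ t)
    (hN : ∃ M, ∀ τ ∈ Icc s t, ∫ x, c (max τ 0) x ≤ M) : ∫ x, c (max t 0) x = ∫ x, c (max s 0) x := by
  rcases le_or_gt t 0 with ht | ht
  · rw [max_eq_right ht, max_eq_right (hst.trans ht)]
  · obtain ⟨M, hM⟩ := hN
    refine mass_const hF hS (le_max_right _ _) (max_le_max hst le_rfl) ⟨M, fun τ hτ => ?_⟩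
    rw [max_eq_left ht.le] at hτ
    have h0 : 0 ≤ τ := (le_max_right _ _).trans hτ.1
    have := hM τ ⟨(le_max_left _ _).trans hτ.1, hτ.2⟩
    rwa [max_eq_left h0] at this

lemma mass_lsc (hF : KF K a lam C Ψ) (hS : Sol K n c) (k : ℝ) (hk : 0 ≤ k) :
    IsClosed {τ : ℝ | ∫ x, c (max τ 0) x ≤ k} := by
  apply IsSeqClosed.isClosed
  intro u τ hu hτ
  simp only [mem_ofPred_eq] at hu ⊢
  have hn : ∀ τ, Nice n (c (max τ 0)) := fun τ => hS.nice (le_max_right _ _)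
  have e : ∀ τ, ENNReal.ofReal (∫ x, c (max τ 0) x) = ∫⁻ x, ENNReal.ofReal (c (max τ 0) x) := fun τ =>
    ofReal_integral_eq_lintegral_ofReal (hn τ).i (Filter.Eventually.of_forall (hn τ).nn)
  have h1 := lintegral_liminf_le (u := atTop) (μ := volume) (f := fun j x => ENNReal.ofReal (c (max (u j) 0) x))
    (fun j => (hn (u j)).m.ennreal_ofReal)
  have h2 : ∀ x, liminf (fun j => ENNReal.ofReal (c (max (u j) 0) x)) atTop = ENNReal.ofReal (c (max τ 0) x) := by
    intro x
    apply Tendsto.liminf_eq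
    apply ENNReal.tendsto_ofReal
    exact (hS.cont hF.ker x).continuousAt.tendsto.comp hτ
  simp only [h2, ← e] at h1
  have h3 : liminf (fun j => ENNReal.ofReal (∫ x, c (max (u j) 0) x)) atTop ≤ ENNReal.ofReal k := by
    have h4 : liminf (fun j => ENNReal.ofReal (∫ x, c (max (u j) 0) x)) atTop ≤
        liminf (fun _ : ℕ => ENNReal.ofReal k) atTop :=
      liminf_le_liminf (Filter.Eventually.of_forall fun j => ENNReal.ofReal_le_ofReal (hu j))
    rwa [liminf_const] at h4
  exact (ENNReal.ofReal_le_ofReal_iff hk).1 (h1.trans h3)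

lemma mass_eq (hF : KF K a lam C Ψ) (hS : Sol K n c) {t : ℝ} (ht : 0 ≤ t) :
    ∫ x, c t x = ∫ x, c 0 x := by
  set N : ℝ → ℝ := fun τ => ∫ x, c (max τ 0) x with hN
  let E : Set ℝ := {τ | ¬ ∃ M, ∀ᶠ r in 𝓝 τ, N r ≤ M}
  have hEc : IsClosed E := by
    rw [← isOpen_compl_iff, isOpen_iff_mem_nhds]
    intro τ hτ
    simp only [E, mem_compl_iff, mem_ofPred_eq, not_not] at hτ
    obtain ⟨M, hM⟩ := hτ
    filter_upwards [eventually_eventually_nhds.2 hM] with r hr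
    simp only [E, mem_compl_iff, mem_ofPred_eq, not_not]
    exact ⟨M, hr⟩
  have A0 : ∀ p q, p ≤ q → (∀ r ∈ Icc p q, r ∉ E) → N q = N p := by
    intro p q hpq hr
    refine mass_const' hF hS hpq ?_
    refine isCompact_Icc.induction_on (p := fun S => ∃ M, ∀ τ ∈ S, N τ ≤ M) ⟨0, by simp⟩ ?_ ?_ ?_
    · rintro S S' hSS ⟨M, hM⟩; exact ⟨M, fun τ hτ => hM τ (hSS hτ)⟩
    · rintro S S' ⟨M, hM⟩ ⟨M', hM'⟩
      refine ⟨max M M', fun τ hτ => ?_⟩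
      rcases hτ with h | h
      · exact (hM τ h).trans (le_max_left _ _)
      · exact (hM' τ h).trans (le_max_right _ _)
    · intro x hx
      have := hr x hx
      simp only [E, mem_ofPred_eq, not_not] at this
      obtain ⟨M, hM⟩ := this
      exact ⟨_, mem_nhdsWithin_of_mem_nhds hM, M, fun τ hτ => hτ⟩
  have A1 : ∀ p q, p ≤ q → (∀ r ∈ Ioc p q, r ∉ E) → N q = N p := by
    intro p q hpq hr
    refine mass_const' hF hS hpq ⟨max (N p) (N q), fun τ hτ => ?_⟩
    rcases hτ.1.eq_or_lt with h | h
    · rw [← h]; exact le_max_left _ _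
    · have : N q = N τ := A0 τ q hτ.2 fun r hrr => hr r ⟨h.trans_le hrr.1, hrr.2⟩
      change N τ ≤ _
      rw [← this]; exact le_max_right _ _
  have A2 : ∀ p q, p ≤ q → (∀ r ∈ Ico p q, r ∉ E) → N q = N p := by
    intro p q hpq hr
    refine mass_const' hF hS hpq ⟨max (N p) (N q), fun τ hτ => ?_⟩
    rcases hτ.2.eq_or_lt with h | h
    · rw [h]; exact le_max_right _ _
    · have : N τ = N p := A0 p τ hτ.1 fun r hrr => hr r ⟨hrr.1, hrr.2.trans_lt h⟩
      change N τ ≤ _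
      rw [this]; exact le_max_left _ _
  have hE : E = ∅ := by
    by_contra hne
    have hne' : E.Nonempty := nonempty_iff_ne_empty.2 hne
    have : Nonempty E := hne'.to_subtype
    have : CompleteSpace E := hEc.completeSpace_coe
    obtain ⟨k, hk⟩ := nonempty_interior_of_iUnion_of_closed
      (f := fun k : ℕ => {τ : E | N τ ≤ k})
      (fun k => (mass_lsc hF hS (k:ℝ) (Nat.cast_nonneg k)).preimage continuous_subtype_val)
      (by
        ext τ; simp only [mem_iUnion, mem_ofPred_eq, mem_univ, iff_true]
        exact exists_nat_ge _)
    obtain ⟨t0, ht0⟩ := hk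
    rw [mem_interior_iff_mem_nhds, Metric.mem_nhds_iff] at ht0
    obtain ⟨ε, hε, hb⟩ := ht0
    have hb' : ∀ τ ∈ E, |τ - t0| < ε → N τ ≤ k := by
      intro τ hτ h
      exact hb (show (⟨τ, hτ⟩ : E) ∈ Metric.ball t0 ε by
        rw [Metric.mem_ball, Subtype.dist_eq, Real.dist_eq]; exact h)
    apply t0.2
    refine ⟨k, ?_⟩
    filter_upwards [Metric.ball_mem_nhds (t0:ℝ) hε] with τ hτ
    rw [Metric.mem_ball, Real.dist_eq] at hτ
    by_cases hτE : τ ∈ E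
    · exact hb' τ hτE hτ
    rcases le_total (t0:ℝ) τ with h | h
    · obtain ⟨p, hp1, hp2⟩ := (isCompact_Icc.inter_left hEc : IsCompact (E ∩ Icc (t0:ℝ) τ)).exists_isGreatest
        ⟨t0, t0.2, le_rfl, h⟩
      rw [A1 p τ hp1.2.2 (fun r hr hrE => by
        have := hp2 ⟨hrE, hp1.2.1.trans hr.1.le, hr.2⟩
        exact absurd this (not_le.2 hr.1))]
      refine hb' p hp1.1 ?_
      have := hp1.2.1; have := hp1.2.2
      rw [abs_lt] at hτ ⊢; constructor <;> linarith
    · obtain ⟨p, hp1, hp2⟩ := (isCompact_Icc.inter_left hEc : IsCompact (E ∩ Icc τ (t0:ℝ))).exists_isLeast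
        ⟨t0, t0.2, h, le_rfl⟩
      rw [← A2 τ p hp1.2.1 (fun r hr hrE => by
        have := hp2 ⟨hrE, hr.1, hr.2.le.trans hp1.2.2⟩
        exact absurd this (not_le.2 hr.2))]
      refine hb' p hp1.1 ?_
      have := hp1.2.1; have := hp1.2.2
      rw [abs_lt] at hτ ⊢; constructor <;> linarith
  have := A0 0 t ht (by simp [hE])
  simpa [hN, max_eq_left ht] using this

end


/-- weights dominated by `Wt` -/
def Dom (a lam : ℝ) (U : ℝ → ℝ) : Prop := Measurable U ∧ ∃ D, ∀ x, 0 < x → |U x| ≤ D * Wt a lam x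

lemma Wt_bdd {a lam : ℝ} (ha : 0 ≤ a) (hl : 0 ≤ lam) (n : ℕ) :
    ∃ F, 0 ≤ F ∧ ∀ x ∈ Ioo (1/(n:ℝ)) n, Wt a lam x ≤ F := by
  rcases Nat.eq_zero_or_pos n with rfl | hn
  · exact ⟨0, le_rfl, fun x hx => by simp at hx⟩
  · have hn' : (0:ℝ) < 1/(n:ℝ) := by positivity
    have := hatm_pos hn'; have := checkm_pos n
    refine ⟨hatm (1/(n:ℝ)) ^ (-a) * checkm n ^ lam, by positivity, fun x hx => ?_⟩
    unfold Wt
    have h1 := hatm_rpow_anti ha hn' hx.1.le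
    have h2 : checkm x ≤ checkm n := max_le_max le_rfl hx.2.le
    have := checkm_pos x
    gcongr

lemma Dom.bdd {a lam : ℝ} {U : ℝ → ℝ} (hU : Dom a lam U) (ha : 0 ≤ a) (hl : 0 ≤ lam) (n : ℕ) :
    ∃ F, 0 ≤ F ∧ ∀ x ∈ Ioo (1/(n:ℝ)) n, |U x| ≤ F := by
  obtain ⟨F, hF0, hF⟩ := Wt_bdd ha hl n
  obtain ⟨_, D, hD⟩ := hU
  refine ⟨|D| * F, by positivity, fun x hx => ?_⟩
  have h0 := inv_pos_n n
  have hx0 : 0 < x := h0.trans_lt hx.1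
  refine (hD x hx0).trans ?_
  have := Wt_pos a lam hx0
  have := hF x hx
  have := le_abs_self D
  gcongr

section
variable {a lam : ℝ}

lemma Dom.mono {U V : ℝ → ℝ} (hV : Dom a lam V) (hU : Measurable U) (h : ∀ x, 0 < x → |U x| ≤ |V x|) :
    Dom a lam U := ⟨hU, hV.2.choose, fun x hx => (h x hx).trans (hV.2.choose_spec x hx)⟩

lemma Dom.Wt : Dom a lam (Wt a lam) :=
  ⟨Wt_meas a lam, 1, fun x hx => by rw [abs_of_pos (Wt_pos a lam hx), one_mul]⟩

lemma Dom.ofle {U : ℝ → ℝ} (hU : Measurable U) (h0 : ∀ x, 0 < x → 0 ≤ U x) (h : ∀ x, 0 < x → U x ≤ _root_.Wt a lam x) :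
    Dom a lam U := ⟨hU, 1, fun x hx => by rw [abs_of_nonneg (h0 x hx), one_mul]; exact h x hx⟩

lemma Dom.check (ha : 0 ≤ a) : Dom a lam (fun x => checkm x ^ lam) :=
  Dom.ofle (checkm_meas.pow_const _) (fun x _ => (Real.rpow_pos_of_pos (checkm_pos x) _).le)
    (fun _ hx => Wt_ge_check ha hx)

lemma Dom.hat (hl : 0 ≤ lam) : Dom a lam (fun x => hatm x ^ (-a)) :=
  Dom.ofle (hatm_meas.pow_const _) (fun _ hx => (Real.rpow_pos_of_pos (hatm_pos hx) _).le)
    (fun _ hx => Wt_ge_hat hl hx)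

lemma checkm_le_rpow (hl : 1 ≤ lam) (x : ℝ) : checkm x ≤ checkm x ^ lam := by
  calc checkm x = checkm x ^ (1:ℝ) := (Real.rpow_one _).symm
    _ ≤ _ := Real.rpow_le_rpow_of_exponent_le (one_le_checkm x) hl

lemma Dom.check1 (ha : 0 ≤ a) (hl : 1 ≤ lam) : Dom a lam checkm :=
  Dom.ofle checkm_meas (fun x _ => (checkm_pos x).le)
    (fun x hx => (checkm_le_rpow hl x).trans (Wt_ge_check ha hx))

lemma Dom.one (ha : 0 ≤ a) (hl : 0 ≤ lam) : Dom a lam (fun _ => 1) :=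
  Dom.ofle measurable_const (fun _ _ => zero_le_one) (fun _ hx => Wt_ge_one ha hl hx)

lemma Dom.id (ha : 0 ≤ a) (hl : 1 ≤ lam) : Dom a lam (fun x => x) :=
  Dom.ofle measurable_id (fun _ h => h.le)
    (fun x hx => (le_checkm x).trans ((checkm_le_rpow hl x).trans (Wt_ge_check ha hx)))

lemma rpow_le_check (hl : 0 ≤ lam) {x : ℝ} (hx : 0 < x) : x ^ lam ≤ checkm x ^ lam :=
  Real.rpow_le_rpow hx.le (le_checkm x) hl

lemma Dom.rpow (ha : 0 ≤ a) (hl : 0 ≤ lam) : Dom a lam (fun x => x ^ lam) :=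
  Dom.ofle (measurable_id.pow_const _) (fun _ h => (Real.rpow_pos_of_pos h _).le)
    (fun _ hx => (rpow_le_check hl hx).trans (Wt_ge_check ha hx))

lemma fR_le (hl : 0 ≤ lam) {R x : ℝ} (hR : 0 ≤ R) (hx : 0 < x) : fR lam R x ≤ checkm x ^ lam := by
  unfold fR
  have h1 : x / (x+R) ≤ 1 := by rw [div_le_one (by positivity)]; linarith
  have := rpow_le_check hl hx
  calc _ ≤ x^lam * 1 := by gcongr
    _ ≤ _ := by rw [mul_one]; exact this

lemma fR_meas (R : ℝ) : Measurable (fR lam R) := by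
  unfold fR
  exact (measurable_id.pow_const _).mul (measurable_id.div (measurable_id.add_const R))

lemma Dom.fR (ha : 0 ≤ a) (hl : 0 ≤ lam) {R : ℝ} (hR : 0 ≤ R) : Dom a lam (fR lam R) :=
  Dom.ofle (fR_meas R) (fun _ h => fR_nonneg _ _ _ hR h.le)
    (fun _ hx => (fR_le hl hR hx).trans (Wt_ge_check ha hx))

lemma Dom.cmul {U : ℝ → ℝ} (hU : Dom a lam U) (k : ℝ) : Dom a lam (fun x => k * U x) := by
  obtain ⟨h, D, hD⟩ := hU
  refine ⟨h.const_mul k, |k| * D, fun x hx => ?_⟩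
  rw [abs_mul, mul_assoc]
  have := hD x hx
  gcongr

lemma Dom.ind {U : ℝ → ℝ} (hU : Dom a lam U) {s : Set ℝ} (hs : MeasurableSet s) : Dom a lam (s.indicator U) :=
  hU.mono (hU.1.indicator hs) (fun x _ => by
    by_cases h : x ∈ s <;> simp [h])

lemma Dom.int {U : ℝ → ℝ} (hU : Dom a lam U) (ha : 0 ≤ a) (hl : 0 ≤ lam) {n : ℕ} {c : ℝ → ℝ} (hc : Nice n c) :
    Integrable (fun x => U x * c x) := by
  obtain ⟨F, hF0, hF⟩ := hU.bdd ha hl n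
  refine Integrable.mono' (hc.i.const_mul F) (hU.1.mul hc.m).aestronglyMeasurable
    (Filter.Eventually.of_forall fun x => ?_)
  rw [norm_mul, Real.norm_eq_abs, Real.norm_eq_abs, abs_of_nonneg (hc.nn x)]
  by_cases hx : x ∈ Ioo (1/(n:ℝ)) n
  · have := hF x hx
    have := hc.nn x
    gcongr
  · rw [hc.z x hx]; simp

/-- monotonicity of weighted integrals -/
lemma Nice.mono {n : ℕ} {c : ℝ → ℝ} (hc : Nice n c) (ha : 0 ≤ a) (hl : 0 ≤ lam) {U V : ℝ → ℝ} (hU : Dom a lam U)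
    (hV : Dom a lam V) (h : ∀ x, 0 < x → U x ≤ V x) : ∫ x, U x * c x ≤ ∫ x, V x * c x := by
  refine integral_mono (hU.int ha hl hc) (hV.int ha hl hc) fun x => ?_
  by_cases hx : x ∈ Ioo (1/(n:ℝ)) n
  · exact mul_le_mul_of_nonneg_right (h x ((inv_pos_n n).trans_lt hx.1)) (hc.nn x)
  · simp [hc.z x hx]

lemma Nice.nonneg {n : ℕ} {c : ℝ → ℝ} (hc : Nice n c) {U : ℝ → ℝ} (h : ∀ x, 0 < x → 0 ≤ U x) :
    0 ≤ ∫ x, U x * c x := by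
  refine integral_nonneg fun x => ?_
  by_cases hx : x ∈ Ioo (1/(n:ℝ)) n
  · exact mul_nonneg (h x ((inv_pos_n n).trans_lt hx.1)) (hc.nn x)
  · simp [hc.z x hx]

end

section
variable {K : ℝ → ℝ → ℝ → ℝ} {a lam C : ℝ} {Ψ : ℝ → ℝ} {n : ℕ} {c : ℝ → ℝ → ℝ}

lemma Qf_congr {u q q' : ℝ → ℝ} (h : ∀ x ∈ Ioo (1/(n:ℝ)) n, q x = q' x) : Qf K n u q = Qf K n u q' := by
  unfold Qf
  congr 1; ext p
  by_cases hk : Ktrunc K n p.1 p.2.2 p.2.1 = 0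
  · simp [Jd, hk]
  · obtain ⟨s1, s2, s3, s4, s5, s6, s7⟩ := Ktrunc_supp hk
    have h0 := inv_pos_n n
    rw [h (p.1 + p.2.1) ⟨by linarith, by linarith⟩, h (p.1 - p.2.1) ⟨by linarith, by linarith⟩,
      h p.1 ⟨by linarith, by linarith⟩]

lemma KF.hl (hF : KF K a lam C Ψ) : 0 ≤ lam := by linarith [hF.h1]

lemma mass_bdd (hF : KF K a lam C Ψ) (hS : Sol K n c) {s t : ℝ} (hs : 0 ≤ s) :
    ∃ M, ∀ τ ∈ Icc s t, ∫ x, c τ x ≤ M :=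
  ⟨∫ x, c 0 x, fun _ hτ => (mass_eq hF hS (hs.trans hτ.1)).le⟩

/-- the weak form with unbounded weights -/
lemma weakD (hF : KF K a lam C Ψ) (hS : Sol K n c) {s t : ℝ} (hs : 0 ≤ s) (hst : s ≤ t)
    (f : ℝ → ℝ) (hf : Dom a lam f)
    (σ β : ℝ → ℝ) (hσm : Measurable σ) (hβm : Measurable β) (hβ : ∀ r, 0 ≤ r → |β r| ≤ 1)
    (hσ : ∀ r, 0 ≤ r → |σ r| ≤ r) (hd : ∀ r, 0 ≤ r → HasDerivAt σ (β r) r) :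
    IntervalIntegrable (fun τ => Qf K n (c τ) (fun x => f x * β (c τ x))) volume s t ∧
    (∫ x, f x * σ (c t x)) - (∫ x, f x * σ (c s x)) =
      ∫ τ in s..t, Qf K n (c τ) (fun x => f x * β (c τ x)) := by
  obtain ⟨F, hF0, hFb⟩ := hf.bdd hF.ha hF.hl n
  have h := weakform hF hS hs hst (mass_bdd hF hS hs) ((Ioo (1/(n:ℝ)) n).indicator f)
    (hf.1.indicator measurableSet_Ioo) F (fun x => by
      by_cases hx : x ∈ Ioo (1/(n:ℝ)) n
      · rw [indicator_of_mem hx]; exact hFb x hx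
      · rw [indicator_of_notMem hx]; simpa using hF0) σ β hσm hβm hβ hσ hd
  have e1 : ∀ τ, Qf K n (c τ) (fun x => (Ioo (1/(n:ℝ)) (n:ℝ)).indicator f x * β (c τ x)) =
      Qf K n (c τ) (fun x => f x * β (c τ x)) := fun τ => Qf_congr fun x hx => by
    simp only [indicator_of_mem hx]
  have hσ0 : σ 0 = 0 := by have := hσ 0 le_rfl; simpa using this
  have e2 : ∀ τ, ∫ x, (Ioo (1/(n:ℝ)) (n:ℝ)).indicator f x * σ (c τ x) = ∫ x, f x * σ (c τ x) := fun τ => by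
    congr 1; ext x
    by_cases hx : x ∈ Ioo (1/(n:ℝ)) n
    · rw [indicator_of_mem hx]
    · rw [hS.s.zero_outside τ x hx, hσ0]; simp
  simp only [e1, e2] at h
  exact h

lemma weakL (hF : KF K a lam C Ψ) (hS : Sol K n c) {s t : ℝ} (hs : 0 ≤ s) (hst : s ≤ t)
    (f : ℝ → ℝ) (hf : Dom a lam f) :
    IntervalIntegrable (fun τ => Qf K n (c τ) f) volume s t ∧
    (∫ x, f x * c t x) - (∫ x, f x * c s x) = ∫ τ in s..t, Qf K n (c τ) f := by
  have := weakD hF hS hs hst f hf (fun r => r) (fun _ => 1) measurable_id measurable_const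
    (fun r _ => by simp) (fun r hr => by rw [abs_of_nonneg hr]) (fun r _ => hasDerivAt_id r)
  simpa using this

lemma gronD (hF : KF K a lam C Ψ) (hS : Sol K n c) {T : ℝ} (hT : 0 < T)
    (f : ℝ → ℝ) (hf : Dom a lam f) (hf0 : ∀ x, 0 < x → 0 ≤ f x)
    (σ β : ℝ → ℝ) (hσm : Measurable σ) (hβm : Measurable β) (hβ : ∀ r, 0 ≤ r → |β r| ≤ 1)
    (hσ0 : ∀ r, 0 ≤ r → 0 ≤ σ r)
    (hσ : ∀ r, 0 ≤ r → |σ r| ≤ r) (hd : ∀ r, 0 ≤ r → HasDerivAt σ (β r) r)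
    (B E : ℝ) (hB : 0 < B) (hE : 0 ≤ E)
    (h : ∀ τ ∈ Icc 0 T, Qf K n (c τ) (fun x => f x * β (c τ x)) ≤ B * (∫ x, f x * σ (c τ x)) + E) :
    ∀ t ∈ Icc 0 T, ∫ x, f x * σ (c t x) ≤ 2 * ((∫ x, f x * σ (c 0 x)) + E * T) * Real.exp (2*B*T) := by
  have hz : ∀ τ x, x ∉ Ioo (1/(n:ℝ)) n → σ (c τ x) = 0 := by
    intro τ x hx
    rw [hS.s.zero_outside τ x hx]
    have := hσ 0 le_rfl; simpa using this
  have hpw : ∀ τ, 0 ≤ τ → ∀ x, 0 ≤ f x * σ (c τ x) := by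
    intro τ hτ x
    by_cases hx : x ∈ Ioo (1/(n:ℝ)) n
    · exact mul_nonneg (hf0 x ((inv_pos_n n).trans_lt hx.1)) (hσ0 _ (hS.nn τ x hτ))
    · rw [hz τ x hx, mul_zero]
  obtain ⟨F, hF0, hFb⟩ := hf.bdd hF.ha hF.hl n
  refine gron T B E hT hB hE (fun t => ∫ x, f x * σ (c t x)) (fun τ => Qf K n (c τ) (fun x => f x * β (c τ x)))
    (fun t ht => integral_nonneg (hpw t ht.1)) ⟨F * ∫ x, c 0 x, fun t ht => ?_⟩
    (fun t ht => weakD hF hS le_rfl ht.1 f hf σ β hσm hβm hβ hσ hd) h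
  have hn := hS.nice ht.1
  rw [← mass_eq hF hS ht.1, ← integral_const_mul]
  refine integral_mono_of_nonneg (Filter.Eventually.of_forall (hpw t ht.1)) (hn.i.const_mul F)
    (Filter.Eventually.of_forall fun x => ?_)
  by_cases hx : x ∈ Ioo (1/(n:ℝ)) n
  · have h1 := hFb x hx
    have h2 := (le_abs_self _).trans (hσ _ (hn.nn x))
    have h3 := (le_abs_self _).trans h1
    have := hσ0 _ (hn.nn x)
    simp only
    gcongr
  · show f x * σ (c t x) ≤ F * c t x
    rw [hz t x hx, hn.z x hx, mul_zero, mul_zero]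

lemma gronL (hF : KF K a lam C Ψ) (hS : Sol K n c) {T : ℝ} (hT : 0 < T)
    (f : ℝ → ℝ) (hf : Dom a lam f) (hf0 : ∀ x, 0 < x → 0 ≤ f x)
    (B E : ℝ) (hB : 0 < B) (hE : 0 ≤ E)
    (h : ∀ τ ∈ Icc 0 T, Qf K n (c τ) f ≤ B * (∫ x, f x * c τ x) + E) :
    ∀ t ∈ Icc 0 T, ∫ x, f x * c t x ≤ 2 * ((∫ x, f x * c 0 x) + E * T) * Real.exp (2*B*T) :=
  gronD hF hS hT f hf hf0 (fun r => r) (fun _ => 1) measurable_id measurable_const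
    (fun r _ => by simp) (fun r hr => hr) (fun r hr => by rw [abs_of_nonneg hr]) (fun r _ => hasDerivAt_id r)
    B E hB hE (by simpa using h)

lemma QD_le (hF : KF K a lam C Ψ) {u : ℝ → ℝ} (hc : Nice n u) (q U1 V1 U2 V2 : ℝ → ℝ)
    (i1 : Dom a lam U1) (i2 : Dom a lam V1) (i3 : Dom a lam U2) (i4 : Dom a lam V2)
    (hq : Dom a lam q)
    (h : ∀ x y z, Ktrunc K n x y z ≠ 0 → 0 < z → z < x → z < y →
      K x y z * (q (x+z) + q (x-z) - 2 * q x) ≤ Ψ z * (U1 x * V1 y + U2 x * V2 y))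
    (h' : ∀ x y, 0 < x → 0 < y → 0 ≤ U1 x * V1 y + U2 x * V2 y) :
    Qf K n u q ≤ (∫ z, Ψ z) * ((∫ x, U1 x * u x) * (∫ x, V1 x * u x) + (∫ x, U2 x * u x) * (∫ x, V2 x * u x)) := by
  have ha := hF.ha; have hl := hF.hl
  obtain ⟨F, hF0, hFb⟩ := hq.bdd ha hl n
  have h0 := inv_pos_n n
  refine Q_le hF hc q U1 V1 U2 V2 (i1.int ha hl hc) (i2.int ha hl hc) (i3.int ha hl hc) (i4.int ha hl hc)
    hq.1 F hFb ?_ (fun x y hx hy => h' x y (h0.trans_lt hx.1) (h0.trans_lt hy.1))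
  intro x y z hk _ _
  obtain ⟨s1, s2, s3, s4, s5, s6, s7⟩ := Ktrunc_supp hk
  have := h x y z hk (by linarith) (by linarith) (by linarith)
  rwa [Ktrunc_eq hk]

lemma QD_le1 (hF : KF K a lam C Ψ) {u : ℝ → ℝ} (hc : Nice n u) (q U1 V1 : ℝ → ℝ)
    (i1 : Dom a lam U1) (i2 : Dom a lam V1) (hq : Dom a lam q)
    (h : ∀ x y z, Ktrunc K n x y z ≠ 0 → 0 < z → z < x → z < y →
      K x y z * (q (x+z) + q (x-z) - 2 * q x) ≤ Ψ z * (U1 x * V1 y))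
    (h' : ∀ x y, 0 < x → 0 < y → 0 ≤ U1 x * V1 y) :
    Qf K n u q ≤ (∫ z, Ψ z) * ((∫ x, U1 x * u x) * (∫ x, V1 x * u x)) := by
  have := QD_le hF hc q U1 V1 (fun x => 0 * U1 x) (fun x => 0 * U1 x) i1 i2 (i1.cmul 0) (i1.cmul 0) hq
    (by simpa using h) (by simpa using h')
  simpa using this

end


/-- dominating initial datum -/
structure Dat (a lam : ℝ) (g0 : ℝ → ℝ) : Prop where
  m : Measurable g0
  nn : ∀ x, 0 ≤ g0 x
  z : ∀ x, x ≤ 0 → g0 x = 0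
  i : Integrable (fun x => Wt a lam x * g0 x)

section
variable {K : ℝ → ℝ → ℝ → ℝ} {a lam C : ℝ} {Ψ : ℝ → ℝ} {g0 : ℝ → ℝ} {T : ℝ}

lemma Dat.wi {U : ℝ → ℝ} (hg : Dat a lam g0) (hU : Measurable U)
    (h : ∀ x, 0 < x → |U x| ≤ Wt a lam x) : Integrable (fun x => U x * g0 x) := by
  refine Integrable.mono' hg.i (hU.mul hg.m).aestronglyMeasurable (Filter.Eventually.of_forall fun x => ?_)
  rw [norm_mul, Real.norm_eq_abs, Real.norm_eq_abs, abs_of_nonneg (hg.nn x)]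
  rcases le_or_gt x 0 with hx | hx
  · rw [hg.z x hx]; simp
  · exact mul_le_mul_of_nonneg_right (h x hx) (hg.nn x)

lemma Dat.init {n : ℕ} {u : ℝ → ℝ} (hg : Dat a lam g0) (ha : 0 ≤ a) (hl : 0 ≤ lam) (hc : Nice n u)
    (h0 : ∀ x, u x ≤ g0 x) {U : ℝ → ℝ}
    (hU : Measurable U) (hU0 : ∀ x, 0 < x → 0 ≤ U x) (h : ∀ x, 0 < x → U x ≤ Wt a lam x) :
    ∫ x, U x * u x ≤ ∫ x, U x * g0 x := by
  refine integral_mono ((Dom.ofle hU hU0 h).int ha hl hc)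
    (hg.wi hU fun x hx => by rw [abs_of_nonneg (hU0 x hx)]; exact h x hx) fun x => ?_
  show U x * u x ≤ U x * g0 x
  rcases le_or_gt x 0 with hx | hx
  · rw [hg.z x hx, hc.z x (fun h => by have := (inv_pos_n n).trans_lt h.1; linarith)]
  · exact mul_le_mul_of_nonneg_left (h0 x) (hU0 x hx)

lemma Dat.wle (hg : Dat a lam g0) {U : ℝ → ℝ} 
    (hU : Measurable U) (hU0 : ∀ x, 0 < x → 0 ≤ U x) (h : ∀ x, 0 < x → U x ≤ Wt a lam x) :
    ∫ x, U x * g0 x ≤ ∫ x, Wt a lam x * g0 x := by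
  refine integral_mono (hg.wi hU fun x hx => by rw [abs_of_nonneg (hU0 x hx)]; exact h x hx) hg.i fun x => ?_
  show U x * g0 x ≤ Wt a lam x * g0 x
  rcases le_or_gt x 0 with hx | hx
  · rw [hg.z x hx]; simp
  · exact mul_le_mul_of_nonneg_right (h x hx) (hg.nn x)

lemma Dat.D0 (hg : Dat a lam g0) : 0 ≤ ∫ x, Wt a lam x * g0 x := by
  refine integral_nonneg fun x => ?_
  rcases le_or_gt x 0 with hx | hx
  · simp [hg.z x hx]
  · exact mul_nonneg (Wt_pos a lam hx).le (hg.nn x)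

lemma Dom.add {U V : ℝ → ℝ} (hU : Dom a lam U) (hV : Dom a lam V) : Dom a lam (fun x => U x + V x) := by
  obtain ⟨h1, D1, h2⟩ := hU
  obtain ⟨h3, D2, h4⟩ := hV
  refine ⟨h1.add h3, D1 + D2, fun x hx => ?_⟩
  have := abs_add_le (U x) (V x)
  linarith [h2 x hx, h4 x hx, add_mul D1 D2 (_root_.Wt a lam x)]

lemma Dom.int_add {n : ℕ} {u U V : ℝ → ℝ} (ha : 0 ≤ a) (hl : 0 ≤ lam) (hc : Nice n u)
    (hU : Dom a lam U) (hV : Dom a lam V) :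
    ∫ x, (U x + V x) * u x = (∫ x, U x * u x) + ∫ x, V x * u x := by
  rw [← integral_add (hU.int ha hl hc) (hV.int ha hl hc)]
  congr 1; ext x; ring

lemma int_cmul (U u : ℝ → ℝ) (k : ℝ) : ∫ x, k * U x * u x = k * ∫ x, U x * u x := by
  rw [← integral_const_mul]; congr 1; ext x; ring

lemma KF.P0 (hF : KF K a lam C Ψ) : 0 ≤ ∫ z, Ψ z := integral_nonneg hF.Pnn

lemma E0 (hF : KF K a lam C Ψ) (hg : Dat a lam g0) {n : ℕ} {c : ℝ → ℝ → ℝ} (hS : Sol K n c)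
    (h0 : ∀ x, c 0 x ≤ g0 x) {t : ℝ} (ht : 0 ≤ t) :
    ∫ x, checkm x * c t x ≤ 2 * ∫ x, Wt a lam x * g0 x := by
  have ha := hF.ha; have hl := hF.hl; have hl1 := hF.h1.le
  have hd := (Dom.one (a := a) (lam := lam) ha hl).add (Dom.id ha hl1)
  have hw := (weakL hF hS le_rfl ht _ hd).2
  have hq : ∀ u, Qf K n u (fun x => 1 + x) = 0 := by
    intro u; unfold Qf
    rw [← integral_zero (ℝ × ℝ × ℝ) ℝ (μ := volume)]
    congr 1; ext p; ring
  simp only [hq] at hw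
  rw [intervalIntegral.integral_zero] at hw
  have h1 : ∫ x, checkm x * c t x ≤ ∫ x, (1 + x) * c t x := by
    refine (hS.nice ht).mono ha hl (Dom.check1 ha hl1) hd fun x hx => ?_
    exact max_le (by linarith) (by linarith)
  have n0 := hS.nice le_rfl
  have h2 := Dom.int_add ha hl n0 (Dom.one (a := a) (lam := lam) ha hl) (Dom.id ha hl1)
  have h3 := (hg.init ha hl n0 h0 (U := fun _ => 1) measurable_const (fun _ _ => zero_le_one)
    (fun x hx => Wt_ge_one ha hl hx)).trans (hg.wle measurable_const (fun _ _ => zero_le_one)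
    (fun x hx => Wt_ge_one ha hl hx))
  have hid : ∀ x, 0 < x → x ≤ Wt a lam x :=
    fun x hx => (le_checkm x).trans ((checkm_le_rpow hl1 x).trans (Wt_ge_check ha hx))
  have h4 := (hg.init ha hl n0 h0 (U := fun x => x) measurable_id (fun _ h => h.le) hid).trans
    (hg.wle measurable_id (fun _ h => h.le) hid)
  linarith

lemma check_le_add (lam x : ℝ) (hx : 0 < x) : checkm x ^ lam ≤ 1 + x ^ lam := by
  have := Real.rpow_pos_of_pos hx lam
  rcases le_total x 1 with h | h
  · rw [checkm, max_eq_left h, Real.one_rpow]; linarith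
  · rw [checkm, max_eq_right h]; linarith

lemma E1 (hF : KF K a lam C Ψ) (hg : Dat a lam g0) (hT : 0 < T) :
    ∃ M, 0 ≤ M ∧ ∀ (n : ℕ) (c : ℝ → ℝ → ℝ), Sol K n c → (∀ x, c 0 x ≤ g0 x) → ∀ t ∈ Icc 0 T,
      ∫ x, checkm x ^ lam * c t x ≤ M := by
  have ha := hF.ha; have hl := hF.hl; have hl1 := hF.h1.le
  set D0 := ∫ x, Wt a lam x * g0 x with hD0
  have hD := hg.D0
  set P := ∫ z, Ψ z with hP
  have hP0 := hF.P0
  have hC := hF.hC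
  set B := 4*P*C*D0 + 1 with hB
  set E := 4*P*C*D0*D0 with hE
  refine ⟨D0 + 2 * (D0 + E * T) * Real.exp (2*B*T), by positivity, fun n c hS h0 t ht => ?_⟩
  have n0 := hS.nice le_rfl
  have key : ∀ τ ∈ Icc 0 T, ∫ x, checkm x ^ lam * c τ x ≤ D0 + ∫ x, x ^ lam * c τ x := by
    intro τ hτ
    have nt := hS.nice hτ.1
    refine (nt.mono ha hl (Dom.check ha) ((Dom.one ha hl).add (Dom.rpow ha hl))
      (fun x hx => check_le_add lam x hx)).trans ?_
    rw [Dom.int_add ha hl nt (Dom.one ha hl) (Dom.rpow ha hl)]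
    have h3 := (hg.init ha hl n0 h0 (U := fun _ => 1) measurable_const (fun _ _ => zero_le_one)
      (fun x hx => Wt_ge_one ha hl hx)).trans (hg.wle measurable_const (fun _ _ => zero_le_one)
      (fun x hx => Wt_ge_one ha hl hx))
    have h4 := mass_eq hF hS hτ.1
    simp only [one_mul] at h3 ⊢
    linarith
  have hm : ∀ x, 0 < x → x ^ lam ≤ Wt a lam x := fun x hx => (rpow_le_check hl hx).trans (Wt_ge_check ha hx)
  have hG := gronL hF hS hT (fun x => x ^ lam) (Dom.rpow ha hl) (fun x hx => (Real.rpow_pos_of_pos hx _).le)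
    B E (by positivity) (by positivity) (fun τ hτ => ?_) t ht
  · have h5 := (hg.init ha hl n0 h0 (U := fun x => x ^ lam) (measurable_id.pow_const _)
      (fun x hx => (Real.rpow_pos_of_pos hx _).le) hm).trans
      (hg.wle (measurable_id.pow_const _) (fun x hx => (Real.rpow_pos_of_pos hx _).le) hm)
    refine (key t ht).trans ?_
    refine add_le_add le_rfl (hG.trans ?_)
    gcongr
  · have nt := hS.nice hτ.1
    have hq := QD_le hF nt (fun x => x ^ lam) (fun x => C * checkm x ^ lam) checkm (fun x => C * checkm x)
      (fun x => checkm x ^ lam) ((Dom.check ha).cmul C) (Dom.check1 ha hl1) ((Dom.check1 ha hl1).cmul C)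
      (Dom.check ha) (Dom.rpow ha hl) (fun x y z _ h1 h2 h3 => (hF.b1 x y z h1 h2 h3).trans (le_of_eq (by ring)))
      (fun x y _ _ => by
        have := checkm_pos x; have := checkm_pos y
        positivity)
    refine hq.trans ?_
    rw [int_cmul, int_cmul]
    have k1 := key τ hτ
    have k2 := E0 hF hg hS h0 hτ.1
    have k3 : 0 ≤ ∫ x, checkm x * c τ x := nt.nonneg fun x _ => (checkm_pos x).le
    have k4 : 0 ≤ ∫ x, x ^ lam * c τ x := nt.nonneg fun x hx => (Real.rpow_pos_of_pos hx _).le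
    rw [← hD0] at k2
    rw [← hP]
    set X := ∫ x, checkm x ^ lam * c τ x
    set Y := ∫ x, checkm x * c τ x
    set m := ∫ x, x ^ lam * c τ x
    calc P * (C * X * Y + C * Y * X) = 2 * P * C * (X * Y) := by ring
      _ ≤ 2 * P * C * ((D0 + m) * (2 * D0)) := by gcongr
      _ ≤ B * m + E := by rw [hB, hE]; nlinarith

lemma E2 (hF : KF K a lam C Ψ) (hg : Dat a lam g0) (hT : 0 < T) :
    ∃ M, 0 ≤ M ∧ ∀ (n : ℕ) (c : ℝ → ℝ → ℝ), Sol K n c → (∀ x, c 0 x ≤ g0 x) → ∀ t ∈ Icc 0 T,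
      ∫ x, Wt a lam x * c t x ≤ M := by
  have ha := hF.ha; have hl := hF.hl; have hl1 := hF.h1.le
  obtain ⟨M, hM0, hM⟩ := E1 hF hg hT
  set D0 := ∫ x, Wt a lam x * g0 x with hD0
  have hD := hg.D0
  set P := ∫ z, Ψ z with hP
  have hP0 := hF.P0
  have hC := hF.hC
  set B := P*C*M + 1 with hB
  set E := P*C*M*M with hE
  refine ⟨2 * (D0 + E * T) * Real.exp (2*B*T) + M, by positivity, fun n c hS h0 t ht => ?_⟩
  have n0 := hS.nice le_rfl
  have key : ∀ τ ∈ Icc 0 T, ∫ x, Wt a lam x * c τ x ≤ (∫ x, hatm x ^ (-a) * c τ x) + M := by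
    intro τ hτ
    have nt := hS.nice hτ.1
    refine (nt.mono ha hl Dom.Wt ((Dom.hat hl).add (Dom.check ha)) (fun x hx => ?_)).trans ?_
    · unfold Wt
      have h1 : 0 < hatm x ^ (-a) := Real.rpow_pos_of_pos (hatm_pos hx) _
      have h2 : 0 < checkm x ^ lam := Real.rpow_pos_of_pos (checkm_pos x) _
      rcases le_total x 1 with h | h
      · have : checkm x ^ lam = 1 := by rw [checkm, max_eq_left h, Real.one_rpow]
        rw [this]; linarith
      · have : hatm x ^ (-a) = 1 := by rw [hatm, min_eq_left h, Real.one_rpow]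
        rw [this]; linarith
    rw [Dom.int_add ha hl nt (Dom.hat hl) (Dom.check ha)]
    linarith [hM n c hS h0 τ hτ]
  have hm0 : ∀ x, 0 < x → 0 ≤ hatm x ^ (-a) := fun x hx => (Real.rpow_pos_of_pos (hatm_pos hx) _).le
  have hG := gronL hF hS hT (fun x => hatm x ^ (-a)) (Dom.hat hl) hm0
    B E (by positivity) (by positivity) (fun τ hτ => ?_) t ht
  · have h5 := (hg.init ha hl n0 h0 (U := fun x => hatm x ^ (-a)) (hatm_meas.pow_const _)
      hm0 (fun x hx => Wt_ge_hat hl hx)).trans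
      (hg.wle (hatm_meas.pow_const _) hm0 (fun x hx => Wt_ge_hat hl hx))
    refine (key t ht).trans ?_
    refine add_le_add (hG.trans ?_) le_rfl
    gcongr
  · have nt := hS.nice hτ.1
    have hq := QD_le1 hF nt (fun x => hatm x ^ (-a)) (fun x => C * checkm x ^ lam) (Wt a lam)
      ((Dom.check ha).cmul C) Dom.Wt (Dom.hat hl) (fun x y z _ h1 h2 h3 => by
        have hx : 0 < x := by linarith
        have q1 := hatm_rpow_anti ha hx (show x ≤ x + z by linarith)
        have q2 := hm0 x hx
        have q3 := hF.bs x y z h1 h2 h3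
        have q4 := hF.ker.nonneg x y z
        calc _ ≤ K x y z * hatm (x-z) ^ (-a) := by
              apply mul_le_mul_of_nonneg_left _ q4; linarith
          _ ≤ _ := by linarith) (fun x y _ hy => by
        have := checkm_pos x; have := Wt_pos a lam hy
        positivity)
    refine hq.trans ?_
    rw [int_cmul]
    have k1 := key τ hτ
    have k2 := hM n c hS h0 τ hτ
    have k3 : 0 ≤ ∫ x, Wt a lam x * c τ x := nt.nonneg fun x hx => (Wt_pos a lam hx).le
    have k4 : 0 ≤ ∫ x, hatm x ^ (-a) * c τ x := nt.nonneg hm0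
    rw [← hP]
    set X := ∫ x, checkm x ^ lam * c τ x
    set Y := ∫ x, Wt a lam x * c τ x
    set m := ∫ x, hatm x ^ (-a) * c τ x
    calc P * (C * X * Y) ≤ P * (C * M * (m + M)) := by gcongr
      _ ≤ B * m + E := by rw [hB, hE]; nlinarith

lemma fR_lim (hg : Dat a lam g0) (ha : 0 ≤ a) (hl : 0 ≤ lam) :
    Tendsto (fun R : ℕ => ∫ x, fR lam (R:ℝ) x * g0 x) atTop (𝓝 0) := by
  rw [← integral_zero ℝ ℝ (μ := volume)]
  refine tendsto_integral_of_dominated_convergence (fun x => Wt a lam x * g0 x)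
    (fun R => ((fR_meas _).mul hg.m).aestronglyMeasurable) hg.i (fun R => Filter.Eventually.of_forall fun x => ?_)
    (Filter.Eventually.of_forall fun x => ?_)
  · rw [norm_mul, Real.norm_eq_abs, Real.norm_eq_abs, abs_of_nonneg (hg.nn x)]
    rcases le_or_gt x 0 with hx | hx
    · simp [hg.z x hx]
    · have hR : (0:ℝ) ≤ R := R.cast_nonneg
      rw [abs_of_nonneg (fR_nonneg _ _ _ hR hx.le)]
      exact mul_le_mul_of_nonneg_right ((fR_le hl hR hx).trans (Wt_ge_check ha hx)) (hg.nn x)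
  · have h1 : Tendsto (fun R : ℕ => x / (x + (R:ℝ))) atTop (𝓝 0) :=
      tendsto_const_nhds.div_atTop (tendsto_atTop_add_const_left _ _ tendsto_natCast_atTop_atTop)
    have := (h1.const_mul (x^lam)).mul_const (g0 x)
    simpa [fR] using this

/-- uniform tails -/
lemma E3 (hF : KF K a lam C Ψ) (hg : Dat a lam g0) (hT : 0 < T) :
    ∀ ε > 0, ∃ R : ℝ, 1 ≤ R ∧ ∀ (n : ℕ) (c : ℝ → ℝ → ℝ), Sol K n c → (∀ x, c 0 x ≤ g0 x) → ∀ t ∈ Icc 0 T,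
      ∫ x, (Ici R).indicator (fun x => checkm x ^ lam) x * c t x ≤ ε := by
  have ha := hF.ha; have hl := hF.hl; have hl1 := hF.h1.le
  obtain ⟨M, hM0, hM⟩ := E1 hF hg hT
  intro ε hε
  set P := ∫ z, Ψ z with hP
  have hP0 := hF.P0
  have hC := hF.hC
  set B := P*C*M + 1 with hB
  have hlim := fR_lim hg ha hl
  set A := 4 * Real.exp (2*B*T) with hAdef
  have hA : 0 < A := by positivity
  have hev := (hlim.eventually (gt_mem_nhds (show 0 < ε / A by positivity))).and (eventually_ge_atTop 1)
  obtain ⟨N, hN, hN1⟩ := hev.exists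
  have hR1 : (1:ℝ) ≤ (N:ℝ) := by exact_mod_cast hN1
  set R : ℝ := (N:ℝ) with hR
  have hR0 : 0 ≤ R := by linarith
  refine ⟨R, hR1, fun n c hS h0 t ht => ?_⟩
  have n0 := hS.nice le_rfl
  have nt := hS.nice ht.1
  have hf0 : ∀ x, 0 < x → 0 ≤ fR lam R x := fun x hx => fR_nonneg _ _ _ hR0 hx.le
  have hG := gronL hF hS hT (fR lam R) (Dom.fR ha hl hR0) hf0 B 0 (by positivity) le_rfl (fun τ hτ => ?_) t ht
  · have h5 := hg.init ha hl n0 h0 (fR_meas R) hf0 (fun x hx => (fR_le hl hR0 hx).trans (Wt_ge_check ha hx))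
    have h6 : ∫ x, (Ici R).indicator (fun x => checkm x ^ lam) x * c t x ≤ ∫ x, 2 * fR lam R x * c t x := by
      refine nt.mono ha hl ((Dom.check ha).ind measurableSet_Ici) ((Dom.fR ha hl hR0).cmul 2) fun x hx => ?_
      by_cases h : R ≤ x
      · rw [indicator_of_mem (mem_Ici.2 h)]
        have : checkm x = x := max_eq_right (by linarith)
        rw [this, fR]
        have h2 : 1/2 ≤ x / (x+R) := by rw [div_le_div_iff₀ (by norm_num) (by linarith)]; linarith
        have h3 := Real.rpow_pos_of_pos hx lam
        nlinarith
      · rw [indicator_of_notMem (by simpa using h)]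
        linarith [hf0 x hx]
    rw [int_cmul] at h6
    have h7 : 2 * ∫ x, fR lam R x * c t x ≤ A * ∫ x, fR lam R x * g0 x := by
      have h8 : 0 < Real.exp (2*B*T) := Real.exp_pos _
      rw [hAdef]
      nlinarith
    have h9 : A * ∫ x, fR lam R x * g0 x ≤ ε := by
      rw [lt_div_iff₀ hA] at hN; linarith
    linarith
  · have nt := hS.nice hτ.1
    have hq := QD_le1 hF nt (fR lam R) (fun x => C * fR lam R x) (fun x => checkm x ^ lam)
      ((Dom.fR ha hl hR0).cmul C) (Dom.check ha) (Dom.fR ha hl hR0) (fun x y z _ h1 h2 h3 =>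
        (hF.b3 R x y z hR0 h1 h2 h3).trans (le_of_eq (by ring))) (fun x y hx hy => by
        have := checkm_pos y; have := hf0 x hx
        positivity)
    refine hq.trans ?_
    rw [int_cmul]
    have k2 := hM n c hS h0 τ hτ
    have k4 : 0 ≤ ∫ x, fR lam R x * c τ x := nt.nonneg hf0
    rw [← hP]
    set X := ∫ x, checkm x ^ lam * c τ x
    set m := ∫ x, fR lam R x * c τ x
    calc P * (C * m * X) ≤ P * (C * m * M) := by gcongr
      _ ≤ B * m + 0 := by rw [hB]; nlinarith

end


section
variable {K : ℝ → ℝ → ℝ → ℝ} {a lam C : ℝ} {Ψ : ℝ → ℝ} {g0 : ℝ → ℝ} {T : ℝ}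

/-- uniform Lipschitz bound in time -/
lemma E4 (hF : KF K a lam C Ψ) (hg : Dat a lam g0) (hT : 0 < T) :
    ∃ L, 0 < L ∧ ∀ (n : ℕ) (c : ℝ → ℝ → ℝ), Sol K n c → (∀ x, c 0 x ≤ g0 x) →
      ∀ s t, 0 ≤ s → s ≤ t → t ≤ T → 
      Integrable (fun x => hatm x ^ (-a) * |c t x - c s x|) ∧
      ∫ x, hatm x ^ (-a) * |c t x - c s x| ≤ L * (t - s) := by
  have ha := hF.ha; have hl := hF.hl; have hl1 := hF.h1.le
  obtain ⟨M, hM0, hM⟩ := E2 hF hg hT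
  set P := ∫ z, Ψ z with hP
  have hP0 := hF.P0
  have hC := hF.hC
  refine ⟨4*P*C*M*M + 1, by positivity, fun n c hS h0 s t hs hst htT => ?_⟩
  have nt := hS.nice (hs.trans hst)
  have ns := hS.nice hs
  set q : ℝ → ℝ := fun x => (if c s x ≤ c t x then 1 else -1) * hatm x ^ (-a) with hq
  have hqm : Measurable q :=
    (Measurable.ite (measurableSet_le ns.m nt.m) measurable_const measurable_const).mul
      (hatm_meas.pow_const _)
  have hm0 : ∀ x, 0 < x → 0 < hatm x ^ (-a) := fun x hx => (Real.rpow_pos_of_pos (hatm_pos hx) _)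
  have hqa : ∀ x, |q x| = |hatm x ^ (-a)| := by
    intro x; rw [hq]; simp only [abs_mul]
    split_ifs <;> simp
  have hqD : Dom a lam q := (Dom.hat hl).mono hqm (fun x _ => (hqa x).le)
  have hqa' : ∀ x, 0 < x → |q x| = hatm x ^ (-a) := fun x hx => by rw [hqa, abs_of_pos (hm0 x hx)]
  have e1 : (fun x => hatm x ^ (-a) * |c t x - c s x|) = fun x => q x * c t x - q x * c s x := by
    ext x; rw [hq]; simp only
    split_ifs with h
    · rw [abs_of_nonneg (by linarith)]; ring
    · rw [abs_of_neg (by linarith)]; ring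
  have it := hqD.int ha hl nt
  have is := hqD.int ha hl ns
  refine ⟨by rw [e1]; exact it.sub is, ?_⟩
  rw [e1, integral_sub it is]
  obtain ⟨w1, w2⟩ := weakL hF hS hs hst q hqD
  rw [w2]
  have hb : ∀ τ ∈ Icc s t, Qf K n (c τ) q ≤ 4*P*C*M*M := by
    intro τ hτ
    have hτ' : τ ∈ Icc 0 T := ⟨hs.trans hτ.1, hτ.2.trans htT⟩
    have nτ := hS.nice hτ'.1
    have h1 := QD_le1 hF nτ q (fun x => (4*C) * checkm x ^ lam) (Wt a lam)
      ((Dom.check ha).cmul _) Dom.Wt hqD (fun x y z _ h1 h2 h3 => by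
        have hx : 0 < x := by linarith
        have hxz : 0 < x - z := by linarith
        have q1 := hatm_rpow_anti ha hxz (show x - z ≤ x + z by linarith)
        have q2 := hatm_rpow_anti ha hxz (show x - z ≤ x by linarith)
        have q3 := hF.bs x y z h1 h2 h3
        have q4 := hF.ker.nonneg x y z
        have r1 := (le_abs_self _).trans (hqa' (x+z) (by linarith)).le
        have r2 := (le_abs_self _).trans (hqa' (x-z) hxz).le
        have r3 := (neg_abs_le (q x))
        rw [hqa' x hx] at r3
        calc _ ≤ K x y z * (4 * hatm (x-z) ^ (-a)) := by
              apply mul_le_mul_of_nonneg_left _ q4; linarith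
          _ ≤ _ := by linarith) (fun x y _ hy => by
        have := checkm_pos x; have := Wt_pos a lam hy
        positivity)
    refine h1.trans ?_
    rw [int_cmul]
    have k2 := hM n c hS h0 τ hτ'
    have k3 : 0 ≤ ∫ x, Wt a lam x * c τ x := nτ.nonneg fun x hx => (Wt_pos a lam hx).le
    have k5 : ∫ x, checkm x ^ lam * c τ x ≤ ∫ x, Wt a lam x * c τ x :=
      nτ.mono ha hl (Dom.check ha) Dom.Wt (fun x hx => Wt_ge_check ha hx)
    rw [← hP]
    set X := ∫ x, checkm x ^ lam * c τ x
    set Y := ∫ x, Wt a lam x * c τ x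
    calc P * (4 * C * X * Y) ≤ P * (4 * C * M * M) := by gcongr; exact k5.trans k2
      _ = _ := by ring
  have h2 := intervalIntegral.integral_mono_on hst w1 (intervalIntegrable_const (c := 4*P*C*M*M)) hb
  rw [intervalIntegral.integral_const, smul_eq_mul] at h2
  nlinarith

/-- the truncated quadratic function, its derivative, and the Legendre remainder -/
def sg (k r : ℝ) : ℝ := r^2/(k+r)
def bt (k r : ℝ) : ℝ := 1 - k^2/(k+r)^2
def hh (k r : ℝ) : ℝ := k*r^2/(k+r)^2
def th (x : ℝ) : ℝ := 1/(1+x)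

lemma sg_meas (k : ℝ) : Measurable (sg k) := by unfold sg; fun_prop
lemma bt_meas (k : ℝ) : Measurable (bt k) := by unfold bt; fun_prop
lemma hh_meas (k : ℝ) : Measurable (hh k) := by unfold hh; fun_prop
lemma th_meas : Measurable th := by unfold th; fun_prop
lemma th_pos {x : ℝ} (hx : 0 < x) : 0 < th x := by unfold th; positivity
lemma th_le {x : ℝ} (hx : 0 < x) : th x ≤ 1 := by
  unfold th; rw [div_le_one (by linarith)]; linarith

section
variable {k r : ℝ} (hk : 0 < k) (hr : 0 ≤ r)
include hk hr
lemma sg_nonneg : 0 ≤ sg k r := by unfold sg; positivity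
lemma hh_nonneg : 0 ≤ hh k r := by unfold hh; positivity
lemma sg_le : sg k r ≤ r := by
  unfold sg; rw [div_le_iff₀ (by positivity)]; nlinarith
lemma hh_le_sg : hh k r ≤ sg k r := by
  unfold sg hh; rw [div_le_div_iff₀ (by positivity) (by positivity)]
  nlinarith [mul_nonneg (mul_nonneg (sq_nonneg r) hr) (show 0 ≤ k + r by positivity)]
lemma hh_le_k : hh k r ≤ k := by
  unfold hh; rw [div_le_iff₀ (by positivity)]
  have : r^2 ≤ (k+r)^2 := by gcongr; linarith
  gcongr
lemma bt_abs : |bt k r| ≤ 1 := by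
  unfold bt
  have h1 : k^2/(k+r)^2 ≤ 1 := by
    rw [div_le_one (by positivity)]; gcongr; linarith
  have h2 : 0 ≤ k^2/(k+r)^2 := by positivity
  rw [abs_le]; constructor <;> linarith
lemma sg_deriv : HasDerivAt (sg k) (bt k r) r := by
  have h0 : k + r ≠ 0 := by positivity
  have := ((hasDerivAt_id r).pow 2).div ((hasDerivAt_id r).const_add k) h0
  refine this.congr_deriv ?_
  unfold bt
  simp only [id, Pi.pow_apply]
  field_simp
  push_cast
  ring
lemma mul_bt_eq : r * bt k r = sg k r + hh k r := by
  unfold bt sg hh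
  have h0 : k + r ≠ 0 := by positivity
  field_simp
  ring
lemma mul_bt_le {b : ℝ} (hb : 0 ≤ b) : r * bt k b ≤ sg k r + hh k b := by
  have e : sg k r + hh k b - r * bt k b = k^2 * (r-b)^2 / ((k+r)*(k+b)^2) := by
    unfold bt sg hh
    have h0 : k + r ≠ 0 := by positivity
    have h1 : k + b ≠ 0 := by positivity
    field_simp
    ring
  have : 0 ≤ k^2 * (r-b)^2 / ((k+r)*(k+b)^2) := by positivity
  linarith
lemma le_sg : r ≤ k + 2 * sg k r := by
  have e : k + 2 * sg k r - r = (k^2 + r^2) / (k+r) := by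
    unfold sg; field_simp; ring
  have : 0 ≤ (k^2 + r^2) / (k+r) := by positivity
  linarith
lemma sg_mono {b : ℝ} (hb : r ≤ b) : sg k r ≤ sg k b := by
  unfold sg
  rw [div_le_div_iff₀ (by positivity) (by linarith)]
  nlinarith [mul_nonneg hr (hr.trans hb), mul_nonneg (mul_nonneg hr (hr.trans hb)) (sub_nonneg.2 hb),
    mul_nonneg hk.le (mul_nonneg (sub_nonneg.2 hb) (add_nonneg hr (hr.trans hb)))]
end

/-- kernel times the second difference of `th` -/
lemma K_th (hF : KF K a lam C Ψ) {x y z : ℝ} (h1 : 0 < z) (h2 : z < x) (h3 : z < y) :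
    K x y z * (th (x+z) + th (x-z) - 2 * th x) ≤ 2 * (Ψ z * Wt a lam y) * th x := by
  have hb := hF.bq x y z h1 h2.le (by linarith)
  have hW := Wt_pos a lam (show 0 < y by linarith)
  have hP := hF.Pnn z
  set W := Ψ z * Wt a lam y with hWd
  have hW0 : 0 ≤ W := by positivity
  have p1 : 0 < 1 + (x + z) := by linarith
  have p2 : 0 < 1 + (x - z) := by linarith
  have p3 : 0 < 1 + x := by linarith
  have e : K x y z * (th (x+z) + th (x-z) - 2 * th x) =
      (z^2 * K x y z) * (2 / ((1+x) * ((1 + (x + z)) * (1 + (x-z))))) := by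
    unfold th; field_simp; ring
  rw [e]
  calc _ ≤ (W * (x-z)^2) * (2 / ((1+x) * ((1 + (x + z)) * (1 + (x-z))))) := by gcongr
    _ = 2 * W * th x * ((x-z)^2 / ((1 + (x + z)) * (1 + (x-z)))) := by
      unfold th; field_simp
    _ ≤ 2 * W * th x * 1 := by
      have := th_pos (show 0 < x by linarith)
      have : (x-z)^2 / ((1 + (x + z)) * (1 + (x-z))) ≤ 1 := by
        rw [div_le_one (by positivity)]
        nlinarith
      gcongr
    _ = _ := by ring

/-- second difference of the truncated kernel -/
lemma Kn_lap (hF : KF K a lam C Ψ) {n : ℕ} {x y z : ℝ} (hx : 0 < x) (hy : 0 < y) :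
    Ktrunc K n (x+z) y z + Ktrunc K n (x-z) y z - 2 * Ktrunc K n x y z ≤
      Ψ z * Wt a lam y * (2 + (Ici ((n:ℝ)/2)).indicator (fun x => checkm x ^ lam) x) := by
  have hker := hF.ker
  have h0 := inv_pos_n n
  have hW := Wt_pos a lam hy
  have hP := hF.Pnn z
  have hi : 0 ≤ (Ici ((n:ℝ)/2)).indicator (fun x => checkm x ^ lam) x :=
    indicator_nonneg (fun x _ => (Real.rpow_pos_of_pos (checkm_pos x) _).le) x
  set I := (Ici ((n:ℝ)/2)).indicator (fun x => checkm x ^ lam) x with hI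
  set W := Ψ z * Wt a lam y with hWd
  have hW0 : 0 ≤ W := by positivity
  have hWI : 0 ≤ W * I := by positivity
  have k0 := Ktrunc_nonneg hker n x y z
  have leK : ∀ w, Ktrunc K n w y z ≤ K w y z := by
    intro w; unfold Ktrunc; split_ifs
    · exact le_rfl
    · exact hker.nonneg _ _ _
  by_cases hp : Ktrunc K n (x+z) y z = 0
  · by_cases hm : Ktrunc K n (x-z) y z = 0
    · rw [hp, hm]; nlinarith
    · have hke := Ktrunc_eq hm
      obtain ⟨⟨s1, s2⟩, ⟨s3, s4⟩, ⟨s5, s6⟩, ⟨s7, s8⟩, ⟨s9, s10⟩, s11, s12⟩ := Ktrunc_supp hm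
      by_cases hxn : x + z < n
      · have e : Ktrunc K n x y z = K x y z := by
          unfold Ktrunc
          exact if_pos ⟨⟨by linarith, by linarith⟩, ⟨s3, s4⟩, ⟨s5, s6⟩, ⟨by linarith, by linarith⟩, ⟨s9, s10⟩, by linarith, s12⟩
        have := hF.bd x y z (by linarith) (by linarith) hy
        have := leK (x+z); have := leK (x-z)
        nlinarith
      · have hI' : I = checkm x ^ lam := indicator_of_mem (mem_Ici.2 (by linarith)) _
        have hb := hF.b0 (x-z) y z (by linarith) (by linarith) (by linarith)
        have c1 : checkm (x-z) ^ lam ≤ checkm x ^ lam :=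
          Real.rpow_le_rpow (checkm_pos _).le (max_le_max le_rfl (by linarith)) hF.hl
        have c2 := Wt_ge_check (lam := lam) hF.ha hy
        have c3 := Real.rpow_pos_of_pos (checkm_pos y) lam
        have c4 := Real.rpow_pos_of_pos (checkm_pos x) lam
        have c5 : checkm (x-z) ^ lam * checkm y ^ lam * Ψ z ≤ checkm x ^ lam * Wt a lam y * Ψ z := by gcongr
        rw [hp, hke, hI', hWd]
        rw [hI', hWd] at hWI
        rw [hWd] at hW0
        nlinarith
  · obtain ⟨⟨s1, s2⟩, ⟨s3, s4⟩, ⟨s5, s6⟩, ⟨s7, s8⟩, ⟨s9, s10⟩, s11, s12⟩ := Ktrunc_supp hp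
    by_cases hxn : 1/(n:ℝ) < x - z
    · have e : Ktrunc K n x y z = K x y z := by
        unfold Ktrunc
        exact if_pos ⟨⟨by linarith, by linarith⟩, ⟨s3, s4⟩, ⟨s5, s6⟩, ⟨by linarith, by linarith⟩, ⟨s9, s10⟩, by linarith, s12⟩
      have := hF.bd x y z (by linarith) (by linarith) hy
      have := leK (x+z); have := leK (x-z)
      nlinarith
    · have hm : Ktrunc K n (x-z) y z = 0 := by
        by_contra hm
        exact hxn (Ktrunc_supp hm).1.1
      have := hF.bl x y z hx (by linarith) hy
      have := leK (x+z)
      nlinarith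

lemma int_2add {α : Type*} [MeasurableSpace α] {μ : Measure α} {f g : α → ℝ} (hf : Integrable f μ)
    (hg : Integrable g μ) : ∫ x, (2 * f x + g x) ∂μ = 2 * (∫ x, f x ∂μ) + ∫ x, g x ∂μ := by
  rw [← integral_const_mul]
  exact integral_add (hf.const_mul 2) hg

lemma int_comb3 {α : Type*} [MeasurableSpace α] {μ : Measure α} {f g h : α → ℝ} (hf : Integrable f μ)
    (hg : Integrable g μ) (hh : Integrable h μ) : Integrable (fun x => f x + g x - 2 * h x) μ ∧
    ∫ x, (f x + g x - 2 * h x) ∂μ = (∫ x, f x ∂μ) + (∫ x, g x ∂μ) - 2 * ∫ x, h x ∂μ := by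
  refine ⟨(hf.add hg).sub (hh.const_mul 2), ?_⟩
  have h1 := integral_sub (hf.add hg) (hh.const_mul 2)
  have h2 := integral_add hf hg
  rw [integral_const_mul] at h1
  rw [← h2]; exact h1

/-- differential inequality for the superlinear functional -/
lemma Q5 (hF : KF K a lam C Ψ) {n : ℕ} {u : ℝ → ℝ} (hc : Nice n u) {k : ℝ} (hk : 0 < k) :
    Qf K n u (fun x => th x * bt k (u x)) ≤ (∫ z, Ψ z) * (∫ x, Wt a lam x * u x) *
      (4 * (∫ x, th x * sg k (u x)) + ∫ x, (Ici ((n:ℝ)/2)).indicator (fun x => checkm x ^ lam) x * u x) := by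
  have ha := hF.ha; have hl := hF.hl
  have hpos : ∀ x ∈ Ioo (1/(n:ℝ)) n, 0 < x := fun x hx => (inv_pos_n n).trans_lt hx.1
  have hs0 : sg k 0 = 0 := by simp [sg]
  have hh0 : hh k 0 = 0 := by simp [hh]
  have hthD : Dom a lam th := Dom.ofle th_meas (fun x hx => (th_pos hx).le)
    (fun x hx => (th_le hx).trans (Wt_ge_one ha hl hx))
  set I := (Ici ((n:ℝ)/2)).indicator (fun x => checkm x ^ lam) with hI
  have hID : Dom a lam I := (Dom.check ha).ind measurableSet_Ici
  have hI0 : ∀ x, 0 ≤ I x := fun x =>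
    indicator_nonneg (fun x _ => (Real.rpow_pos_of_pos (checkm_pos x) _).le) x
  set G : ℝ → ℝ := fun x => th x * hh k (u x) with hG
  set S : ℝ → ℝ := fun x => th x * sg k (u x) with hSd
  have hGz : ∀ x, x ∉ Ioo (1/(n:ℝ)) n → G x = 0 := fun x hx => by
    rw [hG]; simp only; rw [hc.z x hx, hh0, mul_zero]
  have hSz : ∀ x, x ∉ Ioo (1/(n:ℝ)) n → S x = 0 := fun x hx => by
    rw [hSd]; simp only; rw [hc.z x hx, hs0, mul_zero]
  have hGm : Measurable G := th_meas.mul ((hh_meas k).comp hc.m)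
  have hSm : Measurable S := th_meas.mul ((sg_meas k).comp hc.m)
  have hG0 : ∀ x, 0 ≤ G x := fun x => by
    by_cases hx : x ∈ Ioo (1/(n:ℝ)) n
    · exact mul_nonneg (th_pos (hpos x hx)).le (hh_nonneg hk (hc.nn x))
    · rw [hGz x hx]
  have hS0 : ∀ x, 0 ≤ S x := fun x => by
    by_cases hx : x ∈ Ioo (1/(n:ℝ)) n
    · exact mul_nonneg (th_pos (hpos x hx)).le (sg_nonneg hk (hc.nn x))
    · rw [hSz x hx]
  have hGS : ∀ x, G x ≤ S x := fun x => by
    by_cases hx : x ∈ Ioo (1/(n:ℝ)) n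
    · exact mul_le_mul_of_nonneg_left (hh_le_sg hk (hc.nn x)) (th_pos (hpos x hx)).le
    · rw [hGz x hx, hSz x hx]
  have hSu : ∀ x, S x ≤ u x := fun x => by
    by_cases hx : x ∈ Ioo (1/(n:ℝ)) n
    · calc S x ≤ 1 * u x := mul_le_mul (th_le (hpos x hx)) (sg_le hk (hc.nn x)) (sg_nonneg hk (hc.nn x)) zero_le_one
        _ = _ := one_mul _
    · rw [hc.z x hx, hSz x hx]
  have hGk : ∀ x, |G x| ≤ k := fun x => by
    rw [abs_of_nonneg (hG0 x)]
    by_cases hx : x ∈ Ioo (1/(n:ℝ)) n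
    · calc G x ≤ 1 * k := mul_le_mul (th_le (hpos x hx)) (hh_le_k hk (hc.nn x)) (hh_nonneg hk (hc.nn x)) zero_le_one
        _ = _ := one_mul _
    · rw [hGz x hx]; exact hk.le
  have iS : Integrable S := Integrable.mono' hc.i hSm.aestronglyMeasurable
    (Filter.Eventually.of_forall fun x => by rw [Real.norm_eq_abs, abs_of_nonneg (hS0 x)]; exact hSu x)
  have iG : Integrable G := Integrable.mono' hc.i hGm.aestronglyMeasurable
    (Filter.Eventually.of_forall fun x => by
      rw [Real.norm_eq_abs, abs_of_nonneg (hG0 x)]; exact (hGS x).trans (hSu x))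
  have iIu := hID.int ha hl hc
  have iIG : Integrable (fun x => I x * G x) := Integrable.mono' iIu (hID.1.mul hGm).aestronglyMeasurable
    (Filter.Eventually.of_forall fun x => by
      rw [Real.norm_eq_abs, abs_of_nonneg (mul_nonneg (hI0 x) (hG0 x))]
      exact mul_le_mul_of_nonneg_left ((hGS x).trans (hSu x)) (hI0 x))
  have iW := (Dom.Wt (a := a) (lam := lam)).int ha hl hc
  -- the weighted kernel
  set H : ℝ × ℝ × ℝ → ℝ := fun p => Ktrunc K n p.1 p.2.2 p.2.1 * u p.2.2 with hH
  have hHm : Measurable H := by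
    have e : H = fun p : ℝ × ℝ × ℝ => (fun p : ℝ × ℝ × ℝ => Ktrunc K n p.1 p.2.1 p.2.2) (p.1, p.2.2, p.2.1) * u p.2.2 := rfl
    rw [e]
    exact ((Ktrunc_meas hF.ker n).comp (by fun_prop)).mul (hc.m.comp (by fun_prop))
  have iH : Integrable H := by
    have h3 := (prod3_int (f := (Ioo (1/(n:ℝ)) n).indicator (fun _ => (1:ℝ)))
      ((integrable_indicator_iff measurableSet_Ioo).2 (integrableOn_const (by simp))) hF.Pint hc.i).1
    refine Integrable.mono' (h3.const_mul (checkm n ^ lam * checkm n ^ lam)) hHm.aestronglyMeasurable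
      (Filter.Eventually.of_forall fun p => ?_)
    have k0 := Ktrunc_nonneg hF.ker n p.1 p.2.2 p.2.1
    rw [Real.norm_eq_abs, abs_of_nonneg (mul_nonneg k0 (hc.nn _))]
    by_cases hkz : Ktrunc K n p.1 p.2.2 p.2.1 = 0
    · simp only [hkz, zero_mul]
      have : 0 ≤ (Ioo (1/(n:ℝ)) (n:ℝ)).indicator (fun _ => (1:ℝ)) p.1 := indicator_nonneg (fun _ _ => zero_le_one) _
      have := hF.Pnn p.2.1; have := hc.nn p.2.2; have := checkm_pos n
      positivity
    · have hm : p.1 ∈ Ioo (1/(n:ℝ)) (n:ℝ) := (Ktrunc_supp hkz).1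
      rw [indicator_of_mem hm]
      have := mul_le_mul_of_nonneg_right (Ktrunc_le hF n p.1 p.2.2 p.2.1) (hc.nn p.2.2)
      calc _ ≤ _ := this
        _ = _ := by ring
  obtain ⟨i1, j1, e1⟩ := shr_q 1 iH hGm hGk
  obtain ⟨i2, j2, e2⟩ := shr_q (-1) iH hGm hGk
  have i0 : Integrable (fun p : ℝ × ℝ × ℝ => G p.1 * H p) :=
    iH.bdd_mul (c := k) (hGm.comp measurable_fst).aestronglyMeasurable
      (Filter.Eventually.of_forall fun p => hGk p.1)
  obtain ⟨pS, vS⟩ := prod3_int iS hF.Pint iW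
  obtain ⟨pG, vG⟩ := prod3_int iG hF.Pint iW
  obtain ⟨pI, vI⟩ := prod3_int iIG hF.Pint iW
  set q : ℝ → ℝ := fun x => th x * bt k (u x) with hq
  have hqm : Measurable q := th_meas.mul ((bt_meas k).comp hc.m)
  have hqb : ∀ x ∈ Ioo (1/(n:ℝ)) n, |q x| ≤ 1 := fun x hx => by
    rw [hq]; simp only; rw [abs_mul, abs_of_pos (th_pos (hpos x hx))]
    exact mul_le_one₀ (th_le (hpos x hx)) (abs_nonneg _) (bt_abs hk (hc.nn x))
  have iF : Integrable (fun p : ℝ × ℝ × ℝ => Jd K n u p * (q (p.1 + p.2.1) + q (p.1 - p.2.1) - 2 * q p.1)) := by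
    refine Integrable.mono' ((Jd_int hF hc).1.const_mul 4)
      ((Jd_meas hF.ker n hc.m).mul (by fun_prop)).aestronglyMeasurable
      (Filter.Eventually.of_forall fun p => ?_)
    rw [norm_mul, Real.norm_eq_abs, Real.norm_eq_abs, abs_of_nonneg (Jd_nonneg hF.ker hc p), mul_comm 4]
    by_cases hkz : Ktrunc K n p.1 p.2.2 p.2.1 = 0
    · simp [Jd, hkz]
    · obtain ⟨⟨s1, s2⟩, ⟨s3, s4⟩, ⟨s5, s6⟩, ⟨s7, s8⟩, ⟨s9, s10⟩, s11, s12⟩ := Ktrunc_supp hkz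
      have h0 := inv_pos_n n
      have b1 := abs_le.1 (hqb (p.1 + p.2.1) ⟨by linarith, by linarith⟩)
      have b2 := abs_le.1 (hqb (p.1 - p.2.1) ⟨by linarith, by linarith⟩)
      have b3 := abs_le.1 (hqb p.1 ⟨s1, s2⟩)
      refine mul_le_mul_of_nonneg_left ?_ (Jd_nonneg hF.ker hc p)
      rw [abs_le]; constructor <;> linarith
  have hle : ∀ p : ℝ × ℝ × ℝ, Jd K n u p * (q (p.1 + p.2.1) + q (p.1 - p.2.1) - 2 * q p.1) ≤
      2 * (S p.1 * (Ψ p.2.1 * (Wt a lam p.2.2 * u p.2.2))) +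
      (G (p.1 + 1 * p.2.1) * H p + G (p.1 + (-1) * p.2.1) * H p - 2 * (G p.1 * H p)) := by
    intro p
    have y0 := hc.nn p.2.2
    by_cases hkz : Ktrunc K n p.1 p.2.2 p.2.1 = 0
    · have hH0 : H p = 0 := by rw [hH]; simp only [hkz, zero_mul]
      rw [hH0]
      by_cases hy : p.2.2 ∈ Ioo (1/(n:ℝ)) n
      · have := Wt_pos a lam (hpos _ hy)
        have := hS0 p.1; have := hF.Pnn p.2.1
        simp only [Jd, hkz, zero_mul, mul_zero, add_zero, sub_zero]
        positivity
      · simp [Jd, hkz, hc.z _ hy]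
    · obtain ⟨⟨s1, s2⟩, ⟨s3, s4⟩, ⟨s5, s6⟩, ⟨s7, s8⟩, ⟨s9, s10⟩, s11, s12⟩ := Ktrunc_supp hkz
      have h0 := inv_pos_n n
      have hKe := Ktrunc_eq hkz
      set x := p.1
      set z := p.2.1
      set y := p.2.2
      have hx := hc.nn x
      have hH0 : 0 ≤ H p := mul_nonneg (Ktrunc_nonneg hF.ker n x y z) y0
      have c1 : u x * q (x+z) ≤ th (x+z) * sg k (u x) + G (x+z) := by
        have := mul_le_mul_of_nonneg_left (mul_bt_le hk hx (hc.nn (x+z))) (th_pos (show 0 < x + z by linarith)).le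
        rw [hq, hG]; simp only; linarith
      have c2 : u x * q (x-z) ≤ th (x-z) * sg k (u x) + G (x-z) := by
        have := mul_le_mul_of_nonneg_left (mul_bt_le hk hx (hc.nn (x-z))) (th_pos (show 0 < x - z by linarith)).le
        rw [hq, hG]; simp only; linarith
      have c3 : u x * q x = th x * sg k (u x) + G x := by
        have := mul_bt_eq hk hx
        rw [hq, hG]; simp only; linear_combination th x * this
      have c4 : H p * sg k (u x) * (th (x+z) + th (x-z) - 2 * th x) ≤
          2 * (S x * (Ψ z * (Wt a lam y * u y))) := by
        have := mul_le_mul_of_nonneg_right (K_th hF (show 0 < z by linarith) (show z < x by linarith)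
          (show z < y by linarith)) (mul_nonneg (sg_nonneg hk hx) y0)
        have eH : H p = K x y z * u y := by rw [← hKe]
        rw [eH, hSd]; simp only; linarith
      have eJ : Jd K n u p = H p * u x := by
        show Ktrunc K n x y z * (u x * u y) = Ktrunc K n x y z * u y * u x
        ring
      rw [eJ, one_mul, neg_one_mul, ← sub_eq_add_neg]
      have c5 : H p * (u x * (q (x + z) + q (x - z) - 2 * q x)) ≤
          H p * (sg k (u x) * (th (x+z) + th (x-z) - 2 * th x) + (G (x+z) + G (x-z) - 2 * G x)) := by
        refine mul_le_mul_of_nonneg_left ?_ hH0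
        linarith
      linarith
  have hle2 : ∀ p : ℝ × ℝ × ℝ, G p.1 * H (shr (-1) p) + G p.1 * H (shr (- -1) p) - 2 * (G p.1 * H p) ≤
      2 * (G p.1 * (Ψ p.2.1 * (Wt a lam p.2.2 * u p.2.2))) +
       (I p.1 * G p.1) * (Ψ p.2.1 * (Wt a lam p.2.2 * u p.2.2)) := by
    intro p
    have y0 := hc.nn p.2.2
    by_cases hx : p.1 ∈ Ioo (1/(n:ℝ)) n
    · by_cases hy : p.2.2 ∈ Ioo (1/(n:ℝ)) n
      · have := mul_le_mul_of_nonneg_right (Kn_lap hF (n := n) (z := p.2.1) (hpos _ hx) (hpos _ hy))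
          (mul_nonneg y0 (hG0 p.1))
        have r1 : H (shr (-1) p) = Ktrunc K n (p.1 - p.2.1) p.2.2 p.2.1 * u p.2.2 := by
          show Ktrunc K n (p.1 + (-1) * p.2.1) p.2.2 p.2.1 * u p.2.2 = _
          rw [neg_one_mul, ← sub_eq_add_neg]
        have r2 : H (shr (- -1) p) = Ktrunc K n (p.1 + p.2.1) p.2.2 p.2.1 * u p.2.2 := by
          show Ktrunc K n (p.1 + (- -1) * p.2.1) p.2.2 p.2.1 * u p.2.2 = _
          rw [neg_neg, one_mul]
        have r3 : H p = Ktrunc K n p.1 p.2.2 p.2.1 * u p.2.2 := rfl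
        rw [r1, r2, r3]
        rw [← hI] at this
        linarith
      · have r1 : ∀ s, H (shr s p) = 0 := fun s => by
          show _ * u p.2.2 = 0
          rw [hc.z _ hy, mul_zero]
        have r3 : H p = 0 := by
          show _ * u p.2.2 = 0
          rw [hc.z _ hy, mul_zero]
        rw [r1, r1, r3, hc.z _ hy]; simp
    · rw [hGz _ hx]; simp
  have m1 := integral_mono iF ((pS.const_mul 2).add ((j1.add j2).sub (i0.const_mul 2))) hle
  have m2 := integral_mono ((i1.add i2).sub (i0.const_mul 2)) ((pG.const_mul 2).add pI) hle2
  have v1 : ∫ p : ℝ×ℝ×ℝ, (2 * (S p.1 * (Ψ p.2.1 * (Wt a lam p.2.2 * u p.2.2))) +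
      (G (p.1 + 1 * p.2.1) * H p + G (p.1 + (-1) * p.2.1) * H p - 2 * (G p.1 * H p))) =
      2 * ((∫ x, S x) * ((∫ z, Ψ z) * ∫ x, Wt a lam x * u x)) +
      ((∫ p : ℝ×ℝ×ℝ, G (p.1 + 1 * p.2.1) * H p) + (∫ p : ℝ×ℝ×ℝ, G (p.1 + (-1) * p.2.1) * H p) - 2 * ∫ p, G p.1 * H p) := by
    rw [← (int_comb3 j1 j2 i0).2, ← vS]
    exact int_2add pS (int_comb3 j1 j2 i0).1
  have v2 : ∫ p : ℝ×ℝ×ℝ, (G p.1 * H (shr (-1) p) + G p.1 * H (shr (- -1) p) - 2 * (G p.1 * H p)) =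
      (∫ p : ℝ×ℝ×ℝ, G p.1 * H (shr (-1) p)) + (∫ p : ℝ×ℝ×ℝ, G p.1 * H (shr (- -1) p)) - 2 * ∫ p, G p.1 * H p := by
    exact (int_comb3 i1 i2 i0).2
  have v3 : ∫ p : ℝ×ℝ×ℝ, (2 * (G p.1 * (Ψ p.2.1 * (Wt a lam p.2.2 * u p.2.2))) +
       (I p.1 * G p.1) * (Ψ p.2.1 * (Wt a lam p.2.2 * u p.2.2))) =
      2 * ((∫ x, G x) * ((∫ z, Ψ z) * ∫ x, Wt a lam x * u x)) +
      ((∫ x, I x * G x) * ((∫ z, Ψ z) * ∫ x, Wt a lam x * u x)) := by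
    rw [← vG, ← vI]
    exact int_2add pG pI
  have m1' := m1.trans v1.le
  have m2' := (v2.symm.le.trans m2).trans v3.le
  rw [e1, e2] at m2'
  have g1 : ∫ x, G x ≤ ∫ x, S x := integral_mono iG iS hGS
  have g2 : ∫ x, I x * G x ≤ ∫ x, I x * u x := integral_mono iIG iIu fun x =>
    mul_le_mul_of_nonneg_left ((hGS x).trans (hSu x)) (hI0 x)
  have hP0 := hF.P0
  have hW0 : 0 ≤ ∫ x, Wt a lam x * u x := hc.nonneg fun x hx => (Wt_pos a lam hx).le
  have hPW := mul_nonneg hP0 hW0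
  have g1' := mul_le_mul_of_nonneg_right g1 hPW
  have g2' := mul_le_mul_of_nonneg_right g2 hPW
  show ∫ p : ℝ×ℝ×ℝ, Jd K n u p * (q (p.1 + p.2.1) + q (p.1 - p.2.1) - 2 * q p.1) ≤ _
  linarith
end


section
variable {K : ℝ → ℝ → ℝ → ℝ} {a lam C : ℝ} {Ψ : ℝ → ℝ} {g0 : ℝ → ℝ} {T : ℝ}

lemma Dom.th (ha : 0 ≤ a) (hl : 0 ≤ lam) : Dom a lam th := Dom.ofle th_meas (fun x hx => (th_pos hx).le)
    (fun x hx => (th_le hx).trans (Wt_ge_one ha hl hx))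

lemma thsg_le {k x r s : ℝ} (hk : 0 < k) (hx : 0 < x) (hr : 0 ≤ r) (hs : r ≤ s) :
    0 ≤ th x * sg k r ∧ th x * sg k r ≤ sg k s ∧ th x * sg k r ≤ r := by
  have h1 := th_pos hx
  have h2 := th_le hx
  have h3 := sg_nonneg hk hr
  have h4 := sg_le hk hr
  have h5 := sg_mono hk hr hs
  refine ⟨by positivity, ?_, ?_⟩ <;> nlinarith

lemma thsg_int {n : ℕ} {u : ℝ → ℝ} (hc : Nice n u) {k : ℝ} (hk : 0 < k) :
    Integrable (fun x => th x * sg k (u x)) := by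
  refine Integrable.mono' hc.i (th_meas.mul ((sg_meas k).comp hc.m)).aestronglyMeasurable
    (Filter.Eventually.of_forall fun x => ?_)
  by_cases hx : x ∈ Ioo (1/(n:ℝ)) n
  · have := thsg_le hk ((inv_pos_n n).trans_lt hx.1) (hc.nn x) le_rfl
    rw [Real.norm_eq_abs, abs_of_nonneg this.1]; exact this.2.2
  · simp [hc.z x hx, sg]

lemma sg_lim (hg : Dat a lam g0) (ha : 0 ≤ a) (hl : 0 ≤ lam) :
    Tendsto (fun j : ℕ => ∫ x, sg (j+1:ℝ) (g0 x)) atTop (𝓝 0) := by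
  rw [← integral_zero ℝ ℝ (μ := volume)]
  have hi : Integrable g0 := by
    have := hg.wi (U := fun _ => 1) measurable_const (fun x hx => by
      rw [abs_one]; exact Wt_ge_one ha hl hx)
    simpa using this
  refine tendsto_integral_of_dominated_convergence g0
    (fun R => ((sg_meas _).comp hg.m).aestronglyMeasurable) hi (fun j => Filter.Eventually.of_forall fun x => ?_)
    (Filter.Eventually.of_forall fun x => ?_)
  · have hj : (0:ℝ) < j + 1 := by positivity
    show |sg (j+1:ℝ) (g0 x)| ≤ g0 x
    rw [abs_of_nonneg (sg_nonneg hj (hg.nn x))]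
    exact sg_le hj (hg.nn x)
  · have h1 : Tendsto (fun j : ℕ => (j:ℝ) + 1 + g0 x) atTop atTop :=
      tendsto_atTop_add_const_right _ _ (tendsto_atTop_add_const_right _ _ tendsto_natCast_atTop_atTop)
    exact tendsto_const_nhds.div_atTop h1

lemma ind_anti {R R' : ℝ} (h : R ≤ R') (x : ℝ) :
    (Ici R').indicator (fun x => checkm x ^ lam) x ≤ (Ici R).indicator (fun x => checkm x ^ lam) x :=
  indicator_le_indicator_of_subset (Ici_subset_Ici.2 h)
    (fun x => (Real.rpow_pos_of_pos (checkm_pos x) _).le) x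

lemma E5a (hF : KF K a lam C Ψ) (hg : Dat a lam g0) (hT : 0 < T) :
    ∀ ε > 0, ∃ k : ℝ, 0 < k ∧ ∃ N : ℕ, ∀ n ≥ N, ∀ (c : ℝ → ℝ → ℝ), Sol K n c → (∀ x, c 0 x ≤ g0 x) →
      ∀ t ∈ Icc 0 T, ∫ x, th x * sg k (c t x) ≤ ε := by
  have ha := hF.ha; have hl := hF.hl; have hl1 := hF.h1.le
  obtain ⟨M, hM0, hM⟩ := E2 hF hg hT
  intro ε hε
  set P := ∫ z, Ψ z with hP
  have hP0 := hF.P0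
  set B := 4*P*M + 1 with hB
  set A := 2 * Real.exp (2*B*T) with hAd
  have hA : 0 < A := by positivity
  set ε1 := ε / (2 * A * (P * M * T + 1)) with hε1
  have hε1p : 0 < ε1 := by positivity
  obtain ⟨R, hR1, hR⟩ := E3 hF hg hT ε1 hε1p
  obtain ⟨j, hj⟩ := ((sg_lim hg ha hl).eventually (gt_mem_nhds (show 0 < ε / (2*A) by positivity))).exists
  have hk : (0:ℝ) < j + 1 := by positivity
  set k : ℝ := j + 1 with hkd
  obtain ⟨N, hN⟩ := exists_nat_ge (2*R)
  refine ⟨k, hk, N, fun n hn c hS h0 t ht => ?_⟩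
  have hnR : R ≤ (n:ℝ)/2 := by
    have : (N:ℝ) ≤ n := by exact_mod_cast hn
    linarith
  have n0 := hS.nice le_rfl
  have hG := gronD hF hS hT th (Dom.th ha hl) (fun x hx => (th_pos hx).le) (sg k) (bt k) (sg_meas k) (bt_meas k)
    (fun r hr => bt_abs hk hr) (fun r hr => sg_nonneg hk hr)
    (fun r hr => by rw [abs_of_nonneg (sg_nonneg hk hr)]; exact sg_le hk hr) (fun r hr => sg_deriv hk hr)
    B (P*M*ε1) (by positivity) (by positivity) (fun τ hτ => ?_) t ht
  · have h1 : ∫ x, th x * sg k (c 0 x) ≤ ∫ x, sg k (g0 x) := by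
      have hi : Integrable g0 := by
        have := hg.wi (U := fun _ => 1) measurable_const (fun x hx => by
          rw [abs_one]; exact Wt_ge_one ha hl hx)
        simpa using this
      refine integral_mono (thsg_int n0 hk) (Integrable.mono' hi ((sg_meas k).comp hg.m).aestronglyMeasurable
        (Filter.Eventually.of_forall fun x => ?_)) fun x => ?_
      · show |sg k (g0 x)| ≤ g0 x
        rw [abs_of_nonneg (sg_nonneg hk (hg.nn x))]
        exact sg_le hk (hg.nn x)
      · show th x * sg k (c 0 x) ≤ sg k (g0 x)
        by_cases hx : x ∈ Ioo (1/(n:ℝ)) n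
        · exact (thsg_le hk ((inv_pos_n n).trans_lt hx.1) (n0.nn x) (h0 x)).2.1
        · have e : sg k 0 = 0 := by simp [sg]
          rw [n0.z x hx, e, mul_zero]; exact sg_nonneg hk (hg.nn x)
    refine hG.trans ?_
    have h2 : A * (∫ x, sg k (g0 x)) ≤ ε/2 := by
      rw [lt_div_iff₀ (by positivity)] at hj
      linarith
    have h3 : A * (P*M*ε1*T) ≤ ε/2 := by
      have hne : P*M*T+1 ≠ 0 := by
        have hP0' : 0 ≤ P := hP0
        positivity
      have e : A * ((P*M*T+1) * ε1) = ε/2 := by rw [hε1]; field_simp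
      nlinarith
    have h4 := mul_le_mul_of_nonneg_left h1 hA.le
    calc 2 * ((∫ x, th x * sg k (c 0 x)) + P*M*ε1*T) * Real.exp (2*B*T)
        = A * (∫ x, th x * sg k (c 0 x)) + A * (P*M*ε1*T) := by rw [hAd]; ring
      _ ≤ ε := by linarith
  · have nt := hS.nice hτ.1
    refine (Q5 hF nt hk).trans ?_
    have k1 := hM n c hS h0 τ hτ
    have k2 := hR n c hS h0 τ hτ
    have k3 : ∫ x, (Ici ((n:ℝ)/2)).indicator (fun x => checkm x ^ lam) x * c τ x ≤ ε1 :=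
      (nt.mono ha hl ((Dom.check ha).ind measurableSet_Ici) ((Dom.check ha).ind measurableSet_Ici)
        (fun x _ => ind_anti hnR x)).trans k2
    have k4 : 0 ≤ ∫ x, th x * sg k (c τ x) := by
      refine integral_nonneg fun x => ?_
      by_cases hx : x ∈ Ioo (1/(n:ℝ)) n
      · exact (thsg_le hk ((inv_pos_n n).trans_lt hx.1) (nt.nn x) le_rfl).1
      · simp [nt.z x hx, sg]
    have k5 : 0 ≤ ∫ x, (Ici ((n:ℝ)/2)).indicator (fun x => checkm x ^ lam) x * c τ x :=
      nt.nonneg fun x _ => indicator_nonneg (fun x _ => (Real.rpow_pos_of_pos (checkm_pos x) _).le) x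
    have k6 : 0 ≤ ∫ x, Wt a lam x * c τ x := nt.nonneg fun x hx => (Wt_pos a lam hx).le
    rw [← hP]
    set X := ∫ x, Wt a lam x * c τ x
    set S := ∫ x, th x * sg k (c τ x)
    set I := ∫ x, (Ici ((n:ℝ)/2)).indicator (fun x => checkm x ^ lam) x * c τ x
    calc P * X * (4 * S + I) ≤ P * M * (4 * S + ε1) := by gcongr
      _ ≤ B * S + P*M*ε1 := by rw [hB]; nlinarith

/-- uniform integrability -/
lemma E5 (hF : KF K a lam C Ψ) (hg : Dat a lam g0) (hT : 0 < T) :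
    ∀ ε > 0, ∃ δ : ℝ, 0 < δ ∧ ∃ N : ℕ, ∀ n ≥ N, ∀ (c : ℝ → ℝ → ℝ), Sol K n c → (∀ x, c 0 x ≤ g0 x) →
      ∀ t ∈ Icc 0 T, ∀ A : Set ℝ, MeasurableSet A → volume A ≤ ENNReal.ofReal δ →
       ∫ x, A.indicator (fun x => checkm x ^ lam) x * c t x ≤ ε := by
  have ha := hF.ha; have hl := hF.hl; have hl1 := hF.h1.le
  intro ε hε
  obtain ⟨R, hR1, hR⟩ := E3 hF hg hT (ε/3) (by positivity)
  have hR0 : 0 < R := by linarith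
  set L := R ^ lam with hL
  have hLp : 0 < L := Real.rpow_pos_of_pos hR0 _
  obtain ⟨k, hk, N, hN⟩ := E5a hF hg hT (ε/(3*(2*L*(1+R)))) (by positivity)
  refine ⟨ε/(3*(L*k)), by positivity, N, fun n hn c hS h0 t ht A hA hvol => ?_⟩
  have nt := hS.nice ht.1
  have k1 := hR n c hS h0 t ht
  have k2 := hN n hn c hS h0 t ht
  have hfin : volume A ≠ ⊤ := (hvol.trans_lt ENNReal.ofReal_lt_top).ne
  have i1 := ((Dom.check (a := a) (lam := lam) ha).ind (measurableSet_Ici (a := R))).int ha hl nt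
  have i2 : Integrable (A.indicator (fun _ => L*k)) :=
    (integrable_indicator_iff hA).2 (integrableOn_const hfin)
  have i3 := (thsg_int nt hk).const_mul (2*L*(1+R))
  have h := integral_mono (((Dom.check (a := a) (lam := lam) ha).ind hA).int ha hl nt) ((i1.add i2).add i3)
    (fun x => by
      show A.indicator (fun x => checkm x ^ lam) x * c t x ≤
        (Ici R).indicator (fun x => checkm x ^ lam) x * c t x + A.indicator (fun _ => L*k) x +
          2*L*(1+R) * (th x * sg k (c t x))
      have z2 : 0 ≤ A.indicator (fun _ => L*k) x := indicator_nonneg (fun _ _ => by positivity) x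
      by_cases hx : x ∈ Ioo (1/(n:ℝ)) n
      · have hx0 := (inv_pos_n n).trans_lt hx.1
        have hc0 := nt.nn x
        have z3 := thsg_le hk hx0 hc0 le_rfl
        have z1 : 0 ≤ (Ici R).indicator (fun x => checkm x ^ lam) x :=
          indicator_nonneg (fun x _ => (Real.rpow_pos_of_pos (checkm_pos x) _).le) x
        have z4 : 0 ≤ 2*L*(1+R) * (th x * sg k (c t x)) := mul_nonneg (by positivity) z3.1
        have z5 := mul_nonneg z1 hc0
        by_cases hxA : x ∈ A
        · by_cases hxR : R ≤ x
          · rw [indicator_of_mem hxA, indicator_of_mem (mem_Ici.2 hxR)]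
            linarith
          · push Not at hxR
            rw [indicator_of_mem hxA, indicator_of_mem hxA]
            have w1 : checkm x ^ lam ≤ L := by
              rw [hL]
              exact Real.rpow_le_rpow (checkm_pos x).le (max_le hR1 hxR.le) hl
            have w2 := le_sg hk hc0
            have w3 : sg k (c t x) ≤ (1+R) * (th x * sg k (c t x)) := by
              have e : sg k (c t x) = (1+x) * (th x * sg k (c t x)) := by
                unfold th; field_simp
              have := mul_le_mul_of_nonneg_right (show 1+x ≤ 1+R by linarith) z3.1
              linarith
            have w4 : checkm x ^ lam * c t x ≤ L * (k + 2 * ((1+R) * (th x * sg k (c t x)))) := by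
              have : 0 < checkm x ^ lam := Real.rpow_pos_of_pos (checkm_pos x) _
              gcongr
              linarith
            linarith
        · rw [indicator_of_notMem hxA]; linarith
      · have e : sg k 0 = 0 := by simp [sg]
        rw [nt.z x hx, e]; linarith)
  have v : ∫ x, ((Ici R).indicator (fun x => checkm x ^ lam) x * c t x + A.indicator (fun _ => L*k) x +
          2*L*(1+R) * (th x * sg k (c t x))) = (∫ x, (Ici R).indicator (fun x => checkm x ^ lam) x * c t x) +
          (∫ x, A.indicator (fun _ => L*k) x) + 2*L*(1+R) * ∫ x, th x * sg k (c t x) := by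
    rw [← integral_const_mul, ← integral_add i1 i2]
    exact integral_add (i1.add i2) i3
  have h' := h.trans v.le
  have m1 : ∫ x, A.indicator (fun _ => L*k) x ≤ ε/3 := by
    rw [integral_indicator_const _ hA, smul_eq_mul]
    have : volume.real A ≤ ε/(3*(L*k)) := ENNReal.toReal_le_of_le_ofReal (by positivity) hvol
    calc volume.real A * (L*k) ≤ ε/(3*(L*k)) * (L*k) := by gcongr
      _ = ε/3 := by field_simp
  have m2 : 2*L*(1+R) * ∫ x, th x * sg k (c t x) ≤ ε/3 := by
    calc _ ≤ 2*L*(1+R) * (ε/(3*(2*L*(1+R)))) := by gcongr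
      _ = ε/3 := by field_simp
  linarith

lemma hat_lim (hg : Dat a lam g0) (hl : 0 ≤ lam) :
    Tendsto (fun j : ℕ => ∫ x, (Iio (1/((j:ℝ)+1))).indicator (fun x => hatm x ^ (-a)) x * g0 x) atTop (𝓝 0) := by
  rw [← integral_zero ℝ ℝ (μ := volume)]
  refine tendsto_integral_of_dominated_convergence (fun x => Wt a lam x * g0 x)
    (fun R => ((((hatm_meas.pow_const _).indicator measurableSet_Iio)).mul hg.m).aestronglyMeasurable) hg.i
    (fun R => Filter.Eventually.of_forall fun x => ?_)
    (Filter.Eventually.of_forall fun x => ?_)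
  · rw [norm_mul, Real.norm_eq_abs, Real.norm_eq_abs, abs_of_nonneg (hg.nn x)]
    rcases le_or_gt x 0 with hx | hx
    · simp [hg.z x hx]
    · refine mul_le_mul_of_nonneg_right ?_ (hg.nn x)
      have h1 := Wt_ge_hat (a := a) hl hx
      have h2 := Wt_pos a lam hx
      have h3 := Real.rpow_pos_of_pos (hatm_pos hx) (-a)
      by_cases h : x ∈ Iio (1/((R:ℝ)+1))
      · rw [indicator_of_mem h, abs_of_pos h3]; exact h1
      · rw [indicator_of_notMem h, abs_zero]; exact h2.le
  · rcases le_or_gt x 0 with hx | hx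
    · simp [hg.z x hx]
    · have h1 := (tendsto_one_div_add_atTop_nhds_zero_nat (𝕜 := ℝ)).eventually (gt_mem_nhds hx)
      refine tendsto_const_nhds.congr' ?_
      filter_upwards [h1] with j hj
      rw [indicator_of_notMem (by simpa using hj.le), zero_mul]

/-- a product bound with a localised first variable -/
lemma Q6 (hF : KF K a lam C Ψ) {n : ℕ} {u : ℝ → ℝ} (hc : Nice n u) {ρ e : ℝ} 
    (he : ∀ z, ∫ x, (Ioo z (z+ρ)).indicator (fun x => checkm x ^ lam) x * u x ≤ e) :
    Qf K n u ((Iio ρ).indicator (fun x => hatm x ^ (-a))) ≤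
      C * (e * ((∫ z, Ψ z) * ∫ x, Wt a lam x * u x)) := by
  have ha := hF.ha; have hl := hF.hl
  have hC := hF.hC
  set f := (Iio ρ).indicator (fun x => hatm x ^ (-a)) with hf
  have hfm : Measurable f := (hatm_meas.pow_const _).indicator measurableSet_Iio
  have hf0 : ∀ x, 0 < x → 0 ≤ f x := fun x hx => by
    rw [hf]; by_cases h : x ∈ Iio ρ
    · rw [indicator_of_mem h]; exact (Real.rpow_pos_of_pos (hatm_pos hx) _).le
    · rw [indicator_of_notMem h]
  have hfD : Dom a lam f := (Dom.hat hl).ind measurableSet_Iio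
  have hfa : ∀ x y, 0 < x → x ≤ y → f y ≤ f x := fun x y hx hxy => by
    by_cases h : y ∈ Iio ρ
    · have hx' : x ∈ Iio ρ := lt_of_le_of_lt hxy h
      rw [hf, indicator_of_mem h, indicator_of_mem hx']
      exact hatm_rpow_anti ha hx hxy
    · have : f y = 0 := indicator_of_notMem h _
      rw [this]; exact hf0 x hx
  obtain ⟨F, hF0, hFb⟩ := hfD.bdd ha hl n
  have iF : Integrable (fun p : ℝ × ℝ × ℝ => Jd K n u p * (f (p.1 + p.2.1) + f (p.1 - p.2.1) - 2 * f p.1)) := by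
    refine Integrable.mono' ((Jd_int hF hc).1.const_mul (4*F))
      ((Jd_meas hF.ker n hc.m).mul (by fun_prop)).aestronglyMeasurable
      (Filter.Eventually.of_forall fun p => ?_)
    rw [norm_mul, Real.norm_eq_abs, Real.norm_eq_abs, abs_of_nonneg (Jd_nonneg hF.ker hc p), mul_comm (4*F)]
    by_cases hkz : Ktrunc K n p.1 p.2.2 p.2.1 = 0
    · simp [Jd, hkz]
    · obtain ⟨⟨s1, s2⟩, ⟨s3, s4⟩, ⟨s5, s6⟩, ⟨s7, s8⟩, ⟨s9, s10⟩, s11, s12⟩ := Ktrunc_supp hkz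
      have h0 := inv_pos_n n
      have b1 := abs_le.1 (hFb (p.1 + p.2.1) ⟨by linarith, by linarith⟩)
      have b2 := abs_le.1 (hFb (p.1 - p.2.1) ⟨by linarith, by linarith⟩)
      have b3 := abs_le.1 (hFb p.1 ⟨s1, s2⟩)
      refine mul_le_mul_of_nonneg_left ?_ (Jd_nonneg hF.ker hc p)
      rw [abs_le]; constructor <;> linarith
  set G : ℝ × ℝ × ℝ → ℝ := fun p => {p : ℝ × ℝ × ℝ | p.2.1 < p.1 ∧ p.1 < p.2.1 + ρ}.indicator
    (fun p => (checkm p.1 ^ lam * u p.1) * (Ψ p.2.1 * (Wt a lam p.2.2 * u p.2.2))) p with hG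
  have hset : MeasurableSet {p : ℝ × ℝ × ℝ | p.2.1 < p.1 ∧ p.1 < p.2.1 + ρ} := by
    have hs1 : MeasurableSet {p : ℝ × ℝ × ℝ | p.2.1 < p.1} := measurableSet_lt (by fun_prop) (by fun_prop)
    have hs2 : MeasurableSet {p : ℝ × ℝ × ℝ | p.1 < p.2.1 + ρ} := measurableSet_lt (by fun_prop) (by fun_prop)
    exact hs1.inter hs2
  have icu := (Dom.check (a := a) (lam := lam) ha).int ha hl hc
  have iW := (Dom.Wt (a := a) (lam := lam)).int ha hl hc
  have iG : Integrable G := (prod3_int icu hF.Pint iW).1.indicator hset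
  have hwn : ∀ y, 0 ≤ Wt a lam y * u y := fun y => by
    by_cases hy : y ∈ Ioo (1/(n:ℝ)) n
    · exact mul_nonneg (Wt_pos a lam ((inv_pos_n n).trans_lt hy.1)).le (hc.nn y)
    · rw [hc.z y hy, mul_zero]
  have hGn : ∀ p, 0 ≤ G p := fun p => by
    refine indicator_nonneg (fun p _ => ?_) p
    have := checkm_pos p.1; have := hc.nn p.1; have := hF.Pnn p.2.1; have := hwn p.2.2
    positivity
  have hle : ∀ p : ℝ × ℝ × ℝ, Jd K n u p * (f (p.1 + p.2.1) + f (p.1 - p.2.1) - 2 * f p.1) ≤ C * G p := by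
    intro p
    have hGp := hGn p
    by_cases hkz : Ktrunc K n p.1 p.2.2 p.2.1 = 0
    · simp only [Jd, hkz, zero_mul]; positivity
    · have hJ := Jd_nonneg hF.ker hc p
      have hKe := Ktrunc_eq hkz
      obtain ⟨⟨s1, s2⟩, ⟨s3, s4⟩, ⟨s5, s6⟩, ⟨s7, s8⟩, ⟨s9, s10⟩, s11, s12⟩ := Ktrunc_supp hkz
      have h0 := inv_pos_n n
      have t1 := hfa p.1 (p.1 + p.2.1) (by linarith) (by linarith)
      have t2 := hf0 p.1 (by linarith)
      by_cases hr : p.1 - p.2.1 < ρ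
      · have eG : G p = (checkm p.1 ^ lam * u p.1) * (Ψ p.2.1 * (Wt a lam p.2.2 * u p.2.2)) :=
          indicator_of_mem (show p ∈ {p : ℝ × ℝ × ℝ | p.2.1 < p.1 ∧ p.1 < p.2.1 + ρ} from ⟨by linarith, by linarith⟩) _
        have ef : f (p.1 - p.2.1) = hatm (p.1 - p.2.1) ^ (-a) := indicator_of_mem (show p.1 - p.2.1 ∈ Iio ρ from hr) _
        have hb := hF.bs p.1 p.2.2 p.2.1 (by linarith) (by linarith) (by linarith)
        have hb' := mul_le_mul_of_nonneg_right hb (mul_nonneg (hc.nn p.1) (hc.nn p.2.2))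
        calc _ ≤ Jd K n u p * f (p.1 - p.2.1) := mul_le_mul_of_nonneg_left (by linarith) hJ
          _ = hatm (p.1 - p.2.1) ^ (-a) * K p.1 p.2.2 p.2.1 * (u p.1 * u p.2.2) := by
            rw [ef, Jd, hKe]; ring
          _ ≤ _ := hb'
          _ = _ := by rw [eG]; ring
      · have ef : f (p.1 - p.2.1) = 0 := indicator_of_notMem (by simpa using hr) _
        have : f (p.1 + p.2.1) + f (p.1 - p.2.1) - 2 * f p.1 ≤ 0 := by linarith
        have := mul_nonpos_of_nonneg_of_nonpos hJ this
        have : 0 ≤ C * G p := by positivity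
        linarith
  have h1 := integral_mono iF (iG.const_mul C) hle
  rw [integral_const_mul] at h1
  refine h1.trans (mul_le_mul_of_nonneg_left ?_ (by linarith))
  have h2 : ∫ p, G p = ∫ w : ℝ × ℝ, ∫ x, G (x, w) := integral_prod_symm G iG
  have e3 : ∫ w : ℝ × ℝ, e * (Ψ w.1 * (Wt a lam w.2 * u w.2)) = e * ((∫ z, Ψ z) * ∫ x, Wt a lam x * u x) := by
    rw [integral_const_mul]
    congr 1
    exact integral_prod_mul (μ := (volume : Measure ℝ)) (ν := (volume : Measure ℝ)) Ψ (fun y => Wt a lam y * u y)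
  rw [h2, ← e3]
  refine integral_mono (Integrable.integral_prod_right iG) ((hF.Pint.mul_prod iW).const_mul e) fun w => ?_
  have e4 : (fun x => G (x, w)) = fun x => ((Ioo w.1 (w.1+ρ)).indicator (fun x => checkm x ^ lam) x * u x) *
      (Ψ w.1 * (Wt a lam w.2 * u w.2)) := by
    ext x
    by_cases hx : x ∈ Ioo w.1 (w.1 + ρ)
    · rw [indicator_of_mem hx]
      exact indicator_of_mem (show (x, w) ∈ {p : ℝ × ℝ × ℝ | p.2.1 < p.1 ∧ p.1 < p.2.1 + ρ} from hx) _
    · rw [indicator_of_notMem hx, zero_mul, zero_mul]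
      exact indicator_of_notMem (show (x, w) ∉ {p : ℝ × ℝ × ℝ | p.2.1 < p.1 ∧ p.1 < p.2.1 + ρ} from hx) _
  show ∫ x, G (x, w) ≤ _
  rw [e4, integral_mul_const]
  exact mul_le_mul_of_nonneg_right (he w.1) (mul_nonneg (hF.Pnn _) (hwn _))

/-- no concentration at the origin -/
lemma E6 (hF : KF K a lam C Ψ) (hg : Dat a lam g0) (hT : 0 < T) :
    ∀ ε > 0, ∃ ρ : ℝ, 0 < ρ ∧ ρ ≤ 1 ∧ ∃ N : ℕ, ∀ n ≥ N, ∀ (c : ℝ → ℝ → ℝ), Sol K n c → (∀ x, c 0 x ≤ g0 x) →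
      ∀ t ∈ Icc 0 T, ∫ x, (Iio ρ).indicator (fun x => hatm x ^ (-a)) x * c t x ≤ ε := by
  have ha := hF.ha; have hl := hF.hl; have hl1 := hF.h1.le
  obtain ⟨M, hM0, hM⟩ := E2 hF hg hT
  intro ε hε
  set P := ∫ z, Ψ z with hP
  have hP0 := hF.P0
  have hC := hF.hC
  set A := 2 * Real.exp (2*1*T) with hAd
  have hA : 0 < A := by positivity
  set ε1 := ε / (2 * A * (C * (P * M) * T + 1)) with hε1
  have hε1p : 0 < ε1 := by positivity
  obtain ⟨δ, hδ, N, hN⟩ := E5 hF hg hT ε1 hε1p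
  obtain ⟨j, hj1, hj2⟩ := (((hat_lim hg hl).eventually (gt_mem_nhds (show 0 < ε / (2*A) by positivity))).and
    ((tendsto_one_div_add_atTop_nhds_zero_nat (𝕜 := ℝ)).eventually (gt_mem_nhds hδ))).exists
  have hρ0 : 0 < 1/((j:ℝ)+1) := by positivity
  have hρ1 : 1/((j:ℝ)+1) ≤ 1 := by
    rw [div_le_one (by positivity)]
    have : (0:ℝ) ≤ j := j.cast_nonneg
    linarith
  set ρ := 1/((j:ℝ)+1) with hρ
  refine ⟨ρ, hρ0, hρ1, N, fun n hn c hS h0 t ht => ?_⟩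
  have n0 := hS.nice le_rfl
  have hf0 : ∀ x, 0 < x → 0 ≤ (Iio ρ).indicator (fun x => hatm x ^ (-a)) x := fun x hx => by
    by_cases h : x ∈ Iio ρ
    · rw [indicator_of_mem h]; exact (Real.rpow_pos_of_pos (hatm_pos hx) _).le
    · rw [indicator_of_notMem h]
  have hfW : ∀ x, 0 < x → (Iio ρ).indicator (fun x => hatm x ^ (-a)) x ≤ Wt a lam x := fun x hx => by
    by_cases h : x ∈ Iio ρ
    · rw [indicator_of_mem h]; exact Wt_ge_hat hl hx
    · rw [indicator_of_notMem h]; exact (Wt_pos a lam hx).le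
  have hG := gronL hF hS hT _ ((Dom.hat (a := a) hl).ind (measurableSet_Iio (a := ρ))) hf0 1 (C * (ε1 * (P * M)))
    one_pos (by positivity) (fun τ hτ => ?_) t ht
  · refine hG.trans ?_
    have h1 := hg.init ha hl n0 h0 ((hatm_meas.pow_const _).indicator measurableSet_Iio) hf0 hfW
    have h2 := mul_le_mul_of_nonneg_left h1 hA.le
    have h3 : A * (∫ x, (Iio ρ).indicator (fun x => hatm x ^ (-a)) x * g0 x) ≤ ε/2 := by
      rw [lt_div_iff₀ (by positivity)] at hj1
      linarith
    have h4 : A * (C * (ε1 * (P * M)) * T) ≤ ε/2 := by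
      have hne : C*(P*M)*T+1 ≠ 0 := by
        have hP0' : 0 ≤ P := hP0
        positivity
      have e : A * ((C*(P*M)*T+1) * ε1) = ε/2 := by
        rw [hε1]; generalize C*(P*M)*T+1 = q at hne ⊢; field_simp
      nlinarith
    set X := ∫ x, (Iio ρ).indicator (fun x => hatm x ^ (-a)) x * c 0 x
    calc 2 * (X + C * (ε1 * (P * M)) * T) * Real.exp (2*1*T)
        = A * X + A * (C * (ε1 * (P * M)) * T) := by rw [hAd]; ring
      _ ≤ ε := by linarith
  · have nt := hS.nice hτ.1
    have hq := Q6 hF nt (ρ := ρ) (e := ε1) (fun z => hN n hn c hS h0 τ hτ _ measurableSet_Ioo (by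
      rw [Real.volume_Ioo]; exact ENNReal.ofReal_le_ofReal (by linarith)))
    refine hq.trans ?_
    have k1 := hM n c hS h0 τ hτ
    have k2 := nt.nonneg hf0
    rw [← hP]
    have : C * (ε1 * (P * ∫ x, Wt a lam x * c τ x)) ≤ C * (ε1 * (P * M)) := by gcongr
    linarith

end


section
variable {K : ℝ → ℝ → ℝ → ℝ} {a lam C : ℝ} {Ψ : ℝ → ℝ} {g0 : ℝ → ℝ} {T : ℝ}

/-- weight of the space Y -/
def wf (a lam x : ℝ) : ℝ := x ^ (-a) + x ^ lam

lemma wf_meas : Measurable (wf a lam) := (measurable_id.pow_const _).add (measurable_id.pow_const _)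

lemma wf_pos {x : ℝ} (hx : 0 < x) : 0 < wf a lam x :=
  add_pos (Real.rpow_pos_of_pos hx _) (Real.rpow_pos_of_pos hx _)

lemma wf_dom (ha : 0 ≤ a) (hl : 0 ≤ lam) : Dom a lam (wf a lam) :=
  ⟨wf_meas, 2, fun x hx => by rw [abs_of_pos (wf_pos hx)]; exact le_Wt ha hl hx⟩

lemma E7 (hF : KF K a lam C Ψ) (hg : Dat a lam g0) (hT : 0 < T) :
    ∀ ε > 0, ∃ δ : ℝ, 0 < δ ∧ ∃ R : ℝ, ∃ N : ℕ, ∀ n ≥ N, ∀ (c : ℝ → ℝ → ℝ), Sol K n c → (∀ x, c 0 x ≤ g0 x) →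
      ∀ t ∈ Icc 0 T, ∀ A : Set ℝ, MeasurableSet A → volume (A ∩ Icc (-R) R) ≤ ENNReal.ofReal δ →
       ∫ x in A, wf a lam x * c t x ≤ ε := by
  have ha := hF.ha; have hl := hF.hl; have hl1 := hF.h1.le
  intro ε hε
  obtain ⟨ρ, hρ0, hρ1, N1, hN1⟩ := E6 hF hg hT (ε/6) (by positivity)
  set κ := hatm ρ ^ (-a) with hκ
  have hκ0 : 0 < κ := Real.rpow_pos_of_pos (hatm_pos hρ0) _
  obtain ⟨R, hR1, hR⟩ := E3 hF hg hT (ε/(6*κ)) (by positivity)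
  obtain ⟨δ, hδ, N2, hN2⟩ := E5 hF hg hT (ε/(6*κ)) (by positivity)
  refine ⟨δ, hδ, R, max N1 N2, fun n hn c hS h0 t ht A hA hvol => ?_⟩
  have nt := hS.nice ht.1
  have hB : MeasurableSet (A ∩ Icc (-R) R) := hA.inter measurableSet_Icc
  have k1 := hN1 n (le_of_max_le_left hn) c hS h0 t ht
  have k2 := hR n c hS h0 t ht
  have k3 := hN2 n (le_of_max_le_right hn) c hS h0 t ht _ hB hvol
  set V1 := (Iio ρ).indicator (fun x => hatm x ^ (-a)) with hV1
  set V2 := (Ici R).indicator (fun x => checkm x ^ lam) with hV2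
  set V3 := (A ∩ Icc (-R) R).indicator (fun x => checkm x ^ lam) with hV3
  have d1 : Dom a lam V1 := (Dom.hat hl).ind measurableSet_Iio
  have d2 : Dom a lam V2 := (Dom.check ha).ind measurableSet_Ici
  have d3 : Dom a lam V3 := (Dom.check ha).ind hB
  have e1 : ∫ x in A, wf a lam x * c t x = ∫ x, A.indicator (wf a lam) x * c t x := by
    rw [← integral_indicator hA]; congr 1; ext x; by_cases hx : x ∈ A <;> simp [hx]
  have dd := (d2.add d3).cmul κ
  have h := nt.mono ha hl ((wf_dom ha hl).ind hA) ((d1.add dd).cmul 2) (fun x hx => by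
    have p1 : 0 ≤ V1 x := by
      by_cases h : x ∈ Iio ρ
      · rw [hV1, indicator_of_mem h]; exact (Real.rpow_pos_of_pos (hatm_pos hx) _).le
      · rw [hV1, indicator_of_notMem h]
    have p2 : 0 ≤ V2 x := indicator_nonneg (fun x _ => (Real.rpow_pos_of_pos (checkm_pos x) _).le) x
    have p3 : 0 ≤ V3 x := indicator_nonneg (fun x _ => (Real.rpow_pos_of_pos (checkm_pos x) _).le) x
    by_cases hxA : x ∈ A
    · rw [indicator_of_mem hxA]
      refine (le_Wt ha hl hx).trans (mul_le_mul_of_nonneg_left ?_ zero_le_two)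
      by_cases hr : x < ρ
      · have : V1 x = hatm x ^ (-a) := by rw [hV1, indicator_of_mem (mem_Iio.2 hr)]
        have e : checkm x = 1 := max_eq_left (hr.le.trans hρ1)
        rw [this]; unfold Wt
        rw [e, Real.one_rpow, mul_one]
        have : 0 ≤ κ * (V2 x + V3 x) := by positivity
        linarith
      · push Not at hr
        have q1 : hatm x ^ (-a) ≤ κ := hatm_rpow_anti ha hρ0 hr
        have q2 : checkm x ^ lam ≤ V2 x + V3 x := by
          by_cases hR' : R ≤ x
          · have : V2 x = checkm x ^ lam := by rw [hV2, indicator_of_mem (mem_Ici.2 hR')]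
            linarith
          · push Not at hR'
            have : V3 x = checkm x ^ lam := by
              rw [hV3, indicator_of_mem (show x ∈ A ∩ Icc (-R) R from ⟨hxA, by linarith, hR'.le⟩)]
            linarith
        have q3 : 0 < checkm x ^ lam := Real.rpow_pos_of_pos (checkm_pos x) _
        have : Wt a lam x ≤ κ * (V2 x + V3 x) := mul_le_mul q1 q2 q3.le hκ0.le
        linarith
    · rw [indicator_of_notMem hxA]; positivity)
  rw [int_cmul, Dom.int_add ha hl nt d1 dd, int_cmul, Dom.int_add ha hl nt d2 d3] at h
  rw [e1]
  refine h.trans ?_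
  have : κ * ((∫ x, V2 x * c t x) + ∫ x, V3 x * c t x) ≤ κ * (ε/(6*κ) + ε/(6*κ)) := by gcongr
  have e2 : κ * (ε/(6*κ) + ε/(6*κ)) = ε/3 := by field_simp; norm_num
  linarith

lemma E8 (hF : KF K a lam C Ψ) (hg : Dat a lam g0) (hT : 0 < T) :
    ∀ ε > 0, ∃ η : ℝ, 0 < η ∧ ∀ n, ∀ (c : ℝ → ℝ → ℝ), Sol K n c → (∀ x, c 0 x ≤ g0 x) →
      ∀ s t, 0 ≤ s → s ≤ t → t ≤ T → t - s ≤ η → ∀ A : Set ℝ, MeasurableSet A →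
       |(∫ x in A, wf a lam x * c t x) - ∫ x in A, wf a lam x * c s x| ≤ ε := by
  have ha := hF.ha; have hl := hF.hl; have hl1 := hF.h1.le
  intro ε hε
  obtain ⟨R, hR1, hR⟩ := E3 hF hg hT (ε/8) (by positivity)
  obtain ⟨L, hL0, hL⟩ := E4 hF hg hT
  have hR0 : 0 < R := by linarith
  set Q := R ^ lam with hQ
  have hQ0 : 0 < Q := Real.rpow_pos_of_pos hR0 _
  refine ⟨ε/(4*(Q*L)), by positivity, fun n c hS h0 s t hs hst ht hη A hA => ?_⟩
  have nt := hS.nice (hs.trans hst)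
  have ns := hS.nice hs
  obtain ⟨i0, k0⟩ := hL n c hS h0 s t hs hst ht
  have k1 := hR n c hS h0 t ⟨hs.trans hst, ht⟩
  have k2 := hR n c hS h0 s ⟨hs, hst.trans ht⟩
  have it := (wf_dom ha hl).int ha hl nt
  have is := (wf_dom ha hl).int ha hl ns
  have d2 : Dom a lam ((Ici R).indicator (fun x => checkm x ^ lam)) := (Dom.check ha).ind measurableSet_Ici
  set V2 := (Ici R).indicator (fun x => checkm x ^ lam) with hV2
  have j1 := d2.int ha hl nt
  have j2 := d2.int ha hl ns
  rw [← integral_sub it.integrableOn is.integrableOn]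
  refine abs_integral_le_integral_abs.trans ?_
  have iab : Integrable (fun x => |wf a lam x * c t x - wf a lam x * c s x|) := (it.sub is).abs
  refine (setIntegral_le_integral iab (Filter.Eventually.of_forall fun x => abs_nonneg _)).trans ?_
  have h := integral_mono iab ((i0.const_mul (2*Q)).add ((j1.add j2).const_mul 2)) (fun x => by
    show |wf a lam x * c t x - wf a lam x * c s x| ≤ 2*Q*(hatm x ^ (-a) * |c t x - c s x|) +
      2 * (V2 x * c t x + V2 x * c s x)
    by_cases hx : x ∈ Ioo (1/(n:ℝ)) n
    · have hx0 := (inv_pos_n n).trans_lt hx.1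
      have p1 := nt.nn x
      have p2 := ns.nn x
      have p3 : 0 ≤ V2 x := indicator_nonneg (fun x _ => (Real.rpow_pos_of_pos (checkm_pos x) _).le) x
      have p4 : 0 < hatm x ^ (-a) := Real.rpow_pos_of_pos (hatm_pos hx0) _
      have p5 := le_Wt ha hl hx0
      rw [← mul_sub, abs_mul, abs_of_pos (wf_pos hx0)]
      by_cases hr : R ≤ x
      · have e : V2 x = checkm x ^ lam := by rw [hV2, indicator_of_mem (mem_Ici.2 hr)]
        have e1 : hatm x = 1 := min_eq_left (hR1.trans hr)
        have e2 : Wt a lam x = V2 x := by unfold Wt; rw [e, e1, Real.one_rpow, one_mul]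
        have : |c t x - c s x| ≤ c t x + c s x := by rw [abs_le]; constructor <;> linarith
        have q : wf a lam x * |c t x - c s x| ≤ 2 * V2 x * (c t x + c s x) :=
          mul_le_mul (by rw [← e2]; exact p5) this (abs_nonneg _) (by positivity)
        have : 0 ≤ 2*Q*(hatm x ^ (-a) * |c t x - c s x|) := by positivity
        linarith
      · push Not at hr
        have q1 : checkm x ^ lam ≤ Q := Real.rpow_le_rpow (checkm_pos x).le (max_le hR1 hr.le) hl
        have q2 : wf a lam x ≤ 2 * Q * hatm x ^ (-a) := by
          refine p5.trans ?_
          unfold Wt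
          have := mul_le_mul_of_nonneg_left q1 p4.le
          linarith
        have q3 := mul_le_mul_of_nonneg_right q2 (abs_nonneg (c t x - c s x))
        have : 0 ≤ 2 * (V2 x * c t x + V2 x * c s x) := by positivity
        linarith
    · simp [nt.z x hx, ns.z x hx])
  refine h.trans ?_
  have e : ∫ x, (2*Q*(hatm x ^ (-a) * |c t x - c s x|) + 2 * (V2 x * c t x + V2 x * c s x)) =
      2*Q*(∫ x, hatm x ^ (-a) * |c t x - c s x|) + 2 * ((∫ x, V2 x * c t x) + ∫ x, V2 x * c s x) := by
    rw [← integral_add j1 j2, ← integral_const_mul, ← integral_const_mul]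
    exact integral_add (i0.const_mul (2*Q)) ((j1.add j2).const_mul 2)
  refine e.le.trans ?_
  have : 2*Q*(∫ x, hatm x ^ (-a) * |c t x - c s x|) ≤ 2*Q*(L*(ε/(4*(Q*L)))) := by
    gcongr
    exact k0.trans (by gcongr)
  have e2 : 2*Q*(L*(ε/(4*(Q*L)))) = ε/2 := by field_simp; norm_num
  linarith

lemma Dat_of {c0 : ℝ → ℝ} (h : MemYplus a lam c0) :
    Dat a lam ((Ioi 0).indicator fun x => |c0 x|) where
  m := h.1.1.abs.indicator measurableSet_Ioi
  nn := fun x => indicator_nonneg (fun _ _ => abs_nonneg _) x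
  z := fun x hx => indicator_of_notMem (by simpa using hx) _
  i := by
    have := (integrable_indicator_iff measurableSet_Ioi).2 h.1.2
    refine this.mono' ((Wt_meas a lam).mul (h.1.1.abs.indicator measurableSet_Ioi)).aestronglyMeasurable
      (Filter.Eventually.of_forall fun x => ?_)
    by_cases hx : x ∈ Ioi (0:ℝ)
    · rw [indicator_of_mem hx, indicator_of_mem hx, Real.norm_eq_abs, abs_mul, abs_abs,
        abs_of_pos (Wt_pos a lam hx)]
      exact mul_le_mul_of_nonneg_right (Wt_le hx) (abs_nonneg _)
    · rw [indicator_of_notMem hx, indicator_of_notMem hx]; simp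
end

/-- Compactness of the truncated solutions. -/
theorem truncated_compactness
    (K : ℝ → ℝ → ℝ → ℝ) (μ ν a : ℝ) (φ : ℝ → ℝ)
    (hK : IsKernel K) (hA : GlobalExistenceAssumption K μ ν a φ)
    (c₀ : ℝ → ℝ) (hc₀ : MemYplus a (max μ ν) c₀)
    (cn : ℕ → ℝ → ℝ → ℝ)
    (hsol : ∀ n : ℕ, 2 ≤ n → IsTruncatedSolution K n (cn n))
    (hnn : ∀ n : ℕ, 2 ≤ n → ∀ t x : ℝ, 0 ≤ t → 0 ≤ cn n t x)
    (hinit : ∀ n : ℕ, 2 ≤ n → ∀ x : ℝ,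
      cn n 0 x = Set.indicator (Ioo (1/(n:ℝ)) (n:ℝ)) c₀ x)
    (T : ℝ) (hT : 0 < T) :
    ∃ ns : ℕ → ℕ, StrictMono ns ∧ (∀ k, 2 ≤ ns k) ∧
      ∃ c : ℝ → ℝ → ℝ,
        (∀ t ∈ Icc (0:ℝ) T, MemYplus a (max μ ν) (c t)) ∧
        (∀ g : ℝ → ℝ, BddMeas g →
          Tendsto (fun k => ⨆ t ∈ Icc (0:ℝ) T,
              |∫ x in Ioi (0:ℝ),
                g x * (x ^ (-a) + x ^ (max μ ν)) * (cn (ns k) t x - c t x)|)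
            atTop (𝓝 0)) ∧
        (∃ C > 0, ∀ s t : ℝ, 0 ≤ s → s ≤ t → t ≤ T →
          (∫ x in Ioi (0:ℝ), |c t x - c s x| * hatm x ^ (-a)) ≤ C * (t - s)) := by
  obtain ⟨_, C, hF⟩ := KF_of K μ ν a φ hK hA
  have hg := Dat_of hc₀
  set lam := max μ ν with hlam
  set g0 : ℝ → ℝ := (Ioi 0).indicator fun x => |c₀ x| with hg0
  have ha := hF.ha; have hl := hF.hl
  have hS : ∀ n : ℕ, Sol K (n+2) (cn (n+2)) := fun n => ⟨hsol _ (by omega), hnn _ (by omega)⟩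
  have h0 : ∀ n : ℕ, ∀ x, cn (n+2) 0 x ≤ g0 x := fun n x => by
    rw [hinit _ (by omega)]
    by_cases hx : x ∈ Ioo (1/((n+2:ℕ):ℝ)) ((n+2:ℕ):ℝ)
    · have hx0 : x ∈ Ioi (0:ℝ) := (inv_pos_n (n+2)).trans_lt hx.1
      rw [indicator_of_mem hx, hg0, indicator_of_mem hx0]; exact le_abs_self _
    · rw [indicator_of_notMem hx]; exact hg.nn x
  set F : ℕ → ℝ → ℝ → ℝ := fun n t x => wf a lam x * cn (n+2) t x with hFd
  have hz : ∀ n t x, x ≤ 0 → cn (n+2) t x = 0 := fun n t x hx =>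
    (hS n).s.zero_outside t x (fun h => absurd ((inv_pos_n (n+2)).trans_lt h.1) (by linarith))
  have hint : ∀ n, ∀ t ∈ Icc 0 T, Integrable (F n t) := fun n t ht =>
    (wf_dom ha hl).int ha hl ((hS n).nice ht.1)
  have hFnn : ∀ n, ∀ t ∈ Icc 0 T, ∀ x, 0 ≤ F n t x := fun n t ht x => by
    rcases le_or_gt x 0 with hx | hx
    · show 0 ≤ wf a lam x * cn (n+2) t x
      rw [hz n t x hx, mul_zero]
    · exact mul_nonneg (wf_pos hx).le ((hS n).nn t x ht.1)
  obtain ⟨M, hM0, hM⟩ := E2 hF hg hT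
  have hFM : ∀ n, ∀ t ∈ Icc 0 T, ∫ x, F n t x ≤ 2*M := fun n t ht => by
    have nt := (hS n).nice ht.1
    have := nt.mono ha hl (wf_dom ha hl) ((Dom.Wt (a := a) (lam := lam)).cmul 2) (fun x hx => le_Wt ha hl hx)
    rw [int_cmul] at this
    have := hM _ _ (hS n) (h0 n) t ht
    show ∫ x, wf a lam x * cn (n+2) t x ≤ 2*M
    linarith
  obtain ⟨L, hL0, hL⟩ := E4 hF hg hT
  obtain ⟨ns, hns, f, hf, hcv⟩ := abs_compact T hT F hint hFnn (2*M) hFM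
    (fun ε hε => by
      obtain ⟨δ, hδ, R, N, h⟩ := E7 hF hg hT ε hε
      exact ⟨δ, hδ, R, N, fun n hn t ht A hA hv => h (n+2) (by omega) _ (hS n) (h0 n) t ht A hA hv⟩)
    (fun ε hε => by
      obtain ⟨η, hη, h⟩ := E8 hF hg hT ε hε
      refine ⟨η, hη, 0, fun n _ s hs t ht hd A hA => ?_⟩
      rcases le_total s t with hst | hst
      · exact h _ _ (hS n) (h0 n) s t hs.1 hst ht.2 ((le_abs_self _).trans hd) A hA
      · rw [abs_sub_comm]
        exact h _ _ (hS n) (h0 n) t s ht.1 hst hs.2 (by rw [abs_sub_comm] at hd; exact (le_abs_self _).trans hd) A hA)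
  have hcb := conv_bdd T (fun k => F (ns k)) f (fun k => hint _) (fun k => hFnn _) hf (2*M) (by positivity)
    (fun k => hFM _) hcv
  have hwc : ∀ t x, 0 < x → wf a lam x * ((Ioi 0).indicator (fun x => f t x / wf a lam x) x) = f t x := by
    intro t x hx
    rw [indicator_of_mem (mem_Ioi.2 hx)]
    exact mul_div_cancel₀ _ (wf_pos hx).ne'
  refine ⟨fun k => ns k + 2, fun i j hij => by have := hns hij; show ns i + 2 < ns j + 2; omega, fun k => Nat.le_add_left 2 (ns k),
    fun t x => (Ioi 0).indicator (fun x => f t x / wf a lam x) x, fun t ht => ?_, fun g hgb => ?_, L, hL0,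
    fun s t hs hst ht => ?_⟩
  · obtain ⟨m, nn, i⟩ := hf t ht
    have hnn' : ∀ x, 0 ≤ (Ioi 0).indicator (fun x => f t x / wf a lam x) x := fun x =>
      indicator_nonneg (fun x hx => div_nonneg (nn x) (wf_pos hx).le) x
    refine ⟨⟨(m.div wf_meas).indicator measurableSet_Ioi, ?_⟩, Filter.Eventually.of_forall hnn'⟩
    refine (i.integrableOn (s := Ioi 0)).congr_fun (fun x hx => ?_) measurableSet_Ioi
    show f t x = wf a lam x * |(Ioi 0).indicator (fun x => f t x / wf a lam x) x|
    rw [abs_of_nonneg (hnn' x), hwc t x hx]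
  · obtain ⟨hgm, B, hB⟩ := hgb
    have hB0 : 0 ≤ B := (abs_nonneg _).trans (hB 0)
    have hk := hcb ((Ioi 0).indicator g) (hgm.indicator measurableSet_Ioi) B (fun x => by
      by_cases hx : x ∈ Ioi (0:ℝ)
      · rw [indicator_of_mem hx]; exact hB x
      · rw [indicator_of_notMem hx, abs_zero]; exact hB0)
    rw [Metric.tendsto_atTop]
    intro ε hε
    obtain ⟨k0, hk0⟩ := hk (ε/2) (by positivity)
    refine ⟨k0, fun k hkk => ?_⟩
    rw [Real.dist_0_eq_abs, abs_of_nonneg (Real.iSup_nonneg fun t => Real.iSup_nonneg fun _ => abs_nonneg _)]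
    refine lt_of_le_of_lt (Real.iSup_le (fun t => Real.iSup_le (fun ht => ?_) (by positivity)) (by positivity))
      (half_lt_self hε)
    refine le_of_eq_of_le ?_ (hk0 k hkk t ht)
    rw [← integral_indicator measurableSet_Ioi]
    congr 1
    refine integral_congr_ae (Filter.Eventually.of_forall fun x => ?_)
    show (Ioi 0).indicator (fun x => g x * wf a lam x *
      (cn (ns k + 2) t x - (Ioi 0).indicator (fun x => f t x / wf a lam x) x)) x =
      (Ioi 0).indicator g x * (wf a lam x * cn (ns k + 2) t x - f t x)
    by_cases hx : x ∈ Ioi (0:ℝ)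
    · rw [indicator_of_mem hx, indicator_of_mem hx g, ← hwc t x hx]; ring
    · rw [indicator_of_notMem hx, indicator_of_notMem hx, zero_mul]
  · have hsI : s ∈ Icc 0 T := ⟨hs, hst.trans ht⟩
    have htI : t ∈ Icc 0 T := ⟨hs.trans hst, ht⟩
    obtain ⟨ms, nns, is⟩ := hf s hsI
    obtain ⟨mt, nnt, it⟩ := hf t htI
    set σ : ℝ → ℝ := fun x => if f s x ≤ f t x then 1 else -1 with hσ
    have hσm : Measurable σ := Measurable.ite (measurableSet_le ms mt) measurable_const measurable_const
    have hσa : ∀ x, |σ x| = 1 := fun x => by rw [hσ]; dsimp only; split_ifs <;> simp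
    have hσd : ∀ x, σ x * (f t x - f s x) = |f t x - f s x| := fun x => by
      rw [hσ]; dsimp only; split_ifs with h
      · rw [one_mul, abs_of_nonneg (by linarith)]
      · rw [abs_of_neg (by linarith)]; ring
    set g : ℝ → ℝ := (Ioi 0).indicator (fun x => σ x * (hatm x ^ (-a) / wf a lam x)) with hgd
    have hgm : Measurable g := (hσm.mul ((hatm_meas.pow_const _).div wf_meas)).indicator measurableSet_Ioi
    have hq : ∀ x, 0 < x → 0 < hatm x ^ (-a) := fun x hx => Real.rpow_pos_of_pos (hatm_pos hx) _
    have hgb : ∀ x, |g x| ≤ 1 := fun x => by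
      by_cases hx : x ∈ Ioi (0:ℝ)
      · have hx0 : 0 < x := hx
        rw [hgd, indicator_of_mem hx, abs_mul, hσa, one_mul,
          abs_of_pos (div_pos (hq x hx0) (wf_pos hx0)), div_le_one (wf_pos hx0)]
        exact (Wt_ge_hat hl hx0).trans (Wt_le hx0)
      · rw [hgd, indicator_of_notMem hx, abs_zero]; exact zero_le_one
    have hgi : ∀ u : ℝ → ℝ, Integrable u → Integrable (fun x => g x * u x) := fun u hu =>
      hu.bdd_mul hgm.aestronglyMeasurable (Filter.Eventually.of_forall hgb)
    have e1 : ∫ x in Ioi (0:ℝ), |(Ioi 0).indicator (fun x => f t x / wf a lam x) x -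
        (Ioi 0).indicator (fun x => f s x / wf a lam x) x| * hatm x ^ (-a) = ∫ x, g x * (f t x - f s x) := by
      rw [← integral_indicator measurableSet_Ioi]
      congr 1; ext x
      by_cases hx : x ∈ Ioi (0:ℝ)
      · have hx0 : 0 < x := hx
        rw [indicator_of_mem hx, indicator_of_mem hx, indicator_of_mem hx, hgd, indicator_of_mem hx,
          ← sub_div, abs_div, abs_of_pos (wf_pos hx0), ← hσd]
        ring
      · rw [indicator_of_notMem hx, hgd, indicator_of_notMem hx, zero_mul]
    show ∫ x in Ioi (0:ℝ), |(Ioi 0).indicator (fun x => f t x / wf a lam x) x -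
        (Ioi 0).indicator (fun x => f s x / wf a lam x) x| * hatm x ^ (-a) ≤ L * (t - s)
    rw [e1]
    refine le_of_forall_pos_le_add fun ε hε => ?_
    obtain ⟨k0, hk0⟩ := hcb g hgm 1 hgb (ε/2) (by positivity)
    have b1 := abs_le.1 (hk0 k0 le_rfl t htI)
    have b2 := abs_le.1 (hk0 k0 le_rfl s hsI)
    obtain ⟨i0, b3⟩ := hL _ _ (hS (ns k0)) (h0 (ns k0)) s t hs hst ht
    have iFt := hint (ns k0) t htI
    have iFs := hint (ns k0) s hsI
    have b4 : ∫ x, g x * (F (ns k0) t x - F (ns k0) s x) ≤ L * (t - s) := by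
      refine (integral_mono (hgi _ (iFt.sub iFs)) i0 fun x => ?_).trans b3
      show g x * (wf a lam x * cn (ns k0 + 2) t x - wf a lam x * cn (ns k0 + 2) s x) ≤
        hatm x ^ (-a) * |cn (ns k0 + 2) t x - cn (ns k0 + 2) s x|
      by_cases hx : x ∈ Ioi (0:ℝ)
      · have hx0 : 0 < x := hx
        have hw := wf_pos (a := a) (lam := lam) hx0
        have e : g x * (wf a lam x * cn (ns k0 + 2) t x - wf a lam x * cn (ns k0 + 2) s x) =
            hatm x ^ (-a) * (σ x * (cn (ns k0 + 2) t x - cn (ns k0 + 2) s x)) := by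
          rw [hgd, indicator_of_mem hx]; field_simp
        rw [e]
        refine mul_le_mul_of_nonneg_left ?_ (hq x hx0).le
        refine (le_abs_self _).trans ?_
        rw [abs_mul, hσa, one_mul]
      · rw [hz _ t x (by simpa using hx), hz _ s x (by simpa using hx)]; simp
    have e2 : ∫ x, g x * (f t x - f s x) = (∫ x, g x * (F (ns k0) t x - F (ns k0) s x))
        - (∫ x, g x * (F (ns k0) t x - f t x)) + ∫ x, g x * (F (ns k0) s x - f s x) := by
      have j1 := hgi _ (iFt.sub iFs)
      have j2 := hgi _ (iFt.sub it)
      have j3 := hgi _ (iFs.sub is)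
      simp only [Pi.sub_apply] at j1 j2 j3
      have j4 : Integrable (fun x => g x * (F (ns k0) t x - F (ns k0) s x) - g x * (F (ns k0) t x - f t x)) := j1.sub j2
      rw [← integral_sub j1 j2, ← integral_add j4 j3]
      congr 1; ext x; ring
    rw [e2]
    linarith [b1.1, b2.2]
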